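/- The set of formulas of the basic temporal language that are valid on the frame (ℝ², ⪯), where ⪯ is the reflexive closure of ≺ (i.e., (x,y) ⪯ (x',y') iff (x,y) = (x',y') or (x < x' and y < y')), is decidable: there exists a computable total function from formulas to Bool that returns true exactly on the valid formulas. -/

import Mathlib

/-- Formulas of the basic temporal language. -/
inductive Formula : Type
  | var : ℕ → Formula
  | neg : Formula → Formula
  | or : Formula → Formula → Formula
  | F : Formula → Formula
  | P : Formula → Formula

/-- Satisfaction of a formula at a world, given a frame `(W, R)` and valuation `v`. -/
def Sat {W : Type} (R : W → W → Prop) (v : ℕ → Set W) : W → Formula → Prop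
  | w, Formula.var n => w ∈ v n
  | w, Formula.neg φ => ¬ Sat R v w φ
  | w, Formula.or φ ψ => Sat R v w φ ∨ Sat R v w ψ
  | w, Formula.F φ => ∃ u, R w u ∧ Sat R v u φ
  | w, Formula.P φ => ∃ u, R u w ∧ Sat R v u φ

/-- Validity of a formula on a frame. -/
def Valid {W : Type} (R : W → W → Prop) (φ : Formula) : Prop :=
  ∀ (v : ℕ → Set W) (w : W), Sat R v w φ

/-- The irreflexive slower-than-light relation on ℝ². -/
def slt (a b : ℝ × ℝ) : Prop := a.1 < b.1 ∧ a.2 < b.2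

/-- An injective encoding of formulas as natural numbers. -/
def Formula.enc : Formula → ℕ
  | Formula.var n => Nat.pair 0 n
  | Formula.neg φ => Nat.pair 1 φ.enc
  | Formula.or φ ψ => Nat.pair 2 (Nat.pair φ.enc ψ.enc)
  | Formula.F φ => Nat.pair 3 φ.enc
  | Formula.P φ => Nat.pair 4 φ.enc

/-- The reflexive closure of `≺`. -/
def sltRefl (a b : ℝ × ℝ) : Prop := a = b ∨ slt a b

namespace TL

/-- Bit membership. -/
def Mem (i n : ℕ) : Prop := n.testBit i = true

abbrev Ltr := ℕ × ℕ
abbrev Ltr2 := Ltr × Ltr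
abbrev Tri := Ltr × Ltr × Ltr
abbrev Item := List Ltr2 × List Ltr2 × ℕ

def Le (a b : Ltr) : Prop := (∀ i, Mem i b.1 → Mem i a.1) ∧ (∀ i, Mem i a.2 → Mem i b.2)

def L2 (p q : Ltr2) : Prop := Le p.1 q.1 ∧ Le p.2 q.2
def L3 (p q : Tri) : Prop := Le p.1 q.1 ∧ Le p.2.1 q.2.1 ∧ Le p.2.2 q.2.2

def Rl (N : ℕ) (a : Ltr) : Prop := Mem N a.1 ∧ Mem N a.2

def ConsI (i o : ℕ) (f p : ℕ → Prop) : Prop :=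
  (i.unpair.1 = 1 → (Mem i o ↔ ¬ Mem i.unpair.2 o)) ∧
  (i.unpair.1 = 2 → (Mem i o ↔ (Mem i.unpair.2.unpair.1 o ∨ Mem i.unpair.2.unpair.2 o))) ∧
  (i.unpair.1 = 3 → (Mem i o ↔ f i.unpair.2)) ∧
  (i.unpair.1 = 4 → (Mem i o ↔ p i.unpair.2))

def B (N : ℕ) (a b : Ltr) (o : ℕ) : Prop :=
  o < 2 ^ (N + 1) ∧ Mem N o ∧ (∀ i, Mem i o → Mem i a.1 ∧ Mem i b.2) ∧
    ∀ i, i < N → ConsI i o (fun k => Mem k b.1 ∨ Mem k o) (fun k => Mem k a.2 ∨ Mem k o)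

def Adm (N : ℕ) (a b : Ltr) : Prop := ∃ o, o < 2 ^ (N + 1) ∧ B N a b o

def IsMin (V : List Ltr2) (p : Ltr2) : Prop := p ∈ V ∧ ∀ q ∈ V, L2 p q
def IsMax (V : List Ltr2) (p : Ltr2) : Prop := p ∈ V ∧ ∀ q ∈ V, L2 q p

def Rng (it : Item) (a b : Ltr) : Prop :=
  (∃ p ∈ it.1, IsMin it.1 p ∧ p.1 = a) ∧ (∃ p ∈ it.1, IsMax it.1 p ∧ p.2 = b)

def sw (it : Item) : Item := (it.2.1, it.1, it.2.2)

def SplitT (N : ℕ) (T : List Tri) (it : Item) (h : Ltr2) (it1 it2 : Item) : Prop :=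
  h ∈ it.2.1 ∧
  (∀ s ∈ T, ∀ t ∈ T, L3 s t ∨ L3 t s) ∧
  ((∀ p ∈ it.1, ∃ t ∈ T, t.1 = p.1 ∧ t.2.2 = p.2) ∧ ∀ t ∈ T, (t.1, t.2.2) ∈ it.1) ∧
  ((∀ p ∈ it1.1, ∃ t ∈ T, t.1 = p.1 ∧ t.2.1 = p.2) ∧ ∀ t ∈ T, (t.1, t.2.1) ∈ it1.1) ∧
  ((∀ p ∈ it2.1, ∃ t ∈ T, t.2.1 = p.1 ∧ t.2.2 = p.2) ∧ ∀ t ∈ T, (t.2.1, t.2.2) ∈ it2.1) ∧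
  ((∀ k ∈ it1.2.1, k ∈ it.2.1 ∧ L2 k h) ∧ ∀ k ∈ it.2.1, L2 k h → k ∈ it1.2.1) ∧
  ((∀ k ∈ it2.2.1, k ∈ it.2.1 ∧ L2 h k) ∧ ∀ k ∈ it.2.1, L2 h k → k ∈ it2.2.1) ∧
  (∀ t ∈ T, (Le t.1 t.2.1 ∧ Le t.2.1 t.2.2) ∧ (Le h.1 t.2.1 ∧ Le t.2.1 h.2) ∧
    Rl N t.2.1 ∧ Adm N t.2.1 t.2.1) ∧
  ((Rl N h.1 → ∃ t ∈ T, t.2.1 = h.1) ∧ (Rl N h.2 → ∃ t ∈ T, t.2.1 = h.2)) ∧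
  (∀ s ∈ T, ∀ t ∈ T, Le s.2.1 t.2.1 → s.2.1 ≠ t.2.1 →
    (∀ u ∈ T, Le u.2.1 s.2.1 ∨ Le t.2.1 u.2.1) → Adm N s.2.1 t.2.1) ∧
  ((it1.2.2 = it.2.2 ∧ it2.2.2 = 0) ∨ (it1.2.2 = 0 ∧ it2.2.2 = it.2.2))

def ltrs (N : ℕ) : List Ltr := (List.range (2 ^ (N + 1))).product (List.range (2 ^ (N + 1)))
def ltr2s (N : ℕ) : List Ltr2 := (ltrs N).product (ltrs N)
def tris (N : ℕ) : List Tri := (ltrs N).product (ltr2s N)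
def subs {α : Type} (l : List α) : List (List α) :=
  l.foldr (fun a r => r ++ r.map (fun s => a :: s)) [[]]

def SplitV (N : ℕ) (it : Item) (h : Ltr2) (it1 it2 : Item) : Prop :=
  ∃ T ∈ subs (tris N), SplitT N T it h it1 it2

def SplitH (N : ℕ) (it : Item) (h : Ltr2) (it1 it2 : Item) : Prop :=
  SplitV N (sw it) h (sw it1) (sw it2)

/-- a split in any of the two directions -/
def Spl (N : ℕ) (it it1 it2 : Item) : Prop :=
  (∃ h ∈ it.2.1, SplitV N it h it1 it2) ∨ (∃ h ∈ it.1, SplitH N it h it1 it2)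

def CloBase (N : ℕ) (a b : Ltr) (it : Item) : Prop :=
  Rng it a b → (it.2.2 = 0 ∧ Adm N a b) ∨ (it.2.2 ≠ 0 ∧ B N a b it.2.2)

def Clo (N : ℕ) (D : List Item) (a b : Ltr) (it : Item) : Prop :=
  ∀ X ∈ subs D, (∀ j ∈ D, (CloBase N a b j ∨ ∃ j1 ∈ X, ∃ j2 ∈ X, Spl N j j1 j2) → j ∈ X) → it ∈ X

/-- `D` contains a copy of the item with a mark containing `i`. -/
def Mk (D : List Item) (it : Item) (i : ℕ) : Prop :=
  ∃ j ∈ D, j.1 = it.1 ∧ j.2.1 = it.2.1 ∧ Mem i j.2.2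

def Dem (N : ℕ) (D : List Item) (it : Item) (i : ℕ) : Prop :=
  (it.2.2 = 0 ∧ Mk D it i) ∨ (it.2.2 ≠ 0 ∧ Mem i it.2.2) ∨
  (it.2.2 ≠ 0 ∧ ∃ j1 ∈ D, ∃ j2 ∈ D, Spl N it j1 j2 ∧
    ((j1.2.2 = 0 ∧ Mk D j1 i) ∨ (j2.2.2 = 0 ∧ Mk D j2 i)))

def AllR (N : ℕ) (it : Item) : Prop :=
  (∀ p ∈ it.1, Rl N p.1 ∧ Rl N p.2) ∧ (∀ p ∈ it.2.1, Rl N p.1 ∧ Rl N p.2)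

structure Good (N : ℕ) (D : List Item) : Prop where
  cutV : ∀ it ∈ D, ∀ h ∈ it.2.1, ∃ j1 ∈ D, ∃ j2 ∈ D, SplitV N it h j1 j2
  cutH : ∀ it ∈ D, ∀ h ∈ it.1, ∃ j1 ∈ D, ∃ j2 ∈ D, SplitH N it h j1 j2
  clo : ∀ it ∈ D, AllR N it → ∀ p ∈ it.1, ∀ q ∈ it.1, IsMin it.1 p → IsMax it.1 q →
    Clo N D p.1 q.2 it
  demF : ∀ it ∈ D, ∀ p ∈ it.1, ∀ q ∈ it.2.1, IsMin it.1 p → IsMin it.2.1 q → Rl N p.1 → Rl N q.1 →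
    ∀ i, i < N + 1 → Mem i p.1.1 → ¬ Mem i p.2.1 → ¬ Mem i q.2.1 → Dem N D it i
  demP : ∀ it ∈ D, ∀ p ∈ it.1, ∀ q ∈ it.2.1, IsMax it.1 p → IsMax it.2.1 q → Rl N p.2 → Rl N q.2 →
    ∀ i, i < N + 1 → Mem i p.2.2 → ¬ Mem i p.1.2 → ¬ Mem i q.1.2 → Dem N D it i
  insV : ∀ it ∈ D, it.2.2 ≠ 0 →
    (∃ h ∈ it.2.1, ∃ j1 ∈ D, ∃ j2 ∈ D, SplitV N it h j1 j2 ∧ j1.2.2 = it.2.2) ∧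
    (∃ h ∈ it.2.1, ∃ j1 ∈ D, ∃ j2 ∈ D, SplitV N it h j1 j2 ∧ j2.2.2 = it.2.2)
  insH : ∀ it ∈ D, it.2.2 ≠ 0 →
    (∃ h ∈ it.1, ∃ j1 ∈ D, ∃ j2 ∈ D, SplitH N it h j1 j2 ∧ j1.2.2 = it.2.2) ∧
    (∃ h ∈ it.1, ∃ j1 ∈ D, ∃ j2 ∈ D, SplitH N it h j1 j2 ∧ j2.2.2 = it.2.2)

def bot (N : ℕ) : Ltr := (2 ^ (N + 1) - 1, 0)
def top (N : ℕ) : Ltr := (0, 2 ^ (N + 1) - 1)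

def items (N : ℕ) : List Item :=
  (subs (ltr2s N)).product ((subs (ltr2s N)).product (List.range (2 ^ (N + 1))))

/-- The certificate. -/
def Cert (N c : ℕ) : Prop :=
  ∃ D ∈ subs (items N), Good N D ∧ ∃ j ∈ D, j.1 = [(bot N, top N)] ∧ j.2.1 = [(bot N, top N)] ∧
    Mem c j.2.2

/-- Intermediate semantic notion. -/
structure Lab (N c : ℕ) (o : ℝ → ℝ → ℕ) : Prop where
  lt : ∀ x y, 0 < x → x < 1 → 0 < y → y < 1 → o x y < 2 ^ (N + 1)
  mem : ∀ x y, 0 < x → x < 1 → 0 < y → y < 1 → Mem N (o x y)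
  cons : ∀ x y, 0 < x → x < 1 → 0 < y → y < 1 → ∀ i, i < N → ConsI i (o x y)
    (fun k => Mem k (o x y) ∨ ∃ u v, x < u ∧ u < 1 ∧ y < v ∧ v < 1 ∧ Mem k (o u v))
    (fun k => Mem k (o x y) ∨ ∃ u v, 0 < u ∧ u < x ∧ 0 < v ∧ v < y ∧ Mem k (o u v))
  tgt : ∃ x y, 0 < x ∧ x < 1 ∧ 0 < y ∧ y < 1 ∧ Mem c (o x y)

/-! ### Basic lemmas on letters -/

theorem Le.refl (a : Ltr) : Le a a := ⟨fun _ h => h, fun _ h => h⟩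

theorem Le.trans {a b c : Ltr} (h : Le a b) (k : Le b c) : Le a c :=
  ⟨fun i hi => h.1 i (k.1 i hi), fun i hi => k.2 i (h.2 i hi)⟩

theorem mem_ext {m n : ℕ} (h : ∀ i, Mem i m ↔ Mem i n) : m = n := by
  apply Nat.eq_of_testBit_eq
  intro i
  have := h i
  unfold Mem at this
  exact Bool.eq_iff_iff.mpr this

theorem Le.antisymm {a b : Ltr} (h : Le a b) (k : Le b a) : a = b :=
  Prod.ext (mem_ext fun i => ⟨k.1 i, h.1 i⟩) (mem_ext fun i => ⟨h.2 i, k.2 i⟩)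

theorem L2.refl (a : Ltr2) : L2 a a := ⟨Le.refl _, Le.refl _⟩

theorem L2.trans {a b c : Ltr2} (h : L2 a b) (k : L2 b c) : L2 a c :=
  ⟨h.1.trans k.1, h.2.trans k.2⟩

theorem L2.antisymm {a b : Ltr2} (h : L2 a b) (k : L2 b a) : a = b :=
  Prod.ext (h.1.antisymm k.1) (h.2.antisymm k.2)

theorem L3.refl (a : Tri) : L3 a a := ⟨Le.refl _, Le.refl _, Le.refl _⟩

theorem L3.antisymm {a b : Tri} (h : L3 a b) (k : L3 b a) : a = b :=
  Prod.ext (h.1.antisymm k.1) (Prod.ext (h.2.1.antisymm k.2.1) (h.2.2.antisymm k.2.2))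

theorem mem_le {m n : ℕ} (h : ∀ i, Mem i m → Mem i n) : m ≤ n := by
  have : m &&& n = m := by
    apply Nat.eq_of_testBit_eq
    intro i
    have := h i
    unfold Mem at this
    rw [Nat.testBit_and]
    cases hm : m.testBit i <;> simp_all
  rw [← this]
  exact Nat.and_le_right

/-- rank of a letter -/
def rk (a : Ltr) : ℤ := (a.2 : ℤ) - a.1

theorem Le.rk_le {a b : Ltr} (h : Le a b) : rk a ≤ rk b := by
  have h1 := mem_le h.1
  have h2 := mem_le h.2
  unfold rk; omega

theorem Le.eq_of_rk {a b : Ltr} (h : Le a b) (k : rk b ≤ rk a) : a = b := by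
  have h1 := mem_le h.1
  have h2 := mem_le h.2
  unfold rk at k
  exact Prod.ext (by omega) (by omega)

theorem mem_subs {α : Type} (l s : List α) : s ∈ subs l ↔ s.Sublist l := by
  induction l generalizing s with
  | nil => simp [subs]
  | cons a l ih =>
    have : subs (a :: l) = subs l ++ (subs l).map (fun s => a :: s) := rfl
    rw [this, List.mem_append, List.mem_map, ih]
    constructor
    · rintro (h | ⟨t, ht, rfl⟩)
      · exact h.cons a
      · exact ((ih t).1 ht).cons_cons a
    · intro h
      cases h with
      | cons _ h => exact Or.inl h
      | cons_cons _ h => exact Or.inr ⟨_, (ih _).2 h, rfl⟩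

theorem Clo.ind {N : ℕ} {D : List Item} {a b : Ltr} {it : Item} (h : Clo N D a b it)
    (P : Item → Prop)
    (hP : ∀ j ∈ D, (CloBase N a b j ∨ ∃ j1 ∈ D, ∃ j2 ∈ D, P j1 ∧ P j2 ∧ Spl N j j1 j2) → P j) :
    P it := by
  classical
  have := h (D.filter (fun j => P j)) ((mem_subs _ _).2 List.filter_sublist) (by
    intro j hj hh
    rw [List.mem_filter]
    refine ⟨hj, ?_⟩
    simp only [decide_eq_true_eq]
    apply hP j hj
    rcases hh with hh | ⟨j1, h1, j2, h2, hs⟩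
    · exact Or.inl hh
    · rw [List.mem_filter] at h1 h2
      exact Or.inr ⟨j1, h1.1, j2, h2.1, by simpa using h1.2, by simpa using h2.2, hs⟩)
  rw [List.mem_filter] at this
  simpa using this.2

/-! ### Rational points and the lifting lemma -/

def Rt (x : ℝ) : Prop := ¬ Irrational x

theorem rt_btwn {a b : ℝ} (h : a < b) : ∃ x, Rt x ∧ a < x ∧ x < b := by
  obtain ⟨q, h1, h2⟩ := exists_rat_btwn h
  exact ⟨q, fun hh => hh ⟨q, rfl⟩, h1, h2⟩

theorem irr_btwn {a b : ℝ} (h : a < b) : ∃ x, Irrational x ∧ a < x ∧ x < b :=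
  exists_irrational_btwn h

theorem chain_max (rk3 : Tri → ℤ) (hrk : ∀ a b, L3 a b → rk3 a ≤ rk3 b)
    (hrk' : ∀ a b, L3 a b → rk3 b ≤ rk3 a → a = b) (K : Finset Tri) (hK : K.Nonempty)
    (hc : ∀ s ∈ K, ∀ t ∈ K, L3 s t ∨ L3 t s) : ∃ m ∈ K, ∀ s ∈ K, L3 s m := by
  obtain ⟨m, hm, hmax⟩ := K.exists_max_image rk3 hK
  refine ⟨m, hm, fun s hs => ?_⟩
  rcases hc s hs m hm with h | h
  · exact h
  · rw [hrk' m s h (hmax s hs)]; exact L3.refl _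

def rk3 (t : Tri) : ℤ := rk t.1 + rk t.2.1 + rk t.2.2

theorem L3.rk_le {a b : Tri} (h : L3 a b) : rk3 a ≤ rk3 b := by
  have := h.1.rk_le; have := h.2.1.rk_le; have := h.2.2.rk_le
  unfold rk3; omega

theorem L3.eq_of_rk {a b : Tri} (h : L3 a b) (k : rk3 b ≤ rk3 a) : a = b := by
  have h1 := h.1.rk_le; have h2 := h.2.1.rk_le; have h3 := h.2.2.rk_le
  unfold rk3 at k
  exact Prod.ext (h.1.eq_of_rk (by omega))
    (Prod.ext (h.2.1.eq_of_rk (by omega)) (h.2.2.eq_of_rk (by omega)))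

theorem chain_onto : ∀ (n : ℕ) (K : Finset Tri), K.card = n + 1 →
    (∀ s ∈ K, ∀ t ∈ K, L3 s t ∨ L3 t s) → ∀ a b : ℝ, a < b →
    ∃ g : ℝ → Tri, (∀ y y', y ≤ y' → L3 (g y) (g y')) ∧ (∀ y, g y ∈ K) ∧
      (∀ t ∈ K, ∃ y, Rt y ∧ a < y ∧ y < b ∧ g y = t) ∧
      (∀ y, Rt y → ∃ ε > 0, ∀ y', |y' - y| < ε → g y' = g y) := by
  intro n
  induction n with
  | zero =>
    intro K hK hc a b hab
    obtain ⟨t, rfl⟩ := Finset.card_eq_one.1 hK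
    obtain ⟨y, hy, h1, h2⟩ := rt_btwn hab
    refine ⟨fun _ => t, fun _ _ _ => L3.refl _, by simp, ?_, fun _ _ => ⟨1, one_pos, by simp⟩⟩
    intro s hs
    exact ⟨y, hy, h1, h2, (Finset.mem_singleton.1 hs).symm⟩
  | succ n ih =>
    intro K hK hc a b hab
    have hne : K.Nonempty := Finset.card_pos.1 (by omega)
    obtain ⟨m, hm, hmax⟩ := chain_max rk3 (fun _ _ h => h.rk_le) (fun _ _ h k => h.eq_of_rk k) K hne hc
    obtain ⟨θ, hθ, h1, h2⟩ := irr_btwn hab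
    obtain ⟨g, gm, gK, gon, glc⟩ := ih (K.erase m) (by rw [Finset.card_erase_of_mem hm]; omega)
      (fun s hs t ht => hc s (Finset.mem_of_mem_erase hs) t (Finset.mem_of_mem_erase ht)) a θ h1
    classical
    refine ⟨fun y => if y < θ then g y else m, ?_, ?_, ?_, ?_⟩
    · intro y y' h
      by_cases h' : y' < θ
      · simp only [h', lt_of_le_of_lt h h', if_true]; exact gm _ _ h
      · simp only [h', if_false]
        split_ifs
        · exact hmax _ (Finset.mem_of_mem_erase (gK y))
        · exact L3.refl _
    · intro y
      dsimp only
      split_ifs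
      · exact Finset.mem_of_mem_erase (gK y)
      · exact hm
    · intro t ht
      by_cases htm : t = m
      · obtain ⟨y, hy, h3, h4⟩ := rt_btwn h2
        exact ⟨y, hy, by linarith, h4, by simp [not_lt.2 h3.le, htm]⟩
      · obtain ⟨y, hy, h3, h4, h5⟩ := gon t (Finset.mem_erase.2 ⟨htm, ht⟩)
        exact ⟨y, hy, h3, by linarith, by simp [h4, h5]⟩
    · intro y hy
      have hyθ : y ≠ θ := fun h => hy (h ▸ hθ)
      rcases lt_or_gt_of_ne hyθ with h | h
      · obtain ⟨ε, hε, he⟩ := glc y hy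
        refine ⟨min ε (θ - y), lt_min hε (by linarith), fun y' hy' => ?_⟩
        have h3 := lt_of_lt_of_le hy' (min_le_left _ _)
        have h4 := (abs_lt.1 (lt_of_lt_of_le hy' (min_le_right _ _))).2
        simp only [h, show y' < θ by linarith, if_true]
        exact he y' h3
      · refine ⟨y - θ, by linarith, fun y' hy' => ?_⟩
        have h4 := (abs_lt.1 hy').1
        simp [not_lt.2 h.le, show ¬ y' < θ by linarith]

/-- Lifting lemma. -/
theorem lift_lemma (T : List Tri) (hc : ∀ s ∈ T, ∀ t ∈ T, L3 s t ∨ L3 t s) (y0 y1 : ℝ) 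
    (v : ℝ → Ltr2) (hmono : ∀ y y', Rt y → Rt y' → y0 < y → y ≤ y' → y' < y1 → L2 (v y) (v y'))
    (hlc : ∀ y, Rt y → y0 < y → y < y1 →
      ∃ ε > 0, ∀ y', Rt y' → y0 < y' → y' < y1 → |y' - y| < ε → v y' = v y)
    (h1 : ∀ y, Rt y → y0 < y → y < y1 → ∃ t ∈ T, t.1 = (v y).1 ∧ t.2.2 = (v y).2)
    (h2 : ∀ t ∈ T, ∃ y, Rt y ∧ y0 < y ∧ y < y1 ∧ t.1 = (v y).1 ∧ t.2.2 = (v y).2) :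
    ∃ g : ℝ → Tri,
      (∀ y y', Rt y → Rt y' → y0 < y → y ≤ y' → y' < y1 → L3 (g y) (g y')) ∧
      (∀ y, Rt y → y0 < y → y < y1 → g y ∈ T ∧ (g y).1 = (v y).1 ∧ (g y).2.2 = (v y).2) ∧
      (∀ t ∈ T, ∃ y, Rt y ∧ y0 < y ∧ y < y1 ∧ g y = t) ∧
      (∀ y, Rt y → y0 < y → y < y1 →
        ∃ ε > 0, ∀ y', Rt y' → y0 < y' → y' < y1 → |y' - y| < ε → g y' = g y) := by
  classical
  -- a local section for every value
  have key : ∀ p : Ltr2, ∃ g : ℝ → Tri, (∃ y, Rt y ∧ y0 < y ∧ y < y1 ∧ v y = p) →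
      (∀ y y', y ≤ y' → L3 (g y) (g y')) ∧ (∀ y, g y ∈ T ∧ (g y).1 = p.1 ∧ (g y).2.2 = p.2) ∧
      (∀ t ∈ T, t.1 = p.1 → t.2.2 = p.2 → ∃ y, Rt y ∧ y0 < y ∧ y < y1 ∧ v y = p ∧ g y = t) ∧
      (∀ y, Rt y → ∃ ε > 0, ∀ y', |y' - y| < ε → g y' = g y) := by
    intro p
    by_cases hp : ∃ y, Rt y ∧ y0 < y ∧ y < y1 ∧ v y = p
    swap
    · exact ⟨fun _ => default, fun h => absurd h hp⟩
    obtain ⟨y, hy, hy0, hy1, hvy⟩ := hp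
    obtain ⟨ε, hε, he⟩ := hlc y hy hy0 hy1
    let K := T.toFinset.filter (fun t => t.1 = p.1 ∧ t.2.2 = p.2)
    have hKm : ∀ t, t ∈ K ↔ t ∈ T ∧ t.1 = p.1 ∧ t.2.2 = p.2 := by
      intro t; simp [K]
    obtain ⟨t0, ht0, e1, e2⟩ := h1 y hy hy0 hy1
    have ht0K : t0 ∈ K := (hKm _).2 ⟨ht0, by rw [e1, hvy], by rw [e2, hvy]⟩
    have hpos : 0 < K.card := Finset.card_pos.2 ⟨t0, ht0K⟩
    have hb : y < min y1 (y + ε) := lt_min hy1 (by linarith)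
    obtain ⟨g, g1, g2, g3, g4⟩ := chain_onto (K.card - 1) K (by omega)
      (fun s hs t ht => hc s ((hKm _).1 hs).1 t ((hKm _).1 ht).1) y _ hb
    refine ⟨g, fun _ => ⟨g1, fun y => (hKm _).1 (g2 y), fun t ht h3 h4 => ?_, g4⟩⟩
    obtain ⟨y', hy', h5, h6, h7⟩ := g3 t ((hKm _).2 ⟨ht, h3, h4⟩)
    have h8 := lt_of_lt_of_le h6 (min_le_left _ _)
    have h9 := lt_of_lt_of_le h6 (min_le_right _ _)
    refine ⟨y', hy', by linarith, h8, ?_, h7⟩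
    rw [he y' hy' (by linarith) h8 (by rw [abs_lt]; constructor <;> linarith), hvy]
  choose G hG using key
  have hG' : ∀ y, Rt y → y0 < y → y < y1 → _ := fun y hy h h' => hG (v y) ⟨y, hy, h, h', rfl⟩
  refine ⟨fun y => G (v y) y, ?_, ?_, ?_, ?_⟩
  · intro y y' hy hy' h0 hle h1'
    have A := hG' y hy h0 (lt_of_le_of_lt hle h1')
    have A' := hG' y' hy' (lt_of_lt_of_le h0 hle) h1'
    by_cases hv : v y = v y'
    · dsimp only; rw [← hv]; exact A.1 _ _ hle
    · rcases hc _ (A.2.1 y).1 _ (A'.2.1 y').1 with h | h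
      · exact h
      · exfalso
        apply hv
        apply (hmono y y' hy hy' h0 hle h1').antisymm
        refine ⟨?_, ?_⟩
        · have := h.1
          rwa [(A.2.1 y).2.1, (A'.2.1 y').2.1] at this
        · have := h.2.2
          rwa [(A.2.1 y).2.2, (A'.2.1 y').2.2] at this
  · intro y hy h0 h1'
    exact (hG' y hy h0 h1').2.1 y
  · intro t ht
    obtain ⟨y, hy, h0, h1', e1, e2⟩ := h2 t ht
    obtain ⟨y', hy', h3, h4, h5, h6⟩ := (hG' y hy h0 h1').2.2.1 t ht e1 e2
    exact ⟨y', hy', h3, h4, by dsimp only; rw [h5]; exact h6⟩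
  · intro y hy h0 h1'
    obtain ⟨ε, hε, he⟩ := hlc y hy h0 h1'
    obtain ⟨δ, hδ, hd⟩ := (hG' y hy h0 h1').2.2.2 y hy
    refine ⟨min ε δ, lt_min hε hδ, fun y' hy' h3 h4 h5 => ?_⟩
    dsimp only
    rw [he y' hy' h3 h4 (lt_of_lt_of_le h5 (min_le_left _ _))]
    exact hd y' (lt_of_lt_of_le h5 (min_le_right _ _))

end TL

namespace TL

structure Leaf where
  x0 : ℝ
  x1 : ℝ
  y0 : ℝ
  y1 : ℝ
  it : Item

def Leaf.Op (R : Leaf) (x y : ℝ) : Prop := R.x0 < x ∧ x < R.x1 ∧ R.y0 < y ∧ y < R.y1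

def Leaf.tr (R : Leaf) : Leaf := ⟨R.y0, R.y1, R.x0, R.x1, sw R.it⟩

structure St where
  L : Set Leaf
  C : ℝ → ℝ → Ltr

def St.tr (S : St) : St := ⟨{R | R.tr ∈ S.L}, fun x y => S.C y x⟩

def St.G (S : St) (x y : ℝ) : Prop :=
  Rt x ∧ Rt y ∧ (0 ≤ x ∧ x ≤ 1) ∧ (0 ≤ y ∧ y ≤ 1) ∧ ∀ R ∈ S.L, ¬ R.Op x y

theorem tr_Op (R : Leaf) (x y : ℝ) : R.tr.Op x y ↔ R.Op y x := by
  unfold Leaf.tr Leaf.Op; tauto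

theorem tr_G (S : St) (x y : ℝ) : S.tr.G x y ↔ S.G y x := by
  unfold St.G
  constructor
  · rintro ⟨h1, h2, h3, h4, h5⟩
    exact ⟨h2, h1, h4, h3, fun R hR ho => h5 R.tr hR ((tr_Op _ _ _).2 ho)⟩
  · rintro ⟨h1, h2, h3, h4, h5⟩
    exact ⟨h2, h1, h4, h3, fun R hR ho => h5 R.tr hR ((tr_Op _ _ _).2 ho)⟩

def VLp (N : ℕ) (S : St) (x y : ℝ) : Prop :=
  ∃ y1 y2 w w', y1 < y ∧ y < y2 ∧ Adm N w w' ∧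
    (∀ y', Rt y' → y1 < y' → y' < y → S.G x y' ∧ S.C x y' = w) ∧
    (∀ y', Rt y' → y < y' → y' < y2 → S.G x y' ∧ S.C x y' = w')

def LcV (S : St) (x y : ℝ) : Prop :=
  ∃ ε > 0, ∀ y', |y' - y| < ε → S.G x y' → S.C x y' = S.C x y

def FitV (S : St) (R : Leaf) : Prop :=
  ∀ p, p ∈ R.it.1 ↔ ∃ y, Rt y ∧ R.y0 < y ∧ y < R.y1 ∧ p = (S.C R.x0 y, S.C R.x1 y)

structure Inv (N : ℕ) (S : St) : Prop where
  fin : S.L.Finite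
  box : ∀ R ∈ S.L, (Rt R.x0 ∧ Rt R.x1 ∧ 0 ≤ R.x0 ∧ R.x0 < R.x1 ∧ R.x1 ≤ 1) ∧
    (Rt R.y0 ∧ Rt R.y1 ∧ 0 ≤ R.y0 ∧ R.y0 < R.y1 ∧ R.y1 ≤ 1)
  disj : ∀ R ∈ S.L, ∀ R' ∈ S.L, ∀ x y, R.Op x y → R'.Op x y → R = R'
  cover : ∀ x y, Irrational x → Irrational y → 0 < x → x < 1 → 0 < y → y < 1 →
    ∃ R ∈ S.L, R.Op x y
  rat : ∀ x y, S.G x y → 0 < x → x < 1 → 0 < y → y < 1 →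
    Rl N (S.C x y) ∧ Adm N (S.C x y) (S.C x y)
  outb : ∀ x y, (x = 0 ∨ y = 0) → S.C x y = bot N
  outt : ∀ x y, 0 < x → 0 < y → (x = 1 ∨ y = 1) → S.C x y = top N
  mono : ∀ x y x' y', S.G x y → S.G x' y' → x ≤ x' → y ≤ y' → Le (S.C x y) (S.C x' y')
  vl : ∀ x y, Rt x → Irrational y → 0 < x → x < 1 → 0 < y → y < 1 →
    (∃ R ∈ S.L, R.Op x y) ∨ VLp N S x y
  hl : ∀ y x, Rt y → Irrational x → 0 < y → y < 1 → 0 < x → x < 1 →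
    (∃ R ∈ S.tr.L, R.Op y x) ∨ VLp N S.tr y x
  lcV : ∀ x y, S.G x y → 0 < y → y < 1 → LcV S x y
  lcH : ∀ y x, S.tr.G y x → 0 < x → x < 1 → LcV S.tr y x
  fitV : ∀ R ∈ S.L, FitV S R
  fitH : ∀ R ∈ S.tr.L, FitV S.tr R

theorem tr_tr (S : St) : S.tr.tr = S := rfl
theorem ltr_tr (R : Leaf) : R.tr.tr = R := rfl

theorem Inv.tr {N : ℕ} {S : St} (h : Inv N S) : Inv N S.tr where
  fin := by
    apply (h.fin.image Leaf.tr).subset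
    intro R hR
    exact ⟨R.tr, hR, rfl⟩
  box R hR := ⟨(h.box _ hR).2, (h.box _ hR).1⟩
  disj R hR R' hR' x y ho ho' := by
    have := h.disj _ hR _ hR' y x ((tr_Op _ _ _).2 ho) ((tr_Op _ _ _).2 ho')
    have := congrArg Leaf.tr this
    exact this
  cover x y hx hy h1 h2 h3 h4 := by
    obtain ⟨R, hR, ho⟩ := h.cover y x hy hx h3 h4 h1 h2
    exact ⟨R.tr, hR, (tr_Op _ _ _).2 ho⟩
  rat x y hg h1 h2 h3 h4 := h.rat y x ((tr_G _ _ _).1 hg) h3 h4 h1 h2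
  outb x y hh := h.outb y x hh.symm
  outt x y h1 h2 hh := h.outt y x h2 h1 hh.symm
  mono x y x' y' h1 h2 h3 h4 := h.mono y x y' x' ((tr_G _ _ _).1 h1) ((tr_G _ _ _).1 h2) h4 h3
  vl := h.hl
  hl := h.vl
  lcV := h.lcH
  lcH := h.lcV
  fitV := h.fitH
  fitH := h.fitV

theorem Inv.closed {N : ℕ} {S : St} (h : Inv N S) {R R' : Leaf} (hR : R ∈ S.L) (hR' : R' ∈ S.L)
    {x y : ℝ} (h1 : R.x0 ≤ x) (h2 : x ≤ R.x1) (h3 : R.y0 ≤ y) (h4 : y ≤ R.y1) (ho : R'.Op x y) :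
    R = R' := by
  have b := h.box R hR
  have b' := h.box R' hR'
  obtain ⟨o1, o2, o3, o4⟩ := ho
  have e1 : max R.x0 R'.x0 < min R.x1 R'.x1 := by
    rw [max_lt_iff, lt_min_iff, lt_min_iff]
    exact ⟨⟨b.1.2.2.2.1, by linarith⟩, by linarith, by linarith⟩
  have e2 : max R.y0 R'.y0 < min R.y1 R'.y1 := by
    rw [max_lt_iff, lt_min_iff, lt_min_iff]
    exact ⟨⟨b.2.2.2.2.1, by linarith⟩, by linarith, by linarith⟩
  obtain ⟨x', h5, h6⟩ := exists_between e1
  obtain ⟨y', h7, h8⟩ := exists_between e2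
  rw [max_lt_iff] at h5 h7
  rw [lt_min_iff] at h6 h8
  exact h.disj R hR R' hR' x' y' ⟨h5.1, h6.1, h7.1, h8.1⟩ ⟨h5.2, h6.2, h7.2, h8.2⟩

/-- boundary points of a leaf are in `G` -/
theorem Inv.bdG {N : ℕ} {S : St} (h : Inv N S) {R : Leaf} (hR : R ∈ S.L)
    {x y : ℝ} (hx : Rt x) (hy : Rt y) (h1 : R.x0 ≤ x) (h2 : x ≤ R.x1) (h3 : R.y0 ≤ y)
    (h4 : y ≤ R.y1) (hb : ¬ R.Op x y) : S.G x y := by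
  have b := h.box R hR
  refine ⟨hx, hy, ⟨by linarith [b.1.2.2.1], by linarith [b.1.2.2.2.2]⟩,
    ⟨by linarith [b.2.2.2.1], by linarith [b.2.2.2.2.2]⟩, fun R' hR' ho => ?_⟩
  have := h.closed hR hR' h1 h2 h3 h4 ho
  subst this
  exact hb ho

theorem Inv.leftG {N : ℕ} {S : St} (h : Inv N S) {R : Leaf} (hR : R ∈ S.L)
    {y : ℝ} (hy : Rt y) (h3 : R.y0 ≤ y) (h4 : y ≤ R.y1) : S.G R.x0 y :=
  have b := h.box R hR
  h.bdG hR b.1.1 hy le_rfl b.1.2.2.2.1.le h3 h4 (fun ho => lt_irrefl _ ho.1)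

theorem Inv.rightG {N : ℕ} {S : St} (h : Inv N S) {R : Leaf} (hR : R ∈ S.L)
    {y : ℝ} (hy : Rt y) (h3 : R.y0 ≤ y) (h4 : y ≤ R.y1) : S.G R.x1 y :=
  have b := h.box R hR
  h.bdG hR b.1.2.1 hy b.1.2.2.2.1.le le_rfl h3 h4 (fun ho => lt_irrefl _ ho.2.1)

theorem Inv.botG {N : ℕ} {S : St} (h : Inv N S) {R : Leaf} (hR : R ∈ S.L)
    {x : ℝ} (hx : Rt x) (h3 : R.x0 ≤ x) (h4 : x ≤ R.x1) : S.G x R.y0 :=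
  have b := h.box R hR
  h.bdG hR hx b.2.1 h3 h4 le_rfl b.2.2.2.2.1.le (fun ho => lt_irrefl _ ho.2.2.1)

theorem Inv.topG {N : ℕ} {S : St} (h : Inv N S) {R : Leaf} (hR : R ∈ S.L)
    {x : ℝ} (hx : Rt x) (h3 : R.x0 ≤ x) (h4 : x ≤ R.x1) : S.G x R.y1 :=
  have b := h.box R hR
  h.bdG hR hx b.2.2.1 h3 h4 b.2.2.2.2.1.le le_rfl (fun ho => lt_irrefl _ ho.2.2.2)

def lf1 (R : Leaf) (x : ℝ) (it1 : Item) : Leaf := ⟨R.x0, x, R.y0, R.y1, it1⟩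
def lf2 (R : Leaf) (x : ℝ) (it2 : Item) : Leaf := ⟨x, R.x1, R.y0, R.y1, it2⟩

def cutL (L : Set Leaf) (R : Leaf) (x : ℝ) (it1 it2 : Item) : Set Leaf :=
  {R' | (R' ∈ L ∧ R' ≠ R) ∨ R' = lf1 R x it1 ∨ R' = lf2 R x it2}

/-- values of a monotone map near an irrational point -/
theorem side_const (w : ℝ → Ltr) (T : List Ltr) (y0 y1 : ℝ)
    (hT : ∀ y, Rt y → y0 < y → y < y1 → w y ∈ T)
    (hm : ∀ y y', Rt y → Rt y' → y0 < y → y ≤ y' → y' < y1 → Le (w y) (w y')) (y : ℝ)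
    (h0 : y0 < y) (h1 : y < y1) :
    (∃ z s, y0 < z ∧ z < y ∧ (∃ r, Rt r ∧ y0 < r ∧ r < y ∧ w r = s) ∧ ∀ y', Rt y' → z < y' → y' < y → w y' = s) ∧
    (∃ z s, y < z ∧ z < y1 ∧ (∃ r, Rt r ∧ y < r ∧ r < y1 ∧ w r = s) ∧ ∀ y', Rt y' → y < y' → y' < z → w y' = s) := by
  classical
  constructor
  · let K := T.toFinset.filter (fun s => ∃ r, Rt r ∧ y0 < r ∧ r < y ∧ w r = s)
    have hK : K.Nonempty := by
      obtain ⟨r, hr, h2, h3⟩ := rt_btwn h0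
      refine ⟨w r, ?_⟩
      simp only [K, Finset.mem_filter, List.mem_toFinset]
      exact ⟨hT r hr h2 (by linarith), r, hr, h2, h3, rfl⟩
    obtain ⟨s, hs, hmax⟩ := K.exists_max_image rk hK
    simp only [K, Finset.mem_filter, List.mem_toFinset] at hs hmax
    obtain ⟨_, r, hr, h2, h3, h4⟩ := hs
    refine ⟨r, s, h2, h3, ⟨r, hr, h2, h3, h4⟩, fun y' hy' h5 h6 => ?_⟩
    have l := hm r y' hr hy' h2 h5.le (by linarith)
    rw [h4] at l
    exact (l.eq_of_rk (hmax _ ⟨hT y' hy' (by linarith) (by linarith), y', hy', by linarith, h6, rfl⟩)).symm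
  · let K := T.toFinset.filter (fun s => ∃ r, Rt r ∧ y < r ∧ r < y1 ∧ w r = s)
    have hK : K.Nonempty := by
      obtain ⟨r, hr, h2, h3⟩ := rt_btwn h1
      refine ⟨w r, ?_⟩
      simp only [K, Finset.mem_filter, List.mem_toFinset]
      exact ⟨hT r hr (by linarith) h3, r, hr, h2, h3, rfl⟩
    obtain ⟨s, hs, hmin⟩ := K.exists_min_image rk hK
    simp only [K, Finset.mem_filter, List.mem_toFinset] at hs hmin
    obtain ⟨_, r, hr, h2, h3, h4⟩ := hs
    refine ⟨r, s, h2, h3, ⟨r, hr, h2, h3, h4⟩, fun y' hy' h5 h6 => ?_⟩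
    have l := hm y' r hy' hr (by linarith) h6.le h3
    rw [h4] at l
    exact (l.eq_of_rk (hmin _ ⟨hT y' hy' (by linarith) (by linarith), y', hy', by linarith, by linarith, rfl⟩))

theorem irr_of_not_rt {x : ℝ} (h : ¬ Rt x) : Irrational x := not_not.1 h

/-- the vertical cut operation -/
theorem cutV_op {N : ℕ} {S : St} (h : Inv N S) {R : Leaf} (hR : R ∈ S.L) {x : ℝ} (hx : Rt x)
    (hx0 : R.x0 < x) (hx1 : x < R.x1) {it1 it2 : Item} {T : List Tri}
    (hs : SplitT N T R.it (S.C x R.y0, S.C x R.y1) it1 it2) :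
    ∃ C' : ℝ → ℝ → Ltr, Inv N ⟨cutL S.L R x it1 it2, C'⟩ ∧
      ∀ x' y', S.G x' y' → C' x' y' = S.C x' y' := by
  obtain ⟨hh, hch, ⟨V1, V2⟩, ⟨V11, V12⟩, ⟨V21, V22⟩, ⟨H11, H12⟩, ⟨H21, H22⟩, hT, ⟨hb, ht⟩, hadj, -⟩ := hs
  dsimp only at H11 H12 H21 H22 hT hb ht
  obtain ⟨⟨bx0, bx1, bx2, bx3, bx4⟩, by0, by1, by2, by3, by4⟩ := h.box R hR
  have fit := h.fitV R hR
  -- the lift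
  obtain ⟨g, gm, gT, gon, glc⟩ := lift_lemma T hch R.y0 R.y1 (fun y => (S.C R.x0 y, S.C R.x1 y))
    (by
      intro y y' hy hy' h1 h2 h3
      exact ⟨h.mono _ _ _ _ (h.leftG hR hy h1.le (by linarith)) (h.leftG hR hy' (by linarith) h3.le)
        le_rfl h2, h.mono _ _ _ _ (h.rightG hR hy h1.le (by linarith))
        (h.rightG hR hy' (by linarith) h3.le) le_rfl h2⟩)
    (by
      intro y hy h1 h2
      obtain ⟨ε, hε, he⟩ := h.lcV _ _ (h.leftG hR hy h1.le h2.le) (by linarith) (by linarith)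
      obtain ⟨δ, hδ, hd⟩ := h.lcV _ _ (h.rightG hR hy h1.le h2.le) (by linarith) (by linarith)
      refine ⟨min ε δ, lt_min hε hδ, fun y' hy' h3 h4 h5 => ?_⟩
      rw [he y' (lt_of_lt_of_le h5 (min_le_left _ _)) (h.leftG hR hy' h3.le h4.le),
        hd y' (lt_of_lt_of_le h5 (min_le_right _ _)) (h.rightG hR hy' h3.le h4.le)])
    (by
      intro y hy h1 h2
      exact V1 _ ((fit _).2 ⟨y, hy, h1, h2, rfl⟩))
    (by
      intro t ht
      obtain ⟨y, hy, h1, h2, h3⟩ := (fit _).1 (V2 t ht)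
      rw [Prod.ext_iff] at h3
      exact ⟨y, hy, h1, h2, h3.1, h3.2⟩)
  classical
  let C' : ℝ → ℝ → Ltr := fun x' y' => if x' = x ∧ R.y0 < y' ∧ y' < R.y1 then (g y').2.1 else S.C x' y'
  have Cnew : ∀ y, R.y0 < y → y < R.y1 → C' x y = (g y).2.1 := by
    intro y h1 h2; simp [C', h1, h2]
  have Cold : ∀ x' y', ¬ R.Op x' y' → C' x' y' = S.C x' y' := by
    intro x' y' hn
    have : ¬ (x' = x ∧ R.y0 < y' ∧ y' < R.y1) := by
      rintro ⟨rfl, h1, h2⟩; exact hn ⟨hx0, hx1, h1, h2⟩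
    simp only [C', this, if_false]
  have CG : ∀ x' y', S.G x' y' → C' x' y' = S.C x' y' := fun x' y' hg => Cold _ _ (hg.2.2.2.2 R hR)
  let S' : St := ⟨cutL S.L R x it1 it2, C'⟩
  have op1 : ∀ x' y', (lf1 R x it1).Op x' y' ↔ R.Op x' y' ∧ x' < x := by
    intro x' y'; unfold lf1 Leaf.Op; dsimp only
    constructor
    · rintro ⟨h1, h2, h3, h4⟩; exact ⟨⟨h1, by linarith, h3, h4⟩, h2⟩
    · rintro ⟨⟨h1, h2, h3, h4⟩, h5⟩; exact ⟨h1, h5, h3, h4⟩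
  have op2 : ∀ x' y', (lf2 R x it2).Op x' y' ↔ R.Op x' y' ∧ x < x' := by
    intro x' y'; unfold lf2 Leaf.Op; dsimp only
    constructor
    · rintro ⟨h1, h2, h3, h4⟩; exact ⟨⟨by linarith, h2, h3, h4⟩, h1⟩
    · rintro ⟨⟨h1, h2, h3, h4⟩, h5⟩; exact ⟨h5, h2, h3, h4⟩
  have sub : ∀ x' y', (∃ R' ∈ S'.L, R'.Op x' y') → ∃ R' ∈ S.L, R'.Op x' y' := by
    rintro x' y' ⟨R', (⟨h1, -⟩ | rfl | rfl), ho⟩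
    · exact ⟨R', h1, ho⟩
    · exact ⟨R, hR, ((op1 _ _).1 ho).1⟩
    · exact ⟨R, hR, ((op2 _ _).1 ho).1⟩
  have sup : ∀ x' y', (∃ R' ∈ S.L, R'.Op x' y') → (x' = x ∧ R.y0 < y' ∧ y' < R.y1) ∨ ∃ R' ∈ S'.L, R'.Op x' y' := by
    rintro x' y' ⟨R', h1, ho⟩
    by_cases he : R' = R
    · subst he
      rcases lt_trichotomy x' x with hl | hl | hl
      · exact Or.inr ⟨_, Or.inr (Or.inl rfl), (op1 _ _).2 ⟨ho, hl⟩⟩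
      · exact Or.inl ⟨hl, ho.2.2⟩
      · exact Or.inr ⟨_, Or.inr (Or.inr rfl), (op2 _ _).2 ⟨ho, hl⟩⟩
    · exact Or.inr ⟨R', Or.inl ⟨h1, he⟩, ho⟩
  have GG : ∀ x' y', S.G x' y' → S'.G x' y' := by
    rintro x' y' ⟨h1, h2, h3, h4, h5⟩
    refine ⟨h1, h2, h3, h4, fun R' hR' ho => ?_⟩
    obtain ⟨R'', h6, h7⟩ := sub x' y' ⟨R', hR', ho⟩
    exact h5 _ h6 h7
  have GS : ∀ x' y', S'.G x' y' → S.G x' y' ∨ (x' = x ∧ R.y0 < y' ∧ y' < R.y1) := by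
    rintro x' y' ⟨h1, h2, h3, h4, h5⟩
    by_contra hcon
    push Not at hcon
    apply hcon.1
    refine ⟨h1, h2, h3, h4, fun R' hR' ho => ?_⟩
    rcases sup x' y' ⟨R', hR', ho⟩ with h6 | ⟨R'', h6, h7⟩
    · exact absurd h6.2.2 (not_lt.2 (hcon.2 h6.1 h6.2.1))
    · exact h5 _ h6 h7
  have Gnew : ∀ y, Rt y → R.y0 < y → y < R.y1 → S'.G x y := by
    intro y hy h1 h2
    refine ⟨hx, hy, ⟨by linarith, by linarith⟩, ⟨by linarith, by linarith⟩, ?_⟩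
    rintro R' (⟨h3, h4⟩ | rfl | rfl) ho
    · exact h4 (h.disj _ h3 _ hR _ _ ho ⟨hx0, hx1, h1, h2⟩)
    · exact lt_irrefl _ ((op1 _ _).1 ho).2
    · exact lt_irrefl _ ((op2 _ _).1 ho).2
  have hbG : S.G x R.y0 := h.botG hR hx hx0.le hx1.le
  have htG : S.G x R.y1 := h.topG hR hx hx0.le hx1.le
  have gT' : ∀ y, Rt y → R.y0 < y → y < R.y1 → (g y).1 = S.C R.x0 y ∧ (g y).2.2 = S.C R.x1 y :=
    fun y hy h1 h2 => (gT y hy h1 h2).2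
  have wm : ∀ y y', Rt y → Rt y' → R.y0 < y → y ≤ y' → y' < R.y1 → Le (g y).2.1 (g y').2.1 :=
    fun y y' hy hy' h1 h2 h3 => (gm y y' hy hy' h1 h2 h3).2.1
  -- monotonicity
  have mon : ∀ a b c d, S'.G a b → S'.G c d → a ≤ c → b ≤ d → Le (C' a b) (C' c d) := by
    intro a b c d h1 h2 hac hbd
    rcases GS _ _ h1 with g1 | ⟨rfl, g1, g1'⟩ <;> rcases GS _ _ h2 with g2 | ⟨e2, g2, g2'⟩
    · rw [CG _ _ g1, CG _ _ g2]; exact h.mono _ _ _ _ g1 g2 hac hbd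
    · subst e2
      rw [CG _ _ g1, Cnew d g2 g2']
      obtain ⟨tT, t1, t2⟩ := gT d h2.2.1 g2 g2'
      dsimp only at t1 t2
      have tt := hT _ tT
      by_cases hc : a ≤ R.x0
      · have := h.mono _ _ _ _ g1 (h.leftG hR h2.2.1 g2.le g2'.le) hc hbd
        rw [← t1] at this
        exact this.trans tt.1.1
      · have hbd' : b ≤ R.y0 := by
          by_contra hb'
          exact g1.2.2.2.2 R hR ⟨by linarith, by linarith, by linarith, by linarith⟩
        exact (h.mono _ _ _ _ g1 hbG hac hbd').trans tt.2.1.1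
    · rw [CG _ _ g2, Cnew b g1 g1']
      obtain ⟨tT, t1, t2⟩ := gT b h1.2.1 g1 g1'
      dsimp only at t1 t2
      have tt := hT _ tT
      by_cases hc : R.x1 ≤ c
      · have := h.mono _ _ _ _ (h.rightG hR h1.2.1 g1.le g1'.le) g2 hc hbd
        rw [← t2] at this
        exact tt.1.2.trans this
      · have hbd' : R.y1 ≤ d := by
          by_contra hb'
          exact g2.2.2.2.2 R hR ⟨by linarith, by linarith, by linarith, by linarith⟩
        exact tt.2.1.2.trans (h.mono _ _ _ _ htG g2 hac hbd')
    · subst e2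
      rw [Cnew b g1 g1', Cnew d g2 g2']
      exact wm b d h1.2.1 h2.2.1 g1 hbd g2'
  have bd' : ∀ R' ∈ S.L, R' ≠ R → ∀ x' y', R'.x0 ≤ x' → x' ≤ R'.x1 → R'.y0 ≤ y' → y' ≤ R'.y1 →
      C' x' y' = S.C x' y' := by
    intro R' hR' hne x' y' h1 h2 h3 h4
    exact Cold _ _ fun ho => hne (h.closed hR' hR h1 h2 h3 h4 ho)
  have VLt : ∀ x' y', VLp N S x' y' → VLp N S' x' y' := by
    rintro x' y' ⟨y1, y2, w, w', h1, h2, h3, h4, h5⟩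
    refine ⟨y1, y2, w, w', h1, h2, h3, fun y'' e1 e2 e3 => ?_, fun y'' e1 e2 e3 => ?_⟩
    · have := h4 y'' e1 e2 e3; exact ⟨GG _ _ this.1, (CG _ _ this.1).trans this.2⟩
    · have := h5 y'' e1 e2 e3; exact ⟨GG _ _ this.1, (CG _ _ this.1).trans this.2⟩
  have HLt : ∀ x' y', VLp N S.tr x' y' → VLp N S'.tr x' y' := by
    rintro x' y' ⟨y1, y2, w, w', h1, h2, h3, h4, h5⟩
    refine ⟨y1, y2, w, w', h1, h2, h3, fun y'' e1 e2 e3 => ?_, fun y'' e1 e2 e3 => ?_⟩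
    · have := h4 y'' e1 e2 e3
      have t := (tr_G _ _ _).1 this.1
      exact ⟨(tr_G _ _ _).2 (GG _ _ t), (CG _ _ t).trans this.2⟩
    · have := h5 y'' e1 e2 e3
      have t := (tr_G _ _ _).1 this.1
      exact ⟨(tr_G _ _ _).2 (GG _ _ t), (CG _ _ t).trans this.2⟩
  -- the letters near the ends of the new line
  have endb : 0 < R.y0 → ∃ ε > 0, ∀ y', Rt y' → R.y0 < y' → y' < R.y1 → y' < R.y0 + ε →
      (g y').2.1 = S.C x R.y0 := by
    intro hpos
    obtain ⟨t, htT, hw⟩ := hb (h.rat _ _ hbG (by linarith) (by linarith) hpos (by linarith)).1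
    obtain ⟨y, hy, h1, h2, rfl⟩ := gon t htT
    refine ⟨y - R.y0, by linarith, fun y' hy' h3 h4 h5 => ?_⟩
    have l := wm y' y hy' hy h3 (by linarith) h2
    rw [hw] at l
    exact l.antisymm (hT _ (gT y' hy' h3 h4).1).2.1.1
  have endt : R.y1 < 1 → ∃ ε > 0, ∀ y', Rt y' → R.y0 < y' → y' < R.y1 → R.y1 - ε < y' →
      (g y').2.1 = S.C x R.y1 := by
    intro hpos
    obtain ⟨t, htT, hw⟩ := ht (h.rat _ _ htG (by linarith) (by linarith) (by linarith) hpos).1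
    obtain ⟨y, hy, h1, h2, rfl⟩ := gon t htT
    refine ⟨R.y1 - y, by linarith, fun y' hy' h3 h4 h5 => ?_⟩
    have l := wm y y' hy hy' h1 (by linarith) h4
    rw [hw] at l
    exact (hT _ (gT y' hy' h3 h4).1).2.1.2.antisymm l
  -- horizontal letters near x
  have hhl : ∃ ε > 0, ∀ x', Rt x' → R.x0 < x' → x' < R.x1 → |x' - x| < ε →
      S.C x' R.y0 = S.C x R.y0 ∧ S.C x' R.y1 = S.C x R.y1 := by
    obtain ⟨ε, hε, he⟩ := h.lcH R.y0 x ((tr_G _ _ _).2 hbG) (by linarith) (by linarith)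
    obtain ⟨δ, hδ, hd⟩ := h.lcH R.y1 x ((tr_G _ _ _).2 htG) (by linarith) (by linarith)
    refine ⟨min ε δ, lt_min hε hδ, fun x' hx' h1 h2 h3 => ⟨?_, ?_⟩⟩
    · exact he x' (lt_of_lt_of_le h3 (min_le_left _ _)) ((tr_G _ _ _).2 (h.botG hR hx' h1.le h2.le))
    · exact hd x' (lt_of_lt_of_le h3 (min_le_right _ _)) ((tr_G _ _ _).2 (h.topG hR hx' h1.le h2.le))
  have fitHR := h.fitH R.tr hR
  refine ⟨C', ?_, CG⟩
  change Inv N S'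
  refine ⟨?_, ?_, ?_, ?_, ?_, ?_, ?_, mon, ?_, ?_, ?_, ?_, ?_, ?_⟩
  · -- finiteness
    apply (h.fin.union ((Set.finite_singleton (lf1 R x it1)).union (Set.finite_singleton (lf2 R x it2)))).subset
    rintro R' (⟨h1, -⟩ | rfl | rfl)
    · exact Or.inl h1
    · exact Or.inr (Or.inl rfl)
    · exact Or.inr (Or.inr rfl)
  · -- boxes
    rintro R' (⟨h1, -⟩ | rfl | rfl)
    · exact h.box R' h1
    · exact ⟨⟨bx0, hx, bx2, hx0, by dsimp [lf1]; linarith⟩, by0, by1, by2, by3, by4⟩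
    · exact ⟨⟨hx, bx1, by dsimp [lf2]; linarith, hx1, bx4⟩, by0, by1, by2, by3, by4⟩
  · -- disjointness
    rintro R1 (⟨h1, h1'⟩ | rfl | rfl) R2 (⟨h2, h2'⟩ | rfl | rfl) a b o1 o2
    · exact h.disj _ h1 _ h2 _ _ o1 o2
    · exact absurd (h.disj _ h1 _ hR _ _ o1 ((op1 _ _).1 o2).1) h1'
    · exact absurd (h.disj _ h1 _ hR _ _ o1 ((op2 _ _).1 o2).1) h1'
    · exact absurd (h.disj _ h2 _ hR _ _ o2 ((op1 _ _).1 o1).1) h2'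
    · rfl
    · have e1 := ((op1 _ _).1 o1).2
      have e2 := ((op2 _ _).1 o2).2
      linarith
    · exact absurd (h.disj _ h2 _ hR _ _ o2 ((op2 _ _).1 o1).1) h2'
    · have e1 := ((op2 _ _).1 o1).2
      have e2 := ((op1 _ _).1 o2).2
      linarith
    · rfl
  · -- cover
    intro a b ha hb' h1 h2 h3 h4
    rcases sup a b (h.cover a b ha hb' h1 h2 h3 h4) with ⟨rfl, -⟩ | h5
    · exact absurd ha hx
    · exact h5
  · -- rat
    intro a b hg h1 h2 h3 h4
    rcases GS _ _ hg with g1 | ⟨rfl, g1, g1'⟩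
    · have := h.rat a b g1 h1 h2 h3 h4
      show Rl N (C' a b) ∧ Adm N (C' a b) (C' a b)
      rw [CG _ _ g1]; exact this
    · have := hT _ (gT b hg.2.1 g1 g1').1
      show Rl N (C' a b) ∧ Adm N (C' a b) (C' a b)
      rw [Cnew b g1 g1']; exact this.2.2
  · -- outb
    intro a b hab
    show C' a b = _
    rw [Cold a b, h.outb a b hab]
    rintro ⟨o1, o2, o3, o4⟩
    rcases hab with rfl | rfl <;> linarith
  · intro a b ha hb' hab
    show C' a b = _
    rw [Cold a b, h.outt a b ha hb' hab]
    rintro ⟨o1, o2, o3, o4⟩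
    rcases hab with rfl | rfl <;> linarith
  · -- vl
    intro a b ha hb' h1 h2 h3 h4
    rcases h.vl a b ha hb' h1 h2 h3 h4 with h5 | h5
    · rcases sup a b h5 with ⟨rfl, e1, e2⟩ | h6
      · right
        obtain ⟨⟨z, s, z1, z2, ⟨r, hr, r1, r2, rs⟩, z3⟩, ⟨z', s', z1', z2', ⟨r', hr', r1', r2', rs'⟩, z3'⟩⟩ :=
          side_const (fun y => (g y).2.1) (T.map (fun t => t.2.1)) R.y0 R.y1
          (fun y hy h1 h2 => List.mem_map.2 ⟨_, (gT y hy h1 h2).1, rfl⟩) wm b e1 e2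
        have tr := (gT r hr r1 (by linarith)).1
        have tr' := (gT r' hr' (by linarith) r2').1
        refine ⟨z, z', s, s', z2, z1', ?_, ?_, ?_⟩
        · by_cases hss : s = s'
          · subst hss
            have := (hT _ tr).2.2.2
            rwa [rs] at this
          · have := hadj _ tr _ tr' (wm r r' hr hr' r1 (by linarith) r2') (by rw [rs, rs']; exact hss) (by
              intro u hu
              obtain ⟨y, hy, y0', y1', rfl⟩ := gon u hu
              have hyb : y ≠ b := fun e => hy (e ▸ hb')
              rcases lt_or_gt_of_ne hyb with hlt | hlt
              · left
                by_cases hyz : z < y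
                · rw [z3 y hy hyz hlt, rs]; exact Le.refl _
                · obtain ⟨r2, hr2, q1, q2⟩ := rt_btwn z2
                  have := wm y r2 hy hr2 y0' (by linarith) (by linarith)
                  rw [z3 r2 hr2 q1 q2] at this
                  rw [rs]; exact this
              · right
                by_cases hyz : y < z'
                · rw [z3' y hy hlt hyz, rs']; exact Le.refl _
                · obtain ⟨r2, hr2, q1, q2⟩ := rt_btwn z1'
                  have := wm r2 y hr2 hy (by linarith) (by linarith) (by linarith)
                  rw [z3' r2 hr2 q1 q2] at this
                  rw [rs']; exact this)
            rwa [rs, rs'] at this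
        · intro y' hy' q1 q2
          exact ⟨Gnew y' hy' (by linarith) (by linarith), (Cnew y' (by linarith) (by linarith)).trans (z3 y' hy' q1 q2)⟩
        · intro y' hy' q1 q2
          exact ⟨Gnew y' hy' (by linarith) (by linarith), (Cnew y' (by linarith) (by linarith)).trans (z3' y' hy' q1 q2)⟩
      · exact Or.inl h6
    · exact Or.inr (VLt _ _ h5)
  · -- hl
    intro b a hb' ha h1 h2 h3 h4
    rcases h.hl b a hb' ha h1 h2 h3 h4 with ⟨R', h5, h6⟩ | h5
    · rcases sup a b ⟨R'.tr, h5, (tr_Op _ _ _).2 h6⟩ with ⟨rfl, -⟩ | ⟨R'', h7, h8⟩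
      · exact absurd ha hx
      · exact Or.inl ⟨R''.tr, h7, (tr_Op _ _ _).2 h8⟩
    · exact Or.inr (HLt _ _ h5)
  · -- lcV
    intro a b hg h1 h2
    rcases GS _ _ hg with g1 | ⟨rfl, g1, g1'⟩
    · obtain ⟨ε, hε, he⟩ := h.lcV a b g1 h1 h2
      have e2 : ∃ δ > 0, ∀ y', |y' - b| < δ → (a = x ∧ R.y0 < y' ∧ y' < R.y1) → Rt y' → (g y').2.1 = S.C a b := by
        by_cases hax : a = x
        swap
        · exact ⟨1, one_pos, fun y' _ hh => absurd hh.1 hax⟩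
        subst hax
        rcases lt_trichotomy b R.y0 with hb0 | hb0 | hb0
        · refine ⟨R.y0 - b, by linarith, fun y' q1 q2 => ?_⟩
          have := (abs_lt.1 q1).2
          linarith [q2.2.1]
        · subst hb0
          obtain ⟨δ, hδ, hd⟩ := endb h1
          refine ⟨δ, hδ, fun y' q1 q2 hy' => hd y' hy' q2.2.1 q2.2.2 ?_⟩
          linarith [(abs_lt.1 q1).2]
        rcases lt_trichotomy b R.y1 with hb1 | hb1 | hb1
        · exact absurd ⟨hx0, hx1, hb0, hb1⟩ (g1.2.2.2.2 R hR)
        · subst hb1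
          obtain ⟨δ, hδ, hd⟩ := endt h2
          refine ⟨δ, hδ, fun y' q1 q2 hy' => hd y' hy' q2.2.1 q2.2.2 ?_⟩
          linarith [(abs_lt.1 q1).1]
        · refine ⟨b - R.y1, by linarith, fun y' q1 q2 => ?_⟩
          have := (abs_lt.1 q1).1
          linarith [q2.2.2]
      obtain ⟨δ, hδ, hd⟩ := e2
      refine ⟨min ε δ, lt_min hε hδ, fun y' q1 q2 => ?_⟩
      show C' a y' = C' a b
      rw [CG _ _ g1]
      rcases GS _ _ q2 with g2 | ⟨e, g2, g2'⟩
      · rw [CG _ _ g2]; exact he y' (lt_of_lt_of_le q1 (min_le_left _ _)) g2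
      · rw [e, Cnew y' g2 g2', ← e]
        exact hd y' (lt_of_lt_of_le q1 (min_le_right _ _)) ⟨e, g2, g2'⟩ q2.2.1
    · obtain ⟨ε, hε, he⟩ := glc b hg.2.1 g1 g1'
      refine ⟨min ε (min (b - R.y0) (R.y1 - b)), lt_min hε (lt_min (by linarith) (by linarith)), fun y' q1 q2 => ?_⟩
      show C' a y' = C' a b
      have q3 := lt_of_lt_of_le q1 (min_le_left _ _)
      have q4 := (abs_lt.1 (lt_of_lt_of_le q1 ((min_le_right _ _).trans (min_le_left _ _)))).1
      have q5 := (abs_lt.1 (lt_of_lt_of_le q1 ((min_le_right _ _).trans (min_le_right _ _)))).2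
      rw [Cnew b g1 g1', Cnew y' (by linarith) (by linarith), he y' q2.2.1 (by linarith) (by linarith) q3]
  · -- lcH
    intro b a hg0 h1 h2
    have hg := (tr_G _ _ _).1 hg0
    rcases GS _ _ hg with g1 | ⟨rfl, g1, g1'⟩
    · obtain ⟨ε, hε, he⟩ := h.lcH b a ((tr_G _ _ _).2 g1) h1 h2
      have e2 : ∃ δ > 0, ∀ x', |x' - a| < δ → (x' = x ∧ R.y0 < b ∧ b < R.y1) → False := by
        by_cases hax : a = x
        · subst hax
          refine ⟨1, one_pos, fun x' _ hh => g1.2.2.2.2 R hR ⟨hx0, hx1, hh.2.1, hh.2.2⟩⟩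
        · refine ⟨|x - a|, abs_pos.2 (fun e => hax (by linarith)), fun x' q1 q2 => ?_⟩
          rw [q2.1] at q1
          exact lt_irrefl _ q1
      obtain ⟨δ, hδ, hd⟩ := e2
      refine ⟨min ε δ, lt_min hε hδ, fun x' q1 q2 => ?_⟩
      show C' x' b = C' a b
      rw [CG _ _ g1]
      rcases GS _ _ ((tr_G _ _ _).1 q2) with g2 | g2
      · rw [CG _ _ g2]; exact he x' (lt_of_lt_of_le q1 (min_le_left _ _)) ((tr_G _ _ _).2 g2)
      · exact (hd x' (lt_of_lt_of_le q1 (min_le_right _ _)) g2).elim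
    · refine ⟨min (a - R.x0) (R.x1 - a), lt_min (by linarith) (by linarith), fun x' q1 q2 => ?_⟩
      show C' x' b = C' a b
      have q4 := (abs_lt.1 (lt_of_lt_of_le q1 (min_le_left _ _))).1
      have q5 := (abs_lt.1 (lt_of_lt_of_le q1 (min_le_right _ _))).2
      rcases GS _ _ ((tr_G _ _ _).1 q2) with g2 | g2
      · exact absurd ⟨by linarith, by linarith, g1, g1'⟩ (g2.2.2.2.2 R hR)
      · rw [g2.1]
  · -- fitV
    rintro R' (⟨h1, h2⟩ | rfl | rfl) p
    · rw [h.fitV R' h1 p]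
      have b' := h.box R' h1
      constructor
      · rintro ⟨y, hy, q1, q2, rfl⟩
        refine ⟨y, hy, q1, q2, ?_⟩
        show _ = (C' _ _, C' _ _)
        rw [bd' R' h1 h2 _ _ le_rfl b'.1.2.2.2.1.le q1.le q2.le, bd' R' h1 h2 _ _ b'.1.2.2.2.1.le le_rfl q1.le q2.le]
      · rintro ⟨y, hy, q1, q2, rfl⟩
        refine ⟨y, hy, q1, q2, ?_⟩
        show (C' _ _, C' _ _) = _
        rw [bd' R' h1 h2 _ _ le_rfl b'.1.2.2.2.1.le q1.le q2.le, bd' R' h1 h2 _ _ b'.1.2.2.2.1.le le_rfl q1.le q2.le]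
    · show p ∈ it1.1 ↔ ∃ y, Rt y ∧ R.y0 < y ∧ y < R.y1 ∧ p = (C' R.x0 y, C' x y)
      constructor
      · intro hp
        obtain ⟨t, tT, t1, t2⟩ := V11 p hp
        obtain ⟨y, hy, q1, q2, rfl⟩ := gon t tT
        refine ⟨y, hy, q1, q2, ?_⟩
        rw [CG _ _ (h.leftG hR hy q1.le q2.le), Cnew y q1 q2, ← (gT' y hy q1 q2).1, t1, t2]
      · rintro ⟨y, hy, q1, q2, rfl⟩
        rw [CG _ _ (h.leftG hR hy q1.le q2.le), Cnew y q1 q2, ← (gT' y hy q1 q2).1]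
        exact V12 _ (gT y hy q1 q2).1
    · show p ∈ it2.1 ↔ ∃ y, Rt y ∧ R.y0 < y ∧ y < R.y1 ∧ p = (C' x y, C' R.x1 y)
      constructor
      · intro hp
        obtain ⟨t, tT, t1, t2⟩ := V21 p hp
        obtain ⟨y, hy, q1, q2, rfl⟩ := gon t tT
        refine ⟨y, hy, q1, q2, ?_⟩
        rw [CG _ _ (h.rightG hR hy q1.le q2.le), Cnew y q1 q2, ← (gT' y hy q1 q2).2, t1, t2]
      · rintro ⟨y, hy, q1, q2, rfl⟩
        rw [CG _ _ (h.rightG hR hy q1.le q2.le), Cnew y q1 q2, ← (gT' y hy q1 q2).2]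
        exact V22 _ (gT y hy q1 q2).1
  · -- fitH
    intro R'' hR'' p
    obtain ⟨R', rfl⟩ : ∃ R' : Leaf, R'' = R'.tr := ⟨R''.tr, rfl⟩
    have hR' : R' ∈ cutL S.L R x it1 it2 := hR''
    show p ∈ R'.it.2.1 ↔ ∃ x', Rt x' ∧ R'.x0 < x' ∧ x' < R'.x1 ∧ p = (C' x' R'.y0, C' x' R'.y1)
    have fH : ∀ p, p ∈ R.it.2.1 ↔ ∃ x', Rt x' ∧ R.x0 < x' ∧ x' < R.x1 ∧ p = (S.C x' R.y0, S.C x' R.y1) := fitHR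
    have cb : ∀ x', C' x' R.y0 = S.C x' R.y0 := fun x' => Cold _ _ fun ho => lt_irrefl _ ho.2.2.1
    have ct : ∀ x', C' x' R.y1 = S.C x' R.y1 := fun x' => Cold _ _ fun ho => lt_irrefl _ ho.2.2.2
    have Hm : ∀ a b, Rt a → Rt b → R.x0 < a → a ≤ b → b < R.x1 →
        L2 (S.C a R.y0, S.C a R.y1) (S.C b R.y0, S.C b R.y1) := by
      intro a b ha hb' q1 q2 q3
      exact ⟨h.mono _ _ _ _ (h.botG hR ha q1.le (by linarith)) (h.botG hR hb' (by linarith) q3.le) q2 le_rfl,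
        h.mono _ _ _ _ (h.topG hR ha q1.le (by linarith)) (h.topG hR hb' (by linarith) q3.le) q2 le_rfl⟩
    obtain ⟨ε, hε, he⟩ := hhl
    rcases hR' with ⟨h1, h2⟩ | rfl | rfl
    · have b' := h.box R' h1
      have f' : p ∈ R'.it.2.1 ↔ ∃ x', Rt x' ∧ R'.x0 < x' ∧ x' < R'.x1 ∧ p = (S.C x' R'.y0, S.C x' R'.y1) := h.fitH R'.tr h1 p
      rw [f']
      constructor
      · rintro ⟨y, hy, q1, q2, rfl⟩
        refine ⟨y, hy, q1, q2, ?_⟩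
        rw [bd' R' h1 h2 _ _ q1.le q2.le le_rfl b'.2.2.2.2.1.le, bd' R' h1 h2 _ _ q1.le q2.le b'.2.2.2.2.1.le le_rfl]
      · rintro ⟨y, hy, q1, q2, rfl⟩
        refine ⟨y, hy, q1, q2, ?_⟩
        rw [bd' R' h1 h2 _ _ q1.le q2.le le_rfl b'.2.2.2.2.1.le, bd' R' h1 h2 _ _ q1.le q2.le b'.2.2.2.2.1.le le_rfl]
    · show p ∈ it1.2.1 ↔ ∃ x', Rt x' ∧ R.x0 < x' ∧ x' < x ∧ p = (C' x' R.y0, C' x' R.y1)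
      simp only [cb, ct]
      constructor
      · intro hp
        obtain ⟨p1, p2⟩ := H11 p hp
        obtain ⟨x', hx', q1, q2, rfl⟩ := (fH p).1 p1
        by_cases hlt : x' < x
        · exact ⟨x', hx', q1, hlt, rfl⟩
        · have := p2.antisymm (Hm x x' hx hx' hx0 (not_lt.1 hlt) q2)
          rw [this]
          obtain ⟨r, hr, r1, r2⟩ := rt_btwn (show max R.x0 (x - ε) < x from max_lt hx0 (by linarith))
          rw [max_lt_iff] at r1
          refine ⟨r, hr, r1.1, r2, ?_⟩
          obtain ⟨e1, e2⟩ := he r hr r1.1 (by linarith) (by rw [abs_lt]; constructor <;> linarith [r1.2])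
          rw [e1, e2]
      · rintro ⟨x', hx', q1, q2, rfl⟩
        exact H12 _ ((fH _).2 ⟨x', hx', q1, by linarith, rfl⟩) (Hm x' x hx' hx q1 q2.le hx1)
    · show p ∈ it2.2.1 ↔ ∃ x', Rt x' ∧ x < x' ∧ x' < R.x1 ∧ p = (C' x' R.y0, C' x' R.y1)
      simp only [cb, ct]
      constructor
      · intro hp
        obtain ⟨p1, p2⟩ := H21 p hp
        obtain ⟨x', hx', q1, q2, rfl⟩ := (fH p).1 p1
        by_cases hlt : x < x'
        · exact ⟨x', hx', hlt, q2, rfl⟩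
        · have := p2.antisymm (Hm x' x hx' hx q1 (not_lt.1 hlt) hx1)
          rw [← this]
          obtain ⟨r, hr, r1, r2⟩ := rt_btwn (show x < min R.x1 (x + ε) from lt_min hx1 (by linarith))
          rw [lt_min_iff] at r2
          refine ⟨r, hr, r1, r2.1, ?_⟩
          obtain ⟨e1, e2⟩ := he r hr (by linarith) r2.1 (by rw [abs_lt]; constructor <;> linarith [r2.2])
          rw [e1, e2]
      · rintro ⟨x', hx', q1, q2, rfl⟩
        exact H22 _ ((fH _).2 ⟨x', hx', by linarith, q2, rfl⟩) (Hm x x' hx hx' hx0 q1.le q2)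

end TL

namespace TL

def Leaf.Sub (R' R : Leaf) : Prop := (R.x0 ≤ R'.x0 ∧ R'.x1 ≤ R.x1) ∧ R.y0 ≤ R'.y0 ∧ R'.y1 ≤ R.y1

theorem Leaf.Sub.refl (R : Leaf) : R.Sub R := ⟨⟨le_rfl, le_rfl⟩, le_rfl, le_rfl⟩
theorem Leaf.Sub.trans {R R' R'' : Leaf} (h : R.Sub R') (k : R'.Sub R'') : R.Sub R'' :=
  ⟨⟨k.1.1.trans h.1.1, h.1.2.trans k.1.2⟩, k.2.1.trans h.2.1, h.2.2.trans k.2.2⟩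
theorem Leaf.Sub.op {R R' : Leaf} (h : R.Sub R') {x y : ℝ} (ho : R.Op x y) : R'.Op x y :=
  ⟨lt_of_le_of_lt h.1.1 ho.1, lt_of_lt_of_le ho.2.1 h.1.2, lt_of_le_of_lt h.2.1 ho.2.2.1,
    lt_of_lt_of_le ho.2.2.2 h.2.2⟩

structure InvD (N : ℕ) (D : List Item) (S : St) : Prop where
  inv : Inv N S
  inD : ∀ R ∈ S.L, R.it ∈ D

structure Ext (S S' : St) : Prop where
  g : ∀ x y, S.G x y → S'.G x y ∧ S'.C x y = S.C x y
  sub : ∀ R' ∈ S'.L, ∃ R ∈ S.L, R'.Sub R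
  mrk : ∀ R ∈ S.L, R.it.2.2 ≠ 0 → ∃ R' ∈ S'.L, R'.Sub R ∧ R'.it.2.2 = R.it.2.2

structure ExtAt (R : Leaf) (S S' : St) : Prop extends Ext S S' where
  keep : ∀ R' ∈ S.L, R' ≠ R → R' ∈ S'.L
  new : ∀ R' ∈ S'.L, (R' ∈ S.L ∧ R' ≠ R) ∨ R'.Sub R

theorem Ext.refl (S : St) : Ext S S :=
  ⟨fun _ _ h => ⟨h, rfl⟩, fun R h => ⟨R, h, Leaf.Sub.refl R⟩, fun R h _ => ⟨R, h, Leaf.Sub.refl R, rfl⟩⟩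

theorem Ext.trans {S S' S'' : St} (h : Ext S S') (k : Ext S' S'') : Ext S S'' := by
  refine ⟨fun x y hg => ?_, fun R hR => ?_, fun R hR hm => ?_⟩
  · obtain ⟨h1, h2⟩ := h.g x y hg
    obtain ⟨h3, h4⟩ := k.g x y h1
    exact ⟨h3, h4.trans h2⟩
  · obtain ⟨R', h1, h2⟩ := k.sub R hR
    obtain ⟨R'', h3, h4⟩ := h.sub R' h1
    exact ⟨R'', h3, h2.trans h4⟩
  · obtain ⟨R', h1, h2, h3⟩ := h.mrk R hR hm
    obtain ⟨R'', h4, h5, h6⟩ := k.mrk R' h1 (by rw [h3]; exact hm)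
    exact ⟨R'', h4, h5.trans h2, h6.trans h3⟩

theorem ExtAt.refl (R : Leaf) (S : St) : ExtAt R S S :=
  ⟨Ext.refl S, fun _ h _ => h, fun R' h => by
    by_cases hh : R' = R
    · right; rw [hh]; exact Leaf.Sub.refl R
    · exact Or.inl ⟨h, hh⟩⟩

theorem Inv.pt {N : ℕ} {S : St} (h : Inv N S) {R : Leaf} (hR : R ∈ S.L) : ∃ x y, R.Op x y := by
  have b := h.box R hR
  obtain ⟨x, h1, h2⟩ := exists_between b.1.2.2.2.1
  obtain ⟨y, h3, h4⟩ := exists_between b.2.2.2.2.1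
  exact ⟨x, y, h1, h2, h3, h4⟩

theorem Inv.sub_eq {N : ℕ} {S : St} (h : Inv N S) {R R' : Leaf} (hR : R ∈ S.L) (hR' : R' ∈ S.L)
    (hs : R'.Sub R) : R' = R := by
  obtain ⟨x, y, ho⟩ := h.pt hR'
  exact h.disj _ hR' _ hR _ _ ho (hs.op ho)

theorem ExtAt.trans {N : ℕ} {S S1 S2 : St} {R R1 : Leaf} (hS : Inv N S) (hR : R ∈ S.L) (hsub : R1.Sub R) (h : ExtAt R S S1) (k : ExtAt R1 S1 S2) : ExtAt R S S2 := by
  have ne : ∀ R' ∈ S.L, R' ≠ R → R' ≠ R1 := by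
    rintro R' hR' hne rfl
    exact hne (hS.sub_eq hR hR' hsub)
  refine ⟨h.toExt.trans k.toExt, fun R' hR' hne => k.keep _ (h.keep _ hR' hne) (ne R' hR' hne), fun R' hR' => ?_⟩
  rcases k.new R' hR' with ⟨h1, h2⟩ | h1
  · exact h.new R' h1
  · exact Or.inr (h1.trans hsub)

theorem tr_Sub {R R' : Leaf} (h : R.Sub R') : R.tr.Sub R'.tr := ⟨h.2, h.1⟩

theorem Ext.tr {S S' : St} (h : Ext S S') : Ext S.tr S'.tr := by
  refine ⟨fun x y hg => ?_, fun R hR => ?_, fun R hR hm => ?_⟩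
  · obtain ⟨h1, h2⟩ := h.g y x ((tr_G _ _ _).1 hg)
    exact ⟨(tr_G _ _ _).2 h1, h2⟩
  · obtain ⟨R', h1, h2⟩ := h.sub R.tr hR
    exact ⟨R'.tr, h1, tr_Sub h2⟩
  · obtain ⟨R', h1, h2, h3⟩ := h.mrk R.tr hR hm
    exact ⟨R'.tr, h1, tr_Sub h2, h3⟩

def lf3 (R : Leaf) (y : ℝ) (it1 : Item) : Leaf := ⟨R.x0, R.x1, R.y0, y, it1⟩
def lf4 (R : Leaf) (y : ℝ) (it2 : Item) : Leaf := ⟨R.x0, R.x1, y, R.y1, it2⟩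

def cutLH (L : Set Leaf) (R : Leaf) (y : ℝ) (it1 it2 : Item) : Set Leaf :=
  {R' | (R' ∈ L ∧ R' ≠ R) ∨ R' = lf3 R y it1 ∨ R' = lf4 R y it2}

theorem ext_of_cut {S S' : St} {R R1 R2 : Leaf} 
    (hL : ∀ R', R' ∈ S'.L ↔ (R' ∈ S.L ∧ R' ≠ R) ∨ R' = R1 ∨ R' = R2) (hR : R ∈ S.L) (h1 : R1.Sub R) (h2 : R2.Sub R)
    (hC : ∀ x y, S.G x y → S'.C x y = S.C x y)
    (hm : (R1.it.2.2 = R.it.2.2 ∧ R2.it.2.2 = 0) ∨ (R1.it.2.2 = 0 ∧ R2.it.2.2 = R.it.2.2)) : ExtAt R S S' := by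
  have hsub : ∀ R' ∈ S'.L, ∃ R ∈ S.L, R'.Sub R := by
    intro R' hR'
    rcases (hL R').1 hR' with ⟨h, -⟩ | rfl | rfl
    · exact ⟨R', h, Leaf.Sub.refl _⟩
    · exact ⟨R, hR, h1⟩
    · exact ⟨R, hR, h2⟩
  refine ⟨⟨fun x y hg => ⟨?_, hC x y hg⟩, hsub, fun R' hR' _ => ?_⟩, fun R' hR' hne => (hL R').2 (Or.inl ⟨hR', hne⟩), fun R' hR' => ?_⟩
  · obtain ⟨e1, e2, e3, e4, e5⟩ := hg
    refine ⟨e1, e2, e3, e4, fun R' hR' ho => ?_⟩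
    obtain ⟨R'', h3, h4⟩ := hsub R' hR'
    exact e5 R'' h3 (h4.op ho)
  · by_cases hne : R' = R
    · subst hne
      rcases hm with ⟨hm, -⟩ | ⟨-, hm⟩
      · exact ⟨R1, (hL _).2 (Or.inr (Or.inl rfl)), h1, hm⟩
      · exact ⟨R2, (hL _).2 (Or.inr (Or.inr rfl)), h2, hm⟩
    · exact ⟨R', (hL _).2 (Or.inl ⟨hR', hne⟩), Leaf.Sub.refl _, rfl⟩
  · rcases (hL R').1 hR' with h | rfl | rfl
    · exact Or.inl h
    · exact Or.inr h1
    · exact Or.inr h2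

theorem cutV_op2 {N : ℕ} {D : List Item} {S : St} (h : InvD N D S) {R : Leaf} (hR : R ∈ S.L) {x : ℝ} (hx : Rt x)
    (hx0 : R.x0 < x) (hx1 : x < R.x1) {it1 it2 : Item} (hd1 : it1 ∈ D) (hd2 : it2 ∈ D)
    (hs : SplitV N R.it (S.C x R.y0, S.C x R.y1) it1 it2) :
    ∃ S' : St, InvD N D S' ∧ ExtAt R S S' ∧ 
      ∀ R', R' ∈ S'.L ↔ (R' ∈ S.L ∧ R' ≠ R) ∨ R' = lf1 R x it1 ∨ R' = lf2 R x it2 := by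
  obtain ⟨T, -, hs⟩ := hs
  obtain ⟨C', h1, h2⟩ := cutV_op h.inv hR hx hx0 hx1 hs
  have hL : ∀ R', R' ∈ cutL S.L R x it1 it2 ↔ (R' ∈ S.L ∧ R' ≠ R) ∨ R' = lf1 R x it1 ∨ R' = lf2 R x it2 := fun R' => Iff.rfl
  refine ⟨⟨cutL S.L R x it1 it2, C'⟩, ⟨h1, ?_⟩, ext_of_cut (S' := ⟨cutL S.L R x it1 it2, C'⟩) hL hR
    ⟨⟨le_rfl, hx1.le⟩, le_rfl, le_rfl⟩ ⟨⟨hx0.le, le_rfl⟩, le_rfl, le_rfl⟩ h2 hs.2.2.2.2.2.2.2.2.2.2, hL⟩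
  rintro R' (⟨h3, -⟩ | rfl | rfl)
  · exact h.inD R' h3
  · exact hd1
  · exact hd2

theorem cutH_op2 {N : ℕ} {D : List Item} {S : St} (h : InvD N D S) {R : Leaf} (hR : R ∈ S.L) {y : ℝ} (hy : Rt y)
    (hy0 : R.y0 < y) (hy1 : y < R.y1) {it1 it2 : Item} (hd1 : it1 ∈ D) (hd2 : it2 ∈ D)
    (hs : SplitH N R.it (S.C R.x0 y, S.C R.x1 y) it1 it2) :
    ∃ S' : St, InvD N D S' ∧ ExtAt R S S' ∧ 
      ∀ R', R' ∈ S'.L ↔ (R' ∈ S.L ∧ R' ≠ R) ∨ R' = lf3 R y it1 ∨ R' = lf4 R y it2 := by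
  obtain ⟨T, -, hs⟩ := hs
  have hs' : SplitT N T R.tr.it (S.tr.C y R.tr.y0, S.tr.C y R.tr.y1) (sw it1) (sw it2) := hs
  obtain ⟨C', h1, h2⟩ := cutV_op h.inv.tr (R := R.tr) hR hy hy0 hy1 hs'
  let S' : St := St.tr ⟨cutL S.tr.L R.tr y (sw it1) (sw it2), C'⟩
  have hL : ∀ R', R' ∈ S'.L ↔ (R' ∈ S.L ∧ R' ≠ R) ∨ R' = lf3 R y it1 ∨ R' = lf4 R y it2 := by
    intro R'
    have inj : ∀ A B : Leaf, A.tr = B.tr ↔ A = B := fun A B => ⟨fun e => congrArg Leaf.tr e, fun e => congrArg Leaf.tr e⟩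
    show ((R'.tr ∈ S.tr.L ∧ R'.tr ≠ R.tr) ∨ R'.tr = (lf3 R y it1).tr ∨ R'.tr = (lf4 R y it2).tr) ↔ _
    rw [inj, inj, ne_eq, inj]
    exact Iff.rfl
  refine ⟨S', ⟨h1.tr, ?_⟩, ext_of_cut (S' := S') hL hR
    ⟨⟨le_rfl, le_rfl⟩, le_rfl, hy1.le⟩ ⟨⟨le_rfl, le_rfl⟩, hy0.le, le_rfl⟩ 
      (fun a b hg => h2 b a ((tr_G _ _ _).2 hg)) hs.2.2.2.2.2.2.2.2.2.2, hL⟩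
  intro R' hR'
  rcases (hL R').1 hR' with ⟨h3, -⟩ | rfl | rfl
  · exact h.inD R' h3
  · exact hd1
  · exact hd2

theorem Inv.fitH' {N : ℕ} {S : St} (h : Inv N S) {R : Leaf} (hR : R ∈ S.L) (p : Ltr2) :
    p ∈ R.it.2.1 ↔ ∃ x', Rt x' ∧ R.x0 < x' ∧ x' < R.x1 ∧ p = (S.C x' R.y0, S.C x' R.y1) :=
  h.fitH R.tr hR p

/-- executing a split -/
theorem spl_op {N : ℕ} {D : List Item} {S : St} (h : InvD N D S) {R : Leaf} (hR : R ∈ S.L)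
    {it1 it2 : Item} (hd1 : it1 ∈ D) (hd2 : it2 ∈ D) (hs : Spl N R.it it1 it2) :
    ∃ (S' : St) (R1 R2 : Leaf), InvD N D S' ∧ ExtAt R S S' ∧ R1.it = it1 ∧ R2.it = it2 ∧ R1 ≠ R2 ∧
      R1.Sub R ∧ R2.Sub R ∧
      ∀ R', R' ∈ S'.L ↔ (R' ∈ S.L ∧ R' ≠ R) ∨ R' = R1 ∨ R' = R2 := by
  rcases hs with ⟨p, hp, hs⟩ | ⟨p, hp, hs⟩
  · obtain ⟨x, hx, h1, h2, rfl⟩ := (h.inv.fitH' hR p).1 hp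
    obtain ⟨S', h3, h4, h5⟩ := cutV_op2 h hR hx h1 h2 hd1 hd2 hs
    refine ⟨S', lf1 R x it1, lf2 R x it2, h3, h4, rfl, rfl, fun e => ?_, ⟨⟨le_rfl, h2.le⟩, le_rfl, le_rfl⟩, ⟨⟨h1.le, le_rfl⟩, le_rfl, le_rfl⟩, h5⟩
    have : R.x0 = x := congrArg Leaf.x0 e
    exact h1.ne this
  · obtain ⟨x, hx, h1, h2, rfl⟩ := (h.inv.fitV R hR p).1 hp
    obtain ⟨S', h3, h4, h5⟩ := cutH_op2 h hR hx h1 h2 hd1 hd2 hs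
    refine ⟨S', lf3 R x it1, lf4 R x it2, h3, h4, rfl, rfl, fun e => ?_, ⟨⟨le_rfl, le_rfl⟩, le_rfl, h2.le⟩, ⟨⟨le_rfl, le_rfl⟩, h1.le, le_rfl⟩, h5⟩
    have : R.y0 = x := congrArg Leaf.y0 e
    exact h1.ne this

def lfm (R : Leaf) (j : Item) : Leaf := ⟨R.x0, R.x1, R.y0, R.y1, j⟩

/-- placing a mark -/
theorem mark_op {N : ℕ} {D : List Item} {S : St} (h : InvD N D S) {R : Leaf} (hR : R ∈ S.L)
    (hm : R.it.2.2 = 0) {j : Item} (hj : j ∈ D) (h1 : j.1 = R.it.1) (h2 : j.2.1 = R.it.2.1) :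
    ∃ S' : St, InvD N D S' ∧ ExtAt R S S' ∧ lfm R j ∈ S'.L := by
  let S' : St := ⟨{R' | (R' ∈ S.L ∧ R' ≠ R) ∨ R' = lfm R j}, S.C⟩
  have hi := h.inv
  have opm : ∀ x y, (lfm R j).Op x y ↔ R.Op x y := fun x y => Iff.rfl
  have hop : ∀ x y, (∃ R' ∈ S'.L, R'.Op x y) ↔ ∃ R' ∈ S.L, R'.Op x y := by
    intro x y
    constructor
    · rintro ⟨R', (⟨e, -⟩ | rfl), ho⟩
      · exact ⟨R', e, ho⟩
      · exact ⟨R, hR, ho⟩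
    · rintro ⟨R', e, ho⟩
      by_cases hne : R' = R
      · subst hne; exact ⟨_, Or.inr rfl, ho⟩
      · exact ⟨R', Or.inl ⟨e, hne⟩, ho⟩
  have hG : S'.G = S.G := by
    funext x y
    have := hop x y
    unfold St.G
    have : (∀ R ∈ S'.L, ¬ R.Op x y) ↔ (∀ R ∈ S.L, ¬ R.Op x y) := by
      constructor
      · intro hh R' hR' ho
        obtain ⟨R'', q1, q2⟩ := this.2 ⟨R', hR', ho⟩
        exact hh R'' q1 q2
      · intro hh R' hR' ho
        obtain ⟨R'', q1, q2⟩ := this.1 ⟨R', hR', ho⟩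
        exact hh R'' q1 q2
    simp only [this]
  have hGt : S'.tr.G = S.tr.G := by
    funext x y
    apply propext
    rw [tr_G, tr_G, hG]
  have hV : VLp N S' = VLp N S := by unfold VLp; rw [hG]
  have hVt : VLp N S'.tr = VLp N S.tr := by unfold VLp; rw [hGt]; rfl
  have hLc : LcV S' = LcV S := by unfold LcV; rw [hG]
  have hLct : LcV S'.tr = LcV S.tr := by unfold LcV; rw [hGt]; rfl
  have inv' : Inv N S' := by
    refine ⟨?_, ?_, ?_, ?_, ?_, hi.outb, hi.outt, ?_, ?_, ?_, ?_, ?_, ?_, ?_⟩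
    · apply (hi.fin.union (Set.finite_singleton (lfm R j))).subset
      rintro R' (⟨e, -⟩ | e)
      · exact Or.inl e
      · exact Or.inr e
    · rintro R' (⟨e, -⟩ | rfl)
      · exact hi.box R' e
      · exact hi.box R hR
    · rintro R1 (⟨e1, e1'⟩ | rfl) R2 (⟨e2, e2'⟩ | rfl) x y o1 o2
      · exact hi.disj _ e1 _ e2 x y o1 o2
      · exact absurd (hi.disj _ e1 _ hR x y o1 o2) e1'
      · exact absurd (hi.disj _ e2 _ hR x y o2 o1) e2'
      · rfl
    · intro x y a b c d e f
      exact (hop x y).2 (hi.cover x y a b c d e f)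
    · rw [hG]; exact hi.rat
    · rw [hG]; exact hi.mono
    · rw [hV]
      intro x y a b c d e f
      rw [hop]; exact hi.vl x y a b c d e f
    · rw [hVt]
      intro y x a b c d e f
      rcases hi.hl y x a b c d e f with ⟨R', e1, e2⟩ | e1
      · obtain ⟨R'', e3, e4⟩ := (hop x y).2 ⟨R'.tr, e1, (tr_Op _ _ _).2 e2⟩
        exact Or.inl ⟨R''.tr, e3, (tr_Op _ _ _).2 e4⟩
      · exact Or.inr e1
    · rw [hG, hLc]; exact hi.lcV
    · rw [hGt, hLct]; exact hi.lcH
    · rintro R' (⟨e, -⟩ | rfl) p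
      · exact hi.fitV R' e p
      · have := hi.fitV R hR p
        rw [← h1] at this
        exact this
    · intro R'' hR'' p
      obtain ⟨R', rfl⟩ : ∃ R' : Leaf, R'' = R'.tr := ⟨R''.tr, rfl⟩
      rcases hR'' with ⟨e, -⟩ | e
      · exact hi.fitH R'.tr e p
      · have e' : R' = lfm R j := e
        subst e'
        have := hi.fitH' hR p
        rw [← h2] at this
        exact this
  refine ⟨S', ⟨inv', ?_⟩, ⟨⟨fun x y hg => ⟨by rw [hG]; exact hg, rfl⟩, ?_, ?_⟩, fun R' e e' => Or.inl ⟨e, e'⟩, ?_⟩, Or.inr rfl⟩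
  · rintro R' (⟨e, -⟩ | rfl)
    · exact h.inD R' e
    · exact hj
  · rintro R' (⟨e, -⟩ | rfl)
    · exact ⟨R', e, Leaf.Sub.refl _⟩
    · exact ⟨R, hR, Leaf.Sub.refl R⟩
  · intro R' hR' hm'
    refine ⟨R', Or.inl ⟨hR', ?_⟩, Leaf.Sub.refl _, rfl⟩
    rintro rfl; exact hm' hm
  · rintro R' (⟨e, e'⟩ | rfl)
    · exact Or.inl ⟨e, e'⟩
    · exact Or.inr (Leaf.Sub.refl R)

/-- Doing a task for all leaves in parallel. -/
theorem par (I : St → Prop) (hfin : ∀ S, I S → S.L.Finite) (Task : Leaf → St → Prop)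
    (hmon : ∀ R S1 S2, I S1 → I S2 → Ext S1 S2 → Task R S1 → Task R S2)
    (hop : ∀ S, I S → ∀ R ∈ S.L, ∃ S', I S' ∧ ExtAt R S S' ∧ Task R S') (S : St) (hS : I S) :
    ∃ S', I S' ∧ Ext S S' ∧ ∀ R ∈ S.L, Task R S' := by
  classical
  have key : ∀ A : Finset Leaf, (∀ R ∈ A, R ∈ S.L) → ∃ S', I S' ∧ Ext S S' ∧ (∀ R ∈ A, Task R S') ∧
      ∀ R ∈ S.L, R ∉ A → R ∈ S'.L := by
    intro A
    induction A using Finset.induction_on with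
    | empty => intro _; exact ⟨S, hS, Ext.refl S, by simp, fun R h _ => h⟩
    | insert R A hRA ih =>
      intro hA
      obtain ⟨S1, h1, h2, h3, h4⟩ := ih (fun R' h => hA R' (Finset.mem_insert_of_mem h))
      obtain ⟨S2, h5, h6, h7⟩ := hop S1 h1 R (h4 R (hA R (Finset.mem_insert_self _ _)) hRA)
      refine ⟨S2, h5, h2.trans h6.toExt, fun R' hR' => ?_, fun R' hR' hn => ?_⟩
      · rcases Finset.mem_insert.1 hR' with rfl | hR'
        · exact h7
        · exact hmon R' S1 S2 h1 h5 h6.toExt (h3 R' hR')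
      · rw [Finset.mem_insert, not_or] at hn
        exact h6.keep R' (h4 R' hR' hn.2) hn.1
  obtain ⟨S', h1, h2, h3, -⟩ := key (hfin S hS).toFinset (by simp)
  exact ⟨S', h1, h2, fun R hR => h3 R (by simpa using hR)⟩

def Ovl (R R' : Leaf) : Prop := ∃ x y, R.Op x y ∧ R'.Op x y

theorem ovl_mon {Q : Leaf → Prop} (S1 S2 : St) (h : Ext S1 S2) {R : Leaf}
    (hQ : ∀ R' ∈ S1.L, ∀ R'' ∈ S2.L, R''.Sub R' → Q R' → Q R'')
    (h1 : ∀ R' ∈ S1.L, Ovl R' R → Q R') : ∀ R' ∈ S2.L, Ovl R' R → Q R' := by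
  rintro R'' h2 ⟨x, y, o1, o2⟩
  obtain ⟨R', h3, h4⟩ := h.sub R'' h2
  exact hQ R' h3 R'' h2 h4 (h1 R' h3 ⟨x, y, h4.op o1, o2⟩)

def Grid (S : St) (X Y : Set ℝ) : Prop := ∀ R ∈ S.L, (R.x0 ∈ X ∧ R.x1 ∈ X) ∧ R.y0 ∈ Y ∧ R.y1 ∈ Y

theorem lineX {N : ℕ} {D : List Item} (hD : Good N D) {X Y : Set ℝ} {x : ℝ} (hx : Rt x) (hxX : x ∈ X) (S : St)
    (h : InvD N D S) (hg : Grid S X Y) :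
    ∃ S', (InvD N D S' ∧ Grid S' X Y) ∧ Ext S S' ∧ ∀ R ∈ S'.L, ¬ (R.x0 < x ∧ x < R.x1) := by
  obtain ⟨S', h1, h2, h3⟩ := par (fun S => InvD N D S ∧ Grid S X Y) (fun S h => h.1.inv.fin)
    (fun R S => ∀ R' ∈ S.L, Ovl R' R → ¬ (R'.x0 < x ∧ x < R'.x1))
    (by
      intro R S1 S2 _ _ he
      apply ovl_mon (Q := fun R' => ¬ (R'.x0 < x ∧ x < R'.x1)) _ _ he
      rintro R' _ R'' _ hs hq ⟨q1, q2⟩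
      exact hq ⟨lt_of_le_of_lt hs.1.1 q1, lt_of_lt_of_le q2 hs.1.2⟩)
    (by
      rintro S ⟨hS, hG⟩ R hR
      by_cases hc : R.x0 < x ∧ x < R.x1
      swap
      · refine ⟨S, ⟨hS, hG⟩, ExtAt.refl R S, ?_⟩
        rintro R' hR' ⟨a, b, o1, o2⟩
        rw [hS.inv.disj _ hR' _ hR _ _ o1 o2]; exact hc
      obtain ⟨j1, d1, j2, d2, hs⟩ := hD.cutV R.it (hS.inD R hR) _ ((hS.inv.fitH' hR _).2 ⟨x, hx, hc.1, hc.2, rfl⟩)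
      obtain ⟨S', e1, e2, e3⟩ := cutV_op2 hS hR hx hc.1 hc.2 d1 d2 hs
      refine ⟨S', ⟨e1, ?_⟩, e2, ?_⟩
      · intro R' hR'
        rcases (e3 R').1 hR' with h | rfl | rfl
        · exact hG R' h.1
        · exact ⟨⟨(hG R hR).1.1, hxX⟩, (hG R hR).2⟩
        · exact ⟨⟨hxX, (hG R hR).1.2⟩, (hG R hR).2⟩
      · rintro R' hR' ⟨a, b, o1, o2⟩
        rcases (e3 R').1 hR' with h | rfl | rfl
        · exact absurd (hS.inv.disj _ h.1 _ hR _ _ o1 o2) h.2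
        · exact fun hh => lt_irrefl _ hh.2
        · exact fun hh => lt_irrefl _ hh.1) S ⟨h, hg⟩
  refine ⟨S', h1, h2, fun R' hR' => ?_⟩
  obtain ⟨R, hR, hs⟩ := h2.sub R' hR'
  obtain ⟨a, b, ho⟩ := h1.1.inv.pt hR'
  exact h3 R hR R' hR' ⟨a, b, ho, hs.op ho⟩

theorem lineY {N : ℕ} {D : List Item} (hD : Good N D) {X Y : Set ℝ} {y : ℝ} (hy : Rt y) (hyY : y ∈ Y) (S : St)
    (h : InvD N D S) (hg : Grid S X Y) :
    ∃ S', (InvD N D S' ∧ Grid S' X Y) ∧ Ext S S' ∧ ∀ R ∈ S'.L, ¬ (R.y0 < y ∧ y < R.y1) := by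
  obtain ⟨S', h1, h2, h3⟩ := par (fun S => InvD N D S ∧ Grid S X Y) (fun S h => h.1.inv.fin)
    (fun R S => ∀ R' ∈ S.L, Ovl R' R → ¬ (R'.y0 < y ∧ y < R'.y1))
    (by
      intro R S1 S2 _ _ he
      apply ovl_mon (Q := fun R' => ¬ (R'.y0 < y ∧ y < R'.y1)) _ _ he
      rintro R' _ R'' _ hs hq ⟨q1, q2⟩
      exact hq ⟨lt_of_le_of_lt hs.2.1 q1, lt_of_lt_of_le q2 hs.2.2⟩)
    (by
      rintro S ⟨hS, hG⟩ R hR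
      by_cases hc : R.y0 < y ∧ y < R.y1
      swap
      · refine ⟨S, ⟨hS, hG⟩, ExtAt.refl R S, ?_⟩
        rintro R' hR' ⟨a, b, o1, o2⟩
        rw [hS.inv.disj _ hR' _ hR _ _ o1 o2]; exact hc
      obtain ⟨j1, d1, j2, d2, hs⟩ := hD.cutH R.it (hS.inD R hR) _ ((hS.inv.fitV R hR _).2 ⟨y, hy, hc.1, hc.2, rfl⟩)
      obtain ⟨S', e1, e2, e3⟩ := cutH_op2 hS hR hy hc.1 hc.2 d1 d2 hs
      refine ⟨S', ⟨e1, ?_⟩, e2, ?_⟩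
      · intro R' hR'
        rcases (e3 R').1 hR' with h | rfl | rfl
        · exact hG R' h.1
        · exact ⟨(hG R hR).1, (hG R hR).2.1, hyY⟩
        · exact ⟨(hG R hR).1, hyY, (hG R hR).2.2⟩
      · rintro R' hR' ⟨a, b, o1, o2⟩
        rcases (e3 R').1 hR' with h | rfl | rfl
        · exact absurd (hS.inv.disj _ h.1 _ hR _ _ o1 o2) h.2
        · exact fun hh => lt_irrefl _ hh.2
        · exact fun hh => lt_irrefl _ hh.1) S ⟨h, hg⟩
  refine ⟨S', h1, h2, fun R' hR' => ?_⟩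
  obtain ⟨R, hR, hs⟩ := h2.sub R' hR'
  obtain ⟨a, b, ho⟩ := h1.1.inv.pt hR'
  exact h3 R hR R' hR' ⟨a, b, ho, hs.op ho⟩

theorem ext_uncutX {S S' : St} (h : Ext S S') {x : ℝ} (hx : ∀ R ∈ S.L, ¬ (R.x0 < x ∧ x < R.x1)) :
    ∀ R ∈ S'.L, ¬ (R.x0 < x ∧ x < R.x1) := by
  rintro R hR ⟨h1, h2⟩
  obtain ⟨R', h3, h4⟩ := h.sub R hR
  exact hx R' h3 ⟨lt_of_le_of_lt h4.1.1 h1, lt_of_lt_of_le h2 h4.1.2⟩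

theorem ext_uncutY {S S' : St} (h : Ext S S') {x : ℝ} (hx : ∀ R ∈ S.L, ¬ (R.y0 < x ∧ x < R.y1)) :
    ∀ R ∈ S'.L, ¬ (R.y0 < x ∧ x < R.y1) := by
  rintro R hR ⟨h1, h2⟩
  obtain ⟨R', h3, h4⟩ := h.sub R hR
  exact hx R' h3 ⟨lt_of_le_of_lt h4.2.1 h1, lt_of_lt_of_le h2 h4.2.2⟩

/-- alignment -/
theorem align {N : ℕ} {D : List Item} (hD : Good N D) (X Y : Finset ℝ) (hX : ∀ x ∈ X, Rt x) (hY : ∀ y ∈ Y, Rt y)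
    (S : St) (h : InvD N D S) (hg : Grid S X Y) :
    ∃ S', InvD N D S' ∧ Grid S' X Y ∧ Ext S S' ∧ (∀ R ∈ S'.L, ∀ x ∈ X, ¬ (R.x0 < x ∧ x < R.x1)) ∧
      (∀ R ∈ S'.L, ∀ y ∈ Y, ¬ (R.y0 < y ∧ y < R.y1)) := by
  classical
  have k1 : ∀ A : Finset ℝ, A ⊆ X → ∃ S', InvD N D S' ∧ Grid S' X Y ∧ Ext S S' ∧
      (∀ R ∈ S'.L, ∀ x ∈ A, ¬ (R.x0 < x ∧ x < R.x1)) := by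
    intro A
    induction A using Finset.induction_on with
    | empty => intro _; exact ⟨S, h, hg, Ext.refl S, by simp⟩
    | insert a A _ ih =>
      intro hA
      obtain ⟨S1, h1, h2, h3, h4⟩ := ih (fun x hx => hA (Finset.mem_insert_of_mem hx))
      have ha := hA (Finset.mem_insert_self a A)
      obtain ⟨S2, ⟨h5, h5'⟩, h6, h7⟩ := lineX hD (hX a ha) (Finset.mem_coe.2 ha) S1 h1 h2
      refine ⟨S2, h5, h5', h3.trans h6, fun R hR x hx => ?_⟩
      rcases Finset.mem_insert.1 hx with rfl | hx
      · exact h7 R hR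
      · exact ext_uncutX h6 (fun R hR => h4 R hR x hx) R hR
  obtain ⟨S1, h1, h2, h3, h4⟩ := k1 X (fun _ h => h)
  have k2 : ∀ A : Finset ℝ, A ⊆ Y → ∃ S', InvD N D S' ∧ Grid S' X Y ∧ Ext S1 S' ∧
      (∀ R ∈ S'.L, ∀ x ∈ A, ¬ (R.y0 < x ∧ x < R.y1)) := by
    intro A
    induction A using Finset.induction_on with
    | empty => intro _; exact ⟨S1, h1, h2, Ext.refl S1, by simp⟩
    | insert a A _ ih =>
      intro hA
      obtain ⟨S2, h1, h2, h3, h4⟩ := ih (fun x hx => hA (Finset.mem_insert_of_mem hx))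
      have ha := hA (Finset.mem_insert_self a A)
      obtain ⟨S3, ⟨h5, h5'⟩, h6, h7⟩ := lineY hD (hY a ha) (Finset.mem_coe.2 ha) S2 h1 h2
      refine ⟨S3, h5, h5', h3.trans h6, fun R hR x hx => ?_⟩
      rcases Finset.mem_insert.1 hx with rfl | hx
      · exact h7 R hR
      · exact ext_uncutY h6 (fun R hR => h4 R hR x hx) R hR
  obtain ⟨S2, e1, e2, e3, e4⟩ := k2 Y (fun _ h => h)
  exact ⟨S2, e1, e2, h3.trans e3, fun R hR x hx => ext_uncutX e3 (fun R hR => h4 R hR x hx) R hR, e4⟩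

end TL

namespace TL

theorem chain2_min (V : List Ltr2) (hne : ∃ p, p ∈ V) (hc : ∀ p ∈ V, ∀ q ∈ V, L2 p q ∨ L2 q p) :
    (∃ p ∈ V, IsMin V p) ∧ ∃ p ∈ V, IsMax V p := by
  classical
  have hne' : V.toFinset.Nonempty := by
    obtain ⟨p, hp⟩ := hne
    exact ⟨p, by simpa using hp⟩
  constructor
  · obtain ⟨m, hm, hmin⟩ := V.toFinset.exists_min_image (fun p => rk p.1 + rk p.2) hne'
    rw [List.mem_toFinset] at hm
    refine ⟨m, hm, hm, fun q hq => ?_⟩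
    rcases hc m hm q hq with h | h
    · exact h
    · have h3 := hmin q (by simpa using hq)
      have h1 := h.1.rk_le
      have h2 := h.2.rk_le
      have : q = m := Prod.ext (h.1.eq_of_rk (by omega)) (h.2.eq_of_rk (by omega))
      rw [this]; exact L2.refl _
  · obtain ⟨m, hm, hmin⟩ := V.toFinset.exists_max_image (fun p => rk p.1 + rk p.2) hne'
    rw [List.mem_toFinset] at hm
    refine ⟨m, hm, hm, fun q hq => ?_⟩
    rcases hc q hq m hm with h | h
    · exact h
    · have h3 := hmin q (by simpa using hq)
      have h1 := h.1.rk_le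
      have h2 := h.2.rk_le
      have : m = q := Prod.ext (h.1.eq_of_rk (by omega)) (h.2.eq_of_rk (by omega))
      rw [this]; exact L2.refl _

theorem Inv.minmax {N : ℕ} {S : St} (h : Inv N S) {R : Leaf} (hR : R ∈ S.L) :
    (∃ p ∈ R.it.1, IsMin R.it.1 p) ∧ ∃ p ∈ R.it.1, IsMax R.it.1 p := by
  have b := h.box R hR
  apply chain2_min
  · obtain ⟨y, hy, h1, h2⟩ := rt_btwn b.2.2.2.2.1
    exact ⟨_, (h.fitV R hR _).2 ⟨y, hy, h1, h2, rfl⟩⟩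
  · intro p hp q hq
    obtain ⟨y, hy, h1, h2, rfl⟩ := (h.fitV R hR _).1 hp
    obtain ⟨y', hy', h1', h2', rfl⟩ := (h.fitV R hR _).1 hq
    rcases le_total y y' with hh | hh
    · exact Or.inl ⟨h.mono _ _ _ _ (h.leftG hR hy h1.le h2.le) (h.leftG hR hy' h1'.le h2'.le) le_rfl hh,
        h.mono _ _ _ _ (h.rightG hR hy h1.le h2.le) (h.rightG hR hy' h1'.le h2'.le) le_rfl hh⟩
    · exact Or.inr ⟨h.mono _ _ _ _ (h.leftG hR hy' h1'.le h2'.le) (h.leftG hR hy h1.le h2.le) le_rfl hh,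
        h.mono _ _ _ _ (h.rightG hR hy' h1'.le h2'.le) (h.rightG hR hy h1.le h2.le) le_rfl hh⟩

theorem Inv.rng_ex {N : ℕ} {S : St} (h : Inv N S) {R : Leaf} (hR : R ∈ S.L) : ∃ a b, Rng R.it a b := by
  obtain ⟨⟨p, h1, h2⟩, q, h3, h4⟩ := h.minmax hR
  exact ⟨p.1, q.2, ⟨p, h1, h2, rfl⟩, q, h3, h4, rfl⟩

theorem rng_mono {N : ℕ} {S1 S2 : St} (h1 : Inv N S1) (h2 : Inv N S2) (he : Ext S1 S2) {R R' : Leaf}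
    (hR : R ∈ S1.L) (hR' : R' ∈ S2.L) (hs : R'.Sub R) {a b a' b' : Ltr} (hr : Rng R.it a b)
    (hr' : Rng R'.it a' b') : Le a a' ∧ Le b' b := by
  obtain ⟨⟨p, hp, hmin, rfl⟩, q, hq, hmax, rfl⟩ := hr
  obtain ⟨⟨p', hp', hmin', rfl⟩, q', hq', hmax', rfl⟩ := hr'
  have bb := h1.box R hR
  have bb' := h2.box R' hR'
  constructor
  · obtain ⟨y, hy, e1, e2, rfl⟩ := (h2.fitV R' hR' _).1 hp'
    have e3 := lt_of_le_of_lt hs.2.1 e1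
    have e4 := lt_of_lt_of_le e2 hs.2.2
    have k1 := (hmin.2 _ ((h1.fitV R hR _).2 ⟨y, hy, e3, e4, rfl⟩)).1
    obtain ⟨k2, k3⟩ := he.g _ _ (h1.leftG hR hy e3.le e4.le)
    refine k1.trans ?_
    dsimp only
    rw [← k3]
    exact h2.mono _ _ _ _ k2 (h2.leftG hR' hy e1.le e2.le) hs.1.1 le_rfl
  · obtain ⟨y, hy, e1, e2, rfl⟩ := (h2.fitV R' hR' _).1 hq'
    have e3 := lt_of_le_of_lt hs.2.1 e1
    have e4 := lt_of_lt_of_le e2 hs.2.2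
    have k1 := (hmax.2 _ ((h1.fitV R hR _).2 ⟨y, hy, e3, e4, rfl⟩)).2
    obtain ⟨k2, k3⟩ := he.g _ _ (h1.rightG hR hy e3.le e4.le)
    refine Le.trans ?_ k1
    dsimp only
    rw [← k3]
    exact h2.mono _ _ _ _ (h2.rightG hR' hy e1.le e2.le) k2 hs.1.2 le_rfl

def Leaf.Inr (R : Leaf) : Prop := 0 < R.x0 ∧ R.x1 < 1 ∧ 0 < R.y0 ∧ R.y1 < 1

theorem Inv.allR {N : ℕ} {S : St} (h : Inv N S) {R : Leaf} (hR : R ∈ S.L) (hi : R.Inr) : AllR N R.it := by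
  have b := h.box R hR
  obtain ⟨i1, i2, i3, i4⟩ := hi
  constructor
  · intro p hp
    obtain ⟨y, hy, h1, h2, rfl⟩ := (h.fitV R hR _).1 hp
    exact ⟨(h.rat _ _ (h.leftG hR hy h1.le h2.le) i1 (by linarith) (by linarith) (by linarith)).1,
      (h.rat _ _ (h.rightG hR hy h1.le h2.le) (by linarith) (by linarith) (by linarith) (by linarith)).1⟩
  · intro p hp
    obtain ⟨y, hy, h1, h2, rfl⟩ := (h.fitH' hR _).1 hp
    exact ⟨(h.rat _ _ (h.botG hR hy h1.le h2.le) (by linarith) (by linarith) (by linarith) (by linarith)).1,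
      (h.rat _ _ (h.topG hR hy h1.le h2.le) (by linarith) (by linarith) (by linarith) (by linarith)).1⟩

def Qb (N : ℕ) (a b : Ltr) (R' : Leaf) : Prop :=
  Rng R'.it a b → Adm N a b ∧ (R'.it.2.2 ≠ 0 → B N a b R'.it.2.2)

theorem clo_op {N : ℕ} {D : List Item} {a b : Ltr} {it : Item} (hc : Clo N D a b it) :
    ∀ S, InvD N D S → ∀ R ∈ S.L, R.it = it → ∃ S', InvD N D S' ∧ ExtAt R S S' ∧
      ∀ R' ∈ S'.L, R'.Sub R → Qb N a b R' := by
  refine hc.ind (fun it => ∀ S, InvD N D S → ∀ R ∈ S.L, R.it = it → ∃ S', InvD N D S' ∧ ExtAt R S S' ∧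
      ∀ R' ∈ S'.L, R'.Sub R → Qb N a b R') ?_
  rintro j hj (hb | ⟨j1, d1, j2, d2, P1, P2, hs⟩) S hS R hR rfl
  · refine ⟨S, hS, ExtAt.refl R S, fun R' hR' hsub => ?_⟩
    rw [hS.inv.sub_eq hR hR' hsub]
    intro hr
    rcases hb hr with ⟨e1, e2⟩ | ⟨e1, e2⟩
    · exact ⟨e2, fun h => absurd e1 h⟩
    · exact ⟨⟨_, e2.1, e2⟩, fun _ => e2⟩
  · obtain ⟨S1, R1, R2, i1, x1, t1, t2, hne, s1, s2, hL⟩ := spl_op hS hR d1 d2 hs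
    have m1 : R1 ∈ S1.L := (hL R1).2 (Or.inr (Or.inl rfl))
    have m2 : R2 ∈ S1.L := (hL R2).2 (Or.inr (Or.inr rfl))
    obtain ⟨S2, i2, x2, q2⟩ := P1 S1 i1 R1 m1 t1
    have m2' := x2.keep R2 m2 hne.symm
    obtain ⟨S3, i3, x3, q3⟩ := P2 S2 i2 R2 m2' t2
    have x12 := ExtAt.trans hS.inv hR s1 x1 x2
    refine ⟨S3, i3, ExtAt.trans hS.inv hR s2 x12 x3, fun R' hR' hsub => ?_⟩
    rcases x3.new R' hR' with ⟨e1, e2⟩ | e1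
    · rcases x2.new R' e1 with ⟨e3, e4⟩ | e3
      · exfalso
        rcases (hL R').1 e3 with ⟨e5, e6⟩ | e5 | e5
        · exact e6 (hS.inv.sub_eq hR e5 hsub)
        · exact e4 e5
        · exact e2 e5
      · exact q2 R' e1 e3
    · exact q3 R' hR' e1

def Wk (N : ℕ) (a b : Ltr) (R' : Leaf) : Prop :=
  ∀ a' b', Rng R'.it a' b' → (Le a a' ∧ Le b' b) ∧ (a' = a → b' = b → Adm N a b)

def TaskC (N : ℕ) (R : Leaf) (S : St) : Prop :=
  R.Inr → ∀ a b, Rng R.it a b → (∀ R' ∈ S.L, Ovl R' R → R'.Sub R ∧ Wk N a b R') ∧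
    (R.it.2.2 ≠ 0 → ∃ R' ∈ S.L, R'.Sub R ∧ R'.it.2.2 = R.it.2.2 ∧ (Rng R'.it a b → B N a b R.it.2.2))

theorem Inv.ovl_of_sub {N : ℕ} {S : St} (h : Inv N S) {R R' : Leaf} (hR' : R' ∈ S.L) (hs : R'.Sub R) : Ovl R' R := by
  obtain ⟨x, y, ho⟩ := h.pt hR'
  exact ⟨x, y, ho, hs.op ho⟩

theorem taskC_mon {N : ℕ} {D : List Item} (R : Leaf) (S1 S2 : St) (h1 : InvD N D S1) (h2 : InvD N D S2)
    (he : Ext S1 S2) (ht : TaskC N R S1) : TaskC N R S2 := by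
  intro hi a b hr
  obtain ⟨t1, t2⟩ := ht hi a b hr
  constructor
  · rintro R'' hR'' ⟨x, y, o1, o2⟩
    obtain ⟨R', hR', hs⟩ := he.sub R'' hR''
    obtain ⟨s1, w1⟩ := t1 R' hR' ⟨x, y, hs.op o1, o2⟩
    refine ⟨hs.trans s1, fun a'' b'' hr'' => ?_⟩
    obtain ⟨a', b', hr'⟩ := h1.inv.rng_ex hR'
    obtain ⟨⟨u1, u2⟩, u3⟩ := w1 a' b' hr'
    obtain ⟨v1, v2⟩ := rng_mono h1.inv h2.inv he hR' hR'' hs hr' hr''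
    refine ⟨⟨u1.trans v1, v2.trans u2⟩, ?_⟩
    rintro rfl rfl
    exact u3 (v1.antisymm u1) (u2.antisymm v2)
  · intro hm
    obtain ⟨R', hR', hs, hmm, hb⟩ := t2 hm
    obtain ⟨R'', hR'', hs', hm'⟩ := he.mrk R' hR' (by rw [hmm]; exact hm)
    refine ⟨R'', hR'', hs'.trans hs, hm'.trans hmm, fun hr'' => hb ?_⟩
    obtain ⟨a', b', hr'⟩ := h1.inv.rng_ex hR'
    obtain ⟨⟨u1, u2⟩, u3⟩ := (t1 R' hR' (h1.inv.ovl_of_sub hR' hs)).2 a' b' hr'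
    obtain ⟨v1, v2⟩ := rng_mono h1.inv h2.inv he hR' hR'' hs' hr' hr''
    rw [v1.antisymm u1, u2.antisymm v2] at hr'
    exact hr'

theorem taskC_op {N : ℕ} {D : List Item} (hD : Good N D) (S : St) (h : InvD N D S) :
    ∃ S', InvD N D S' ∧ Ext S S' ∧ ∀ R ∈ S.L, TaskC N R S' := by
  apply par (fun S => InvD N D S) (fun S h => h.inv.fin) (TaskC N)
  · intro R S1 S2 h1 h2 he ht
    exact taskC_mon R S1 S2 h1 h2 he ht
  swap
  · exact h
  intro S hS R hR
  by_cases hi : R.Inr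
  swap
  · exact ⟨S, hS, ExtAt.refl R S, fun h => absurd h hi⟩
  obtain ⟨a, b, hr⟩ := hS.inv.rng_ex hR
  obtain ⟨⟨p, hp, hmin, rfl⟩, q, hq, hmax, rfl⟩ := id hr
  obtain ⟨S', i1, x1, q1⟩ := clo_op (hD.clo R.it (hS.inD R hR) (hS.inv.allR hR hi) p hp q hq hmin hmax) S hS R hR rfl
  refine ⟨S', i1, x1, fun _ a b hr' => ?_⟩
  obtain ⟨k1, k2⟩ := rng_mono hS.inv hS.inv (Ext.refl S) hR hR (Leaf.Sub.refl R) hr hr'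
  obtain ⟨k3, k4⟩ := rng_mono hS.inv hS.inv (Ext.refl S) hR hR (Leaf.Sub.refl R) hr' hr
  have e1 := k1.antisymm k3
  have e2 := k4.antisymm k2
  subst e1 e2
  constructor
  · rintro R' hR' ⟨x, y, o1, o2⟩
    have hs : R'.Sub R := by
      rcases x1.new R' hR' with ⟨e1, e2⟩ | e1
      · exact absurd (hS.inv.disj _ e1 _ hR _ _ o1 o2) e2
      · exact e1
    refine ⟨hs, fun a' b' hr'' => ⟨rng_mono hS.inv i1.inv x1.toExt hR hR' hs hr hr'', ?_⟩⟩
    rintro rfl rfl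
    exact (q1 R' hR' hs hr'').1
  · intro hm
    obtain ⟨R', hR', hs, hmm⟩ := x1.mrk R hR hm
    refine ⟨R', hR', hs, hmm, fun hr'' => ?_⟩
    have := (q1 R' hR' hs hr'').2 (by rw [hmm]; exact hm)
    rwa [hmm] at this

/-! insets -/

def Leaf.SIn (R' R : Leaf) : Prop := (R.x0 < R'.x0 ∧ R'.x1 < R.x1) ∧ R.y0 < R'.y0 ∧ R'.y1 < R.y1

theorem inset_op {N : ℕ} {D : List Item} (hD : Good N D) (S : St) (h : InvD N D S) (R : Leaf) (hR : R ∈ S.L)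
    (hm : R.it.2.2 ≠ 0) : ∃ S', InvD N D S' ∧ ExtAt R S S' ∧ ∃ R' ∈ S'.L, R'.SIn R ∧ R'.it.2.2 = R.it.2.2 := by
  obtain ⟨⟨p, hp, j1, d1, j2, d2, hs, hj⟩, -⟩ := hD.insV R.it (h.inD R hR) hm
  obtain ⟨x, hx, h1, h2, rfl⟩ := (h.inv.fitH' hR p).1 hp
  obtain ⟨S1, i1, x1, L1⟩ := cutV_op2 h hR hx h1 h2 d1 d2 hs
  have m1 : lf1 R x j1 ∈ S1.L := (L1 _).2 (Or.inr (Or.inl rfl))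
  generalize hR1 : lf1 R x j1 = R1 at m1
  have s1 : R1.Sub R := by rw [← hR1]; exact ⟨⟨le_rfl, h2.le⟩, le_rfl, le_rfl⟩
  have t1 : R1.x1 < R.x1 := by rw [← hR1]; exact h2
  have hm1 : R1.it.2.2 = R.it.2.2 := by rw [← hR1]; exact hj
  clear hs hj d1 d2 L1 hR1 hp h1 h2
  obtain ⟨-, p, hp, j1, d1, j2, d2, hs, hj⟩ := hD.insV R1.it (i1.inD R1 m1) (by rw [hm1]; exact hm)
  obtain ⟨x, hx, h1, h2, rfl⟩ := (i1.inv.fitH' m1 p).1 hp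
  obtain ⟨S2, i2, x2, L2⟩ := cutV_op2 i1 m1 hx h1 h2 d1 d2 hs
  have m2 : lf2 R1 x j2 ∈ S2.L := (L2 _).2 (Or.inr (Or.inr rfl))
  generalize hR2 : lf2 R1 x j2 = R2 at m2
  have s2 : R2.Sub R1 := by rw [← hR2]; exact ⟨⟨h1.le, le_rfl⟩, le_rfl, le_rfl⟩
  have t2 : R1.x0 < R2.x0 := by rw [← hR2]; exact h1
  have hm2 : R2.it.2.2 = R.it.2.2 := by rw [← hR2]; exact hj.trans hm1
  clear hs hj d1 d2 L2 hR2 hp h1 h2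
  obtain ⟨⟨p, hp, j1, d1, j2, d2, hs, hj⟩, -⟩ := hD.insH R2.it (i2.inD R2 m2) (by rw [hm2]; exact hm)
  obtain ⟨x, hx, h1, h2, rfl⟩ := (i2.inv.fitV _ m2 p).1 hp
  obtain ⟨S3, i3, x3, L3⟩ := cutH_op2 i2 m2 hx h1 h2 d1 d2 hs
  have m3 : lf3 R2 x j1 ∈ S3.L := (L3 _).2 (Or.inr (Or.inl rfl))
  generalize hR3 : lf3 R2 x j1 = R3 at m3
  have s3 : R3.Sub R2 := by rw [← hR3]; exact ⟨⟨le_rfl, le_rfl⟩, le_rfl, h2.le⟩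
  have t3 : R3.y1 < R2.y1 := by rw [← hR3]; exact h2
  have hm3 : R3.it.2.2 = R.it.2.2 := by rw [← hR3]; exact hj.trans hm2
  clear hs hj d1 d2 L3 hR3 hp h1 h2
  obtain ⟨-, p, hp, j1, d1, j2, d2, hs, hj⟩ := hD.insH R3.it (i3.inD R3 m3) (by rw [hm3]; exact hm)
  obtain ⟨x, hx, h1, h2, rfl⟩ := (i3.inv.fitV _ m3 p).1 hp
  obtain ⟨S4, i4, x4, L4⟩ := cutH_op2 i3 m3 hx h1 h2 d1 d2 hs
  have m4 : lf4 R3 x j2 ∈ S4.L := (L4 _).2 (Or.inr (Or.inr rfl))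
  generalize hR4 : lf4 R3 x j2 = R4 at m4
  have s4 : R4.Sub R3 := by rw [← hR4]; exact ⟨⟨le_rfl, le_rfl⟩, h1.le, le_rfl⟩
  have t4 : R3.y0 < R4.y0 := by rw [← hR4]; exact h1
  have hm4 : R4.it.2.2 = R.it.2.2 := by rw [← hR4]; exact hj.trans hm3
  have s12 := s2.trans s1
  have s123 := s3.trans s12
  refine ⟨S4, i4, ExtAt.trans h.inv hR s123 (ExtAt.trans h.inv hR s12 (ExtAt.trans h.inv hR s1 x1 x2) x3) x4,
    R4, m4, ⟨⟨?_, ?_⟩, ?_, ?_⟩, hm4⟩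
  · linarith [s1.1.1, s3.1.1, s4.1.1]
  · linarith [s2.1.2, s3.1.2, s4.1.2]
  · linarith [s1.2.1, s2.2.1, s3.2.1]
  · linarith [s1.2.2, s2.2.2, s4.2.2]

theorem taskI_op {N : ℕ} {D : List Item} (hD : Good N D) (S : St) (h : InvD N D S) :
    ∃ S', InvD N D S' ∧ Ext S S' ∧ ∀ R ∈ S.L, R.it.2.2 ≠ 0 → ∃ R' ∈ S'.L, R'.SIn R ∧ R'.it.2.2 = R.it.2.2 := by
  apply par (fun S => InvD N D S) (fun S h => h.inv.fin)
    (fun R S' => R.it.2.2 ≠ 0 → ∃ R' ∈ S'.L, R'.SIn R ∧ R'.it.2.2 = R.it.2.2)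
  · intro R S1 S2 h1 h2 he ht hm
    obtain ⟨R', hR', hs, hm'⟩ := ht hm
    obtain ⟨R'', hR'', hs', hm''⟩ := he.mrk R' hR' (by rw [hm']; exact hm)
    refine ⟨R'', hR'', ⟨⟨?_, ?_⟩, ?_, ?_⟩, hm''.trans hm'⟩
    · exact lt_of_lt_of_le hs.1.1 hs'.1.1
    · exact lt_of_le_of_lt hs'.1.2 hs.1.2
    · exact lt_of_lt_of_le hs.2.1 hs'.2.1
    · exact lt_of_le_of_lt hs'.2.2 hs.2.2
  · intro S hS R hR
    by_cases hm : R.it.2.2 = 0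
    · exact ⟨S, hS, ExtAt.refl R S, fun h => absurd hm h⟩
    · obtain ⟨S', h1, h2, h3⟩ := inset_op hD S hS R hR hm
      exact ⟨S', h1, h2, fun _ => h3⟩
  · exact h

end TL

namespace TL

theorem Inv.minV {N : ℕ} {S : St} (h : Inv N S) {R : Leaf} (hR : R ∈ S.L) (h0 : 0 < R.y0) :
    IsMin R.it.1 (S.C R.x0 R.y0, S.C R.x1 R.y0) := by
  have b := h.box R hR
  have g0 := h.leftG hR b.2.1 le_rfl b.2.2.2.2.1.le
  have g1 := h.rightG hR b.2.1 le_rfl b.2.2.2.2.1.le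
  have hy1 : R.y0 < 1 := by linarith [b.2.2.2.2.1, b.2.2.2.2.2]
  obtain ⟨e1, he1, k1⟩ := h.lcV _ _ g0 h0 hy1
  obtain ⟨e2, he2, k2⟩ := h.lcV _ _ g1 h0 hy1
  constructor
  · have : R.y0 < min R.y1 (min (R.y0 + e1) (R.y0 + e2)) :=
      lt_min b.2.2.2.2.1 (lt_min (by linarith) (by linarith))
    obtain ⟨y, hy, q1, q2⟩ := rt_btwn this
    rw [lt_min_iff, lt_min_iff] at q2
    obtain ⟨q2, q3, q4⟩ := q2
    rw [h.fitV R hR]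
    refine ⟨y, hy, q1, q2, ?_⟩
    rw [k1 y (by rw [abs_lt]; constructor <;> linarith) (h.leftG hR hy q1.le q2.le),
      k2 y (by rw [abs_lt]; constructor <;> linarith) (h.rightG hR hy q1.le q2.le)]
  · intro q hq
    obtain ⟨y, hy, q1, q2, rfl⟩ := (h.fitV R hR q).1 hq
    exact ⟨h.mono _ _ _ _ g0 (h.leftG hR hy q1.le q2.le) le_rfl q1.le,
      h.mono _ _ _ _ g1 (h.rightG hR hy q1.le q2.le) le_rfl q1.le⟩

theorem Inv.maxV {N : ℕ} {S : St} (h : Inv N S) {R : Leaf} (hR : R ∈ S.L) (h0 : R.y1 < 1) :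
    IsMax R.it.1 (S.C R.x0 R.y1, S.C R.x1 R.y1) := by
  have b := h.box R hR
  have g0 := h.leftG hR b.2.2.1 b.2.2.2.2.1.le le_rfl
  have g1 := h.rightG hR b.2.2.1 b.2.2.2.2.1.le le_rfl
  have hy1 : 0 < R.y1 := by linarith [b.2.2.2.2.1, b.2.2.2.1]
  obtain ⟨e1, he1, k1⟩ := h.lcV _ _ g0 hy1 h0
  obtain ⟨e2, he2, k2⟩ := h.lcV _ _ g1 hy1 h0
  constructor
  · have : max R.y0 (max (R.y1 - e1) (R.y1 - e2)) < R.y1 :=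
      max_lt b.2.2.2.2.1 (max_lt (by linarith) (by linarith))
    obtain ⟨y, hy, q1, q2⟩ := rt_btwn this
    rw [max_lt_iff, max_lt_iff] at q1
    obtain ⟨q1, q3, q4⟩ := q1
    rw [h.fitV R hR]
    refine ⟨y, hy, q1, q2, ?_⟩
    rw [k1 y (by rw [abs_lt]; constructor <;> linarith) (h.leftG hR hy q1.le q2.le),
      k2 y (by rw [abs_lt]; constructor <;> linarith) (h.rightG hR hy q1.le q2.le)]
  · intro q hq
    obtain ⟨y, hy, q1, q2, rfl⟩ := (h.fitV R hR q).1 hq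
    exact ⟨h.mono _ _ _ _ (h.leftG hR hy q1.le q2.le) g0 le_rfl q2.le,
      h.mono _ _ _ _ (h.rightG hR hy q1.le q2.le) g1 le_rfl q2.le⟩

/-- executing a demand inside a leaf -/
theorem dem_leaf {N : ℕ} {D : List Item} {S : St} (h : InvD N D S) {R : Leaf} (hR : R ∈ S.L) {i : ℕ}
    (hd : Dem N D R.it i) : ∃ S', InvD N D S' ∧ Ext S S' ∧ ∃ R' ∈ S'.L, R'.Sub R ∧ Mem i R'.it.2.2 := by
  have mk : ∀ S, InvD N D S → ∀ R ∈ S.L, R.it.2.2 = 0 → Mk D R.it i →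
      ∃ S', InvD N D S' ∧ Ext S S' ∧ ∃ R' ∈ S'.L, R'.Sub R ∧ Mem i R'.it.2.2 := by
    rintro S hS R hR hm ⟨j, hj, e1, e2, e3⟩
    obtain ⟨S', h1, h2, h3⟩ := mark_op hS hR hm hj e1 e2
    exact ⟨S', h1, h2.toExt, _, h3, Leaf.Sub.refl R, e3⟩
  rcases hd with ⟨h1, h2⟩ | ⟨h1, h2⟩ | ⟨h1, j1, d1, j2, d2, hs, hh⟩
  · exact mk S h R hR h1 h2
  · exact ⟨S, h, Ext.refl S, R, hR, Leaf.Sub.refl R, h2⟩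
  · obtain ⟨S1, R1, R2, i1, x1, t1, t2, hne, s1, s2, hL⟩ := spl_op h hR d1 d2 hs
    rcases hh with ⟨h2, h3⟩ | ⟨h2, h3⟩
    · obtain ⟨S', k1, k2, R', k3, k4, k5⟩ := mk S1 i1 R1 ((hL _).2 (Or.inr (Or.inl rfl))) (by rw [t1]; exact h2)
        (by rw [t1]; exact h3)
      exact ⟨S', k1, x1.toExt.trans k2, R', k3, k4.trans s1, k5⟩
    · obtain ⟨S', k1, k2, R', k3, k4, k5⟩ := mk S1 i1 R2 ((hL _).2 (Or.inr (Or.inr rfl))) (by rw [t2]; exact h2)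
        (by rw [t2]; exact h3)
      exact ⟨S', k1, x1.toExt.trans k2, R', k3, k4.trans s2, k5⟩

theorem near_right (X : Finset ℝ) (p : ℝ) (h1 : p < 1) : ∃ x, Irrational x ∧ p < x ∧ x < 1 ∧ ∀ z ∈ X, p < z → x < z := by
  classical
  have : ∃ c, p < c ∧ c ≤ 1 ∧ ∀ z ∈ X, p < z → c ≤ z := by
    induction X using Finset.induction_on with
    | empty => exact ⟨1, h1, le_rfl, by simp⟩
    | insert a A _ ih =>
      obtain ⟨c, e1, e2, e3⟩ := ih
      by_cases ha : p < a
      · refine ⟨min c a, lt_min e1 ha, (min_le_left _ _).trans e2, fun z hz hp => ?_⟩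
        rcases Finset.mem_insert.1 hz with rfl | hz
        · exact min_le_right _ _
        · exact (min_le_left _ _).trans (e3 z hz hp)
      · refine ⟨c, e1, e2, fun z hz hp => ?_⟩
        rcases Finset.mem_insert.1 hz with rfl | hz
        · exact absurd hp ha
        · exact e3 z hz hp
  obtain ⟨c, e1, e2, e3⟩ := this
  obtain ⟨x, hx, q1, q2⟩ := irr_btwn e1
  exact ⟨x, hx, q1, by linarith, fun z hz hp => lt_of_lt_of_le q2 (e3 z hz hp)⟩

theorem near_left (X : Finset ℝ) (p : ℝ) (h1 : 0 < p) : ∃ x, Irrational x ∧ x < p ∧ 0 < x ∧ ∀ z ∈ X, z < p → z < x := by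
  classical
  have : ∃ c, c < p ∧ 0 ≤ c ∧ ∀ z ∈ X, z < p → z ≤ c := by
    induction X using Finset.induction_on with
    | empty => exact ⟨0, h1, le_rfl, by simp⟩
    | insert a A _ ih =>
      obtain ⟨c, e1, e2, e3⟩ := ih
      by_cases ha : a < p
      · refine ⟨max c a, max_lt e1 ha, e2.trans (le_max_left _ _), fun z hz hp => ?_⟩
        rcases Finset.mem_insert.1 hz with rfl | hz
        · exact le_max_right _ _
        · exact (e3 z hz hp).trans (le_max_left _ _)
      · refine ⟨c, e1, e2, fun z hz hp => ?_⟩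
        rcases Finset.mem_insert.1 hz with rfl | hz
        · exact absurd hp ha
        · exact e3 z hz hp
  obtain ⟨c, e1, e2, e3⟩ := this
  obtain ⟨x, hx, q1, q2⟩ := irr_btwn e1
  exact ⟨x, hx, q2, by linarith, fun z hz hp => lt_of_le_of_lt (e3 z hz hp) q1⟩

/-- alignment to a common grid containing the point `(qx,qy)` -/
theorem align_all {N : ℕ} {D : List Item} (hD : Good N D) {S : St} (h : InvD N D S) {qx qy : ℝ} (hq : S.G qx qy) :
    ∃ (S' : St) (X Y : Finset ℝ), InvD N D S' ∧ Ext S S' ∧ Grid S' X Y ∧ qx ∈ X ∧ qy ∈ Y ∧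
      (∀ x ∈ X, ∀ y ∈ Y, S'.G x y) ∧ (∀ R ∈ S'.L, ∀ x ∈ X, ¬ (R.x0 < x ∧ x < R.x1)) ∧
      (∀ R ∈ S'.L, ∀ y ∈ Y, ¬ (R.y0 < y ∧ y < R.y1)) := by
  classical
  let L := h.inv.fin.toFinset
  have hL : ∀ R, R ∈ L ↔ R ∈ S.L := by intro R; simp [L]
  let X : Finset ℝ := insert qx (L.image Leaf.x0 ∪ L.image Leaf.x1)
  let Y : Finset ℝ := insert qy (L.image Leaf.y0 ∪ L.image Leaf.y1)
  have hX : ∀ x ∈ X, Rt x ∧ 0 ≤ x ∧ x ≤ 1 := by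
    intro x hx
    simp only [X, Finset.mem_insert, Finset.mem_union, Finset.mem_image] at hx
    rcases hx with rfl | ⟨R, hR, rfl⟩ | ⟨R, hR, rfl⟩
    · exact ⟨hq.1, hq.2.2.1⟩
    · have b := (h.inv.box R ((hL R).1 hR)).1
      exact ⟨b.1, b.2.2.1, by linarith [b.2.2.2.1, b.2.2.2.2]⟩
    · have b := (h.inv.box R ((hL R).1 hR)).1
      exact ⟨b.2.1, by linarith [b.2.2.2.1, b.2.2.1], b.2.2.2.2⟩
  have hY : ∀ x ∈ Y, Rt x ∧ 0 ≤ x ∧ x ≤ 1 := by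
    intro x hx
    simp only [Y, Finset.mem_insert, Finset.mem_union, Finset.mem_image] at hx
    rcases hx with rfl | ⟨R, hR, rfl⟩ | ⟨R, hR, rfl⟩
    · exact ⟨hq.2.1, hq.2.2.2.1⟩
    · have b := (h.inv.box R ((hL R).1 hR)).2
      exact ⟨b.1, b.2.2.1, by linarith [b.2.2.2.1, b.2.2.2.2]⟩
    · have b := (h.inv.box R ((hL R).1 hR)).2
      exact ⟨b.2.1, by linarith [b.2.2.2.1, b.2.2.1], b.2.2.2.2⟩
  have hg : Grid S X Y := by
    intro R hR
    have hR' := (hL R).2 hR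
    have f : ∀ g : Leaf → ℝ, g R ∈ L.image g := fun g => Finset.mem_image_of_mem g hR'
    simp only [X, Y, Finset.mem_coe, Finset.mem_insert, Finset.mem_union]
    exact ⟨⟨Or.inr (Or.inl (f _)), Or.inr (Or.inr (f _))⟩, Or.inr (Or.inl (f _)), Or.inr (Or.inr (f _))⟩
  obtain ⟨S', e1, e2, e3, e4, e5⟩ := align hD X Y (fun x hx => (hX x hx).1) (fun x hx => (hY x hx).1) S h hg
  refine ⟨S', X, Y, e1, e3, e2, Finset.mem_insert_self _ _, Finset.mem_insert_self _ _, ?_, e4, e5⟩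
  intro x hx y hy
  exact ⟨(hX x hx).1, (hY y hy).1, (hX x hx).2, (hY y hy).2, fun R hR ho => e4 R hR x hx ⟨ho.1, ho.2.1⟩⟩

theorem demF_op {N : ℕ} {D : List Item} (hD : Good N D) {S : St} (h : InvD N D S) {qx qy : ℝ} (hq : S.G qx qy)
    (hx0 : 0 < qx) (hx1 : qx < 1) (hy0 : 0 < qy) (hy1 : qy < 1) {i : ℕ} (hi : i < N + 1)
    (hm : Mem i (S.C qx qy).1) :
    ∃ S', InvD N D S' ∧ Ext S S' ∧ ∃ R' ∈ S'.L, qx ≤ R'.x0 ∧ qy ≤ R'.y0 ∧ Mem i R'.it.2.2 := by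
  classical
  obtain ⟨S1, X, Y, i1, x1, hg, mqx, mqy, hG, uX, uY⟩ := align_all hD h hq
  let P := (X ×ˢ Y).filter (fun p => (qx ≤ p.1 ∧ p.1 < 1) ∧ (qy ≤ p.2 ∧ p.2 < 1) ∧ Mem i (S1.C p.1 p.2).1)
  have hP : ∀ p, p ∈ P ↔ (p.1 ∈ X ∧ p.2 ∈ Y) ∧ (qx ≤ p.1 ∧ p.1 < 1) ∧ (qy ≤ p.2 ∧ p.2 < 1) ∧ Mem i (S1.C p.1 p.2).1 := by
    intro p; simp [P]
  obtain ⟨p, hp, hmax⟩ := P.exists_max_image (fun p => p.1 + p.2)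
    ⟨(qx, qy), (hP _).2 ⟨⟨mqx, mqy⟩, ⟨le_rfl, hx1⟩, ⟨le_rfl, hy1⟩, by rw [(x1.g _ _ hq).2]; exact hm⟩⟩
  obtain ⟨⟨p1, p2⟩, ⟨p3, p4⟩, ⟨p5, p6⟩, p7⟩ := (hP p).1 hp
  obtain ⟨x, hx, a1, a2, a3⟩ := near_right X p.1 p4
  obtain ⟨y, hy, b1, b2, b3⟩ := near_right Y p.2 p6
  obtain ⟨R, hR, ho⟩ := i1.inv.cover x y hx hy (by linarith) a2 (by linarith) b2
  have ex : R.x0 = p.1 := by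
    rcases lt_trichotomy R.x0 p.1 with e | e | e
    · exact absurd ⟨e, lt_trans a1 ho.2.1⟩ (uX R hR _ p1)
    · exact e
    · exact absurd (a3 _ (hg R hR).1.1 e) (not_lt.2 ho.1.le)
  have ey : R.y0 = p.2 := by
    rcases lt_trichotomy R.y0 p.2 with e | e | e
    · exact absurd ⟨e, lt_trans b1 ho.2.2.2⟩ (uY R hR _ p2)
    · exact e
    · exact absurd (b3 _ (hg R hR).2.1 e) (not_lt.2 ho.2.2.1.le)
  have bb := i1.inv.box R hR
  have hx0' : 0 < R.x0 := by rw [ex]; linarith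
  have hy0' : 0 < R.y0 := by rw [ey]; linarith
  have mV := i1.inv.minV hR hy0'
  have mH := i1.inv.tr.minV (R := R.tr) hR hx0'
  have rl := (i1.inv.rat _ _ (hG _ p1 _ p2) (by linarith) p4 (by linarith) p6).1
  rw [← ex, ← ey] at rl p7
  have nBR : ¬ Mem i (S1.C R.x1 R.y0).1 := by
    intro hh
    rcases eq_or_lt_of_le bb.1.2.2.2.2 with e | e
    · rw [i1.inv.outt _ _ (by linarith) hy0' (Or.inl e)] at hh
      simp [Mem, top] at hh
    · have := hmax (R.x1, R.y0) ((hP _).2 ⟨⟨(hg R hR).1.2, (hg R hR).2.1⟩, ⟨by dsimp only; linarith [bb.1.2.2.2.1], e⟩, ⟨by dsimp only; linarith, by dsimp only; linarith⟩, hh⟩)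
      dsimp only at this
      linarith [bb.1.2.2.2.1]
  have nTL : ¬ Mem i (S1.C R.x0 R.y1).1 := by
    intro hh
    rcases eq_or_lt_of_le bb.2.2.2.2.2 with e | e
    · rw [i1.inv.outt _ _ hx0' (by linarith) (Or.inr e)] at hh
      simp [Mem, top] at hh
    · have := hmax (R.x0, R.y1) ((hP _).2 ⟨⟨(hg R hR).1.1, (hg R hR).2.2⟩, ⟨by dsimp only; linarith, by dsimp only; linarith⟩, ⟨by dsimp only; linarith [bb.2.2.2.2.1], e⟩, hh⟩)
      dsimp only at this
      linarith [bb.2.2.2.2.1]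
  have hd := hD.demF R.it (i1.inD R hR) _ mV.1 _ mH.1 mV mH rl rl i hi p7 nBR nTL
  obtain ⟨S2, k1, k2, R', k3, k4, k5⟩ := dem_leaf i1 hR hd
  exact ⟨S2, k1, x1.trans k2, R', k3, by linarith [k4.1.1], by linarith [k4.2.1], k5⟩

theorem demP_op {N : ℕ} {D : List Item} (hD : Good N D) {S : St} (h : InvD N D S) {qx qy : ℝ} (hq : S.G qx qy)
    (hx0 : 0 < qx) (hx1 : qx < 1) (hy0 : 0 < qy) (hy1 : qy < 1) {i : ℕ} (hi : i < N + 1)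
    (hm : Mem i (S.C qx qy).2) :
    ∃ S', InvD N D S' ∧ Ext S S' ∧ ∃ R' ∈ S'.L, R'.x1 ≤ qx ∧ R'.y1 ≤ qy ∧ Mem i R'.it.2.2 := by
  classical
  obtain ⟨S1, X, Y, i1, x1, hg, mqx, mqy, hG, uX, uY⟩ := align_all hD h hq
  let P := (X ×ˢ Y).filter (fun p => (p.1 ≤ qx ∧ 0 < p.1) ∧ (p.2 ≤ qy ∧ 0 < p.2) ∧ Mem i (S1.C p.1 p.2).2)
  have hP : ∀ p, p ∈ P ↔ (p.1 ∈ X ∧ p.2 ∈ Y) ∧ (p.1 ≤ qx ∧ 0 < p.1) ∧ (p.2 ≤ qy ∧ 0 < p.2) ∧ Mem i (S1.C p.1 p.2).2 := by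
    intro p; simp [P]
  obtain ⟨p, hp, hmax⟩ := P.exists_min_image (fun p => p.1 + p.2)
    ⟨(qx, qy), (hP _).2 ⟨⟨mqx, mqy⟩, ⟨le_rfl, hx0⟩, ⟨le_rfl, hy0⟩, by rw [(x1.g _ _ hq).2]; exact hm⟩⟩
  obtain ⟨⟨p1, p2⟩, ⟨p3, p4⟩, ⟨p5, p6⟩, p7⟩ := (hP p).1 hp
  obtain ⟨x, hx, a1, a2, a3⟩ := near_left X p.1 p4
  obtain ⟨y, hy, b1, b2, b3⟩ := near_left Y p.2 p6
  obtain ⟨R, hR, ho⟩ := i1.inv.cover x y hx hy a2 (by linarith) b2 (by linarith)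
  have ex : R.x1 = p.1 := by
    rcases lt_trichotomy p.1 R.x1 with e | e | e
    · exact absurd ⟨lt_trans ho.1 a1, e⟩ (uX R hR _ p1)
    · exact e.symm
    · exact absurd (a3 _ (hg R hR).1.2 e) (not_lt.2 ho.2.1.le)
  have ey : R.y1 = p.2 := by
    rcases lt_trichotomy p.2 R.y1 with e | e | e
    · exact absurd ⟨lt_trans ho.2.2.1 b1, e⟩ (uY R hR _ p2)
    · exact e.symm
    · exact absurd (b3 _ (hg R hR).2.2 e) (not_lt.2 ho.2.2.2.le)
  have bb := i1.inv.box R hR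
  have hx1' : R.x1 < 1 := by rw [ex]; linarith
  have hy1' : R.y1 < 1 := by rw [ey]; linarith
  have mV := i1.inv.maxV hR hy1'
  have mH := i1.inv.tr.maxV (R := R.tr) hR hx1'
  have rl := (i1.inv.rat _ _ (hG _ p1 _ p2) p4 (by linarith) p6 (by linarith)).1
  rw [← ex, ← ey] at rl p7
  have nTL : ¬ Mem i (S1.C R.x0 R.y1).2 := by
    intro hh
    rcases eq_or_lt_of_le bb.1.2.2.1 with e | e
    · rw [i1.inv.outb _ _ (Or.inl e.symm)] at hh
      simp [Mem, bot] at hh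
    · have := hmax (R.x0, R.y1) ((hP _).2 ⟨⟨(hg R hR).1.1, (hg R hR).2.2⟩, ⟨by dsimp only; linarith [bb.1.2.2.2.1], e⟩, ⟨by dsimp only; linarith, by dsimp only; linarith⟩, hh⟩)
      dsimp only at this
      linarith [bb.1.2.2.2.1]
  have nBR : ¬ Mem i (S1.C R.x1 R.y0).2 := by
    intro hh
    rcases eq_or_lt_of_le bb.2.2.2.1 with e | e
    · rw [i1.inv.outb _ _ (Or.inr e.symm)] at hh
      simp [Mem, bot] at hh
    · have := hmax (R.x1, R.y0) ((hP _).2 ⟨⟨(hg R hR).1.2, (hg R hR).2.1⟩, ⟨by dsimp only; linarith, by dsimp only; linarith⟩, ⟨by dsimp only; linarith [bb.2.2.2.2.1], e⟩, hh⟩)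
      dsimp only at this
      linarith [bb.2.2.2.2.1]
  have hd := hD.demP R.it (i1.inD R hR) _ mV.1 _ mH.1 mV mH rl rl i hi p7 nTL nBR
  obtain ⟨S2, k1, k2, R', k3, k4, k5⟩ := dem_leaf i1 hR hd
  exact ⟨S2, k1, x1.trans k2, R', k3, by linarith [k4.1.2], by linarith [k4.2.2], k5⟩

end TL

namespace TL

noncomputable def C0 (N : ℕ) (x y : ℝ) : Ltr := by
  classical exact if x = 0 ∨ y = 0 then bot N else top N

noncomputable def S0 (N : ℕ) (j : Item) : St := ⟨{⟨0, 1, 0, 1, j⟩}, C0 N⟩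

theorem C0_symm (N : ℕ) (x y : ℝ) : C0 N x y = C0 N y x := by
  unfold C0; simp only [or_comm]

theorem le_bot_top (N : ℕ) : Le (bot N) (top N) :=
  ⟨fun i h => by simp [Mem, top] at h, fun i h => by simp [Mem, bot] at h⟩

theorem G0 {N : ℕ} {j : Item} {x y : ℝ} (h : (S0 N j).G x y) (h0 : 0 < y) (h1 : y < 1) : x = 0 ∨ x = 1 := by
  obtain ⟨_, _, ⟨a, b⟩, _, hh⟩ := h
  by_contra hc
  rw [not_or] at hc
  exact hh _ rfl ⟨lt_of_le_of_ne a (Ne.symm hc.1), lt_of_le_of_ne b hc.2, h0, h1⟩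

theorem lc0 {N : ℕ} {j : Item} {x y : ℝ} (h : (S0 N j).G x y) (h0 : 0 < y) (h1 : y < 1) : LcV (S0 N j) x y := by
  refine ⟨y, h0, fun y' hy' _ => ?_⟩
  have hy'' : 0 < y' := by have := (abs_lt.1 hy').1; linarith
  show C0 N x y' = C0 N x y
  unfold C0
  simp [h0.ne', hy''.ne']

theorem fit0 {N : ℕ} {j : Item} (p : Ltr2) : p ∈ [(bot N, top N)] ↔
    ∃ y, Rt y ∧ (0:ℝ) < y ∧ y < 1 ∧ p = (C0 N 0 y, C0 N 1 y) := by
  have e : ∀ y : ℝ, 0 < y → (C0 N 0 y, C0 N 1 y) = (bot N, top N) := by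
    intro y hy
    unfold C0
    simp [hy.ne']
  rw [List.mem_singleton]
  constructor
  · rintro rfl
    obtain ⟨y, hy, a, b⟩ := rt_btwn (show (0:ℝ) < 1 from one_pos)
    exact ⟨y, hy, a, b, (e y a).symm⟩
  · rintro ⟨y, _, a, _, rfl⟩
    exact e y a

theorem tr0 (N : ℕ) (j : Item) : (S0 N j).tr = S0 N (sw j) := by
  unfold S0 St.tr
  congr 1
  · ext R
    constructor
    · intro h; exact congrArg Leaf.tr h
    · intro h; exact congrArg Leaf.tr h
  · funext x y; exact C0_symm N y x

theorem inv0 {N : ℕ} {j : Item} (h1 : j.1 = [(bot N, top N)]) (h2 : j.2.1 = [(bot N, top N)]) : Inv N (S0 N j) where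
  fin := Set.finite_singleton _
  box := by
    rintro R rfl
    have r0 : Rt 0 := fun h => h ⟨0, by simp⟩
    have r1 : Rt 1 := fun h => h ⟨1, by simp⟩
    exact ⟨⟨r0, r1, le_rfl, one_pos, le_rfl⟩, r0, r1, le_rfl, one_pos, le_rfl⟩
  disj := by
    rintro R rfl R' rfl x y _ _; rfl
  cover x y _ _ a b c d := ⟨_, rfl, a, b, c, d⟩
  rat x y hg a b c d := absurd ⟨a, b, c, d⟩ (hg.2.2.2.2 _ rfl)
  outb x y h := by show C0 N x y = _; unfold C0; simp [h]
  outt x y a b h := by show C0 N x y = _; unfold C0; simp [a.ne', b.ne']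
  mono x y x' y' hg hg' hx hy := by
    show Le (C0 N x y) (C0 N x' y')
    unfold C0
    by_cases h : x' = 0 ∨ y' = 0
    · have : x = 0 ∨ y = 0 := by
        rcases h with h | h
        · left; linarith [hg.2.2.1.1]
        · right; linarith [hg.2.2.2.1.1]
      simp only [h, this, if_true]
      exact Le.refl _
    · simp only [h, if_false]
      split_ifs
      · exact le_bot_top N
      · exact Le.refl _
  vl x y _ _ a b c d := Or.inl ⟨_, rfl, a, b, c, d⟩
  hl y x _ _ a b c d := Or.inl (by rw [tr0]; exact ⟨_, rfl, a, b, c, d⟩)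
  lcV x y hg a b := lc0 hg a b
  lcH y x := by rw [tr0]; intro hg a b; exact lc0 hg a b
  fitV := by
    rintro R rfl p
    have := fit0 (N := N) (j := j) p
    rw [← h1] at this
    exact this
  fitH := by
    rw [tr0]
    rintro R rfl p
    have := fit0 (N := N) (j := j) p
    rw [← h2] at this
    exact this

theorem ext_between {N : ℕ} {D : List Item} {S Sa S' : St} (h : InvD N D S) (h' : InvD N D S') (x1 : Ext S Sa) (x2 : Ext Sa S')
    {R R' : Leaf} (hR : R ∈ S.L) (hR' : R' ∈ S'.L) (hs : R'.Sub R) : ∃ Ra ∈ Sa.L, R'.Sub Ra ∧ Ra.Sub R := by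
  obtain ⟨Ra, h1, h2⟩ := x2.sub R' hR'
  obtain ⟨R0, h3, h4⟩ := x1.sub Ra h1
  obtain ⟨x, y, ho⟩ := h'.inv.pt hR'
  have := h.inv.disj _ h3 _ hR x y (h4.op (h2.op ho)) (hs.op ho)
  subst this
  exact ⟨Ra, h1, h2, h4⟩

theorem rng_squeeze {N : ℕ} {D : List Item} {S Sa S' : St} (h : InvD N D S) (ha : InvD N D Sa) (h' : InvD N D S') (x1 : Ext S Sa) (x2 : Ext Sa S')
    {R Ra R' : Leaf} (hR : R ∈ S.L) (hRa : Ra ∈ Sa.L) (hR' : R' ∈ S'.L) (s1 : Ra.Sub R) (s2 : R'.Sub Ra)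
    {a b : Ltr} (r : Rng R.it a b) (r' : Rng R'.it a b) : Rng Ra.it a b := by
  obtain ⟨a', b', hr⟩ := ha.inv.rng_ex hRa
  obtain ⟨u1, u2⟩ := rng_mono h.inv ha.inv x1 hR hRa s1 r hr
  obtain ⟨v1, v2⟩ := rng_mono ha.inv h'.inv x2 hRa hR' s2 hr r'
  rw [v1.antisymm u1, u2.antisymm v2] at hr
  exact hr

theorem Leaf.SIn.sub {R R' : Leaf} (h : R'.SIn R) : R'.Sub R := ⟨⟨h.1.1.le, h.1.2.le⟩, h.2.1.le, h.2.2.le⟩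

theorem Leaf.Sub.inr {R R' : Leaf} (h : R'.Sub R) (hi : R.Inr) : R'.Inr :=
  ⟨lt_of_lt_of_le hi.1 h.1.1, lt_of_le_of_lt h.1.2 hi.2.1, lt_of_lt_of_le hi.2.2.1 h.2.1, lt_of_le_of_lt h.2.2 hi.2.2.2⟩

def StepA (N : ℕ) (S S' : St) : Prop :=
  (∀ R ∈ S.L, R.it.2.2 ≠ 0 → ∃ R' ∈ S'.L, R'.SIn R ∧ R'.it.2.2 = R.it.2.2 ∧
      ∀ a b, Rng R.it a b → Rng R'.it a b → B N a b R.it.2.2) ∧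
  (∀ R ∈ S.L, R.Inr → ∀ R' ∈ S'.L, R'.Sub R → ∀ a b, Rng R.it a b → Rng R'.it a b → Adm N a b)

theorem stepA {N : ℕ} {D : List Item} (hD : Good N D) {S : St} (h : InvD N D S) :
    ∃ S', InvD N D S' ∧ Ext S S' ∧ StepA N S S' := by
  obtain ⟨Sa, ha, xa, ta⟩ := taskI_op hD S h
  obtain ⟨Sb, hb, xb, tb⟩ := taskC_op hD Sa ha
  refine ⟨Sb, hb, xa.trans xb, fun R hR hm => ?_, fun R hR hi R' hR' hs a b r r' => ?_⟩
  · obtain ⟨Ra, hRa, sa, ma⟩ := ta R hR hm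
    have bb := h.inv.box R hR
    have hi : Ra.Inr := ⟨by linarith [sa.1.1], by linarith [sa.1.2], by linarith [sa.2.1], by linarith [sa.2.2]⟩
    obtain ⟨a, b, hr⟩ := ha.inv.rng_ex hRa
    obtain ⟨R', hR', s', m', hB⟩ := (tb Ra hRa hi a b hr).2 (by rw [ma]; exact hm)
    refine ⟨R', hR', ?_, m'.trans ma, fun a' b' r r' => ?_⟩
    · exact ⟨⟨lt_of_lt_of_le sa.1.1 s'.1.1, lt_of_le_of_lt s'.1.2 sa.1.2⟩, lt_of_lt_of_le sa.2.1 s'.2.1, lt_of_le_of_lt s'.2.2 sa.2.2⟩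
    · have hr' := rng_squeeze h ha hb xa xb hR hRa hR' sa.sub s' r r'
      obtain ⟨k1, k2⟩ := rng_mono ha.inv ha.inv (Ext.refl Sa) hRa hRa (Leaf.Sub.refl Ra) hr hr'
      obtain ⟨k3, k4⟩ := rng_mono ha.inv ha.inv (Ext.refl Sa) hRa hRa (Leaf.Sub.refl Ra) hr' hr
      have e1 := k1.antisymm k3
      have e2 := k4.antisymm k2
      subst e1 e2
      rw [← ma]
      exact hB r'
  · obtain ⟨Ra, hRa, s2, s1⟩ := ext_between h hb xa xb hR hR' hs
    have hr := rng_squeeze h ha hb xa xb hR hRa hR' s1 s2 r r'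
    exact (((tb Ra hRa (s1.inr hi) a b hr).1 R' hR' (hb.inv.ovl_of_sub hR' s2)).2 a b r').2 rfl rfl

theorem stepA_ext {N : ℕ} {D : List Item} {S S1 S2 : St} (h : InvD N D S) (h1 : InvD N D S1) (h2 : InvD N D S2)
    (x1 : Ext S S1) (x2 : Ext S1 S2) (hs : StepA N S S1) : StepA N S S2 := by
  refine ⟨fun R hR hm => ?_, fun R hR hi R' hR' hss a b r r' => ?_⟩
  · obtain ⟨R', hR', s', m', hB⟩ := hs.1 R hR hm
    obtain ⟨R'', hR'', s'', m''⟩ := x2.mrk R' hR' (by rw [m']; exact hm)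
    refine ⟨R'', hR'', ⟨⟨lt_of_lt_of_le s'.1.1 s''.1.1, lt_of_le_of_lt s''.1.2 s'.1.2⟩, lt_of_lt_of_le s'.2.1 s''.2.1, lt_of_le_of_lt s''.2.2 s'.2.2⟩, m''.trans m', fun a b r r' => ?_⟩
    exact hB a b r (rng_squeeze h h1 h2 x1 x2 hR hR' hR'' s'.sub s'' r r')
  · obtain ⟨Ra, hRa, s2, s1⟩ := ext_between h h2 x1 x2 hR hR' hss
    exact hs.2 R hR hi Ra hRa s1 a b r (rng_squeeze h h1 h2 x1 x2 hR hRa hR' s1 s2 r r')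

def StepF (N : ℕ) (S S' : St) (q : ℝ × ℝ × ℕ) : Prop :=
  S.G q.1 q.2.1 → 0 < q.1 → q.1 < 1 → 0 < q.2.1 → q.2.1 < 1 → q.2.2 < N + 1 → Mem q.2.2 (S.C q.1 q.2.1).1 →
    ∃ R' ∈ S'.L, q.1 ≤ R'.x0 ∧ q.2.1 ≤ R'.y0 ∧ Mem q.2.2 R'.it.2.2
def StepG (N : ℕ) (S S' : St) (q : ℝ × ℝ × ℕ) : Prop :=
  S.G q.1 q.2.1 → 0 < q.1 → q.1 < 1 → 0 < q.2.1 → q.2.1 < 1 → q.2.2 < N + 1 → Mem q.2.2 (S.C q.1 q.2.1).2 →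
    ∃ R' ∈ S'.L, R'.x1 ≤ q.1 ∧ R'.y1 ≤ q.2.1 ∧ Mem q.2.2 R'.it.2.2

theorem mem_ne {i m : ℕ} (h : Mem i m) : m ≠ 0 := by
  rintro rfl; simp [Mem] at h

theorem step {N : ℕ} {D : List Item} (hD : Good N D) {r : ℝ} (hr : Rt r) (q : ℝ × ℝ × ℕ) (S : St) (h : InvD N D S) :
    ∃ S', InvD N D S' ∧ Ext S S' ∧ StepA N S S' ∧ (∀ R ∈ S'.L, ¬ (R.x0 < r ∧ r < R.x1) ∧ ¬ (R.y0 < r ∧ r < R.y1)) ∧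
      StepF N S S' q ∧ StepG N S S' q := by
  obtain ⟨S1, h1, x1, a1⟩ := stepA hD h
  have g : Grid S1 Set.univ Set.univ := fun _ _ => ⟨⟨trivial, trivial⟩, trivial, trivial⟩
  obtain ⟨S2, ⟨h2, g2⟩, x2, l2⟩ := lineX hD hr (Set.mem_univ r) S1 h1 g
  obtain ⟨S3, ⟨h3, g3⟩, x3, l3⟩ := lineY hD hr (Set.mem_univ r) S2 h2 g2
  have x03 := (x1.trans x2).trans x3
  obtain ⟨S4, h4, x4, d4⟩ : ∃ S4, InvD N D S4 ∧ Ext S3 S4 ∧ StepF N S S4 q := by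
    by_cases hc : S.G q.1 q.2.1 ∧ 0 < q.1 ∧ q.1 < 1 ∧ 0 < q.2.1 ∧ q.2.1 < 1 ∧ q.2.2 < N + 1 ∧ Mem q.2.2 (S.C q.1 q.2.1).1
    · obtain ⟨c1, c2, c3, c4, c5, c6, c7⟩ := hc
      obtain ⟨e1, e2⟩ := x03.g _ _ c1
      obtain ⟨S4, k1, k2, k3⟩ := demF_op hD h3 e1 c2 c3 c4 c5 c6 (by rw [e2]; exact c7)
      exact ⟨S4, k1, k2, fun _ _ _ _ _ _ _ => k3⟩
    · exact ⟨S3, h3, Ext.refl S3, fun c1 c2 c3 c4 c5 c6 c7 => absurd ⟨c1, c2, c3, c4, c5, c6, c7⟩ hc⟩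
  have x04 := x03.trans x4
  obtain ⟨S5, h5, x5, d5⟩ : ∃ S5, InvD N D S5 ∧ Ext S4 S5 ∧ StepG N S S5 q := by
    by_cases hc : S.G q.1 q.2.1 ∧ 0 < q.1 ∧ q.1 < 1 ∧ 0 < q.2.1 ∧ q.2.1 < 1 ∧ q.2.2 < N + 1 ∧ Mem q.2.2 (S.C q.1 q.2.1).2
    · obtain ⟨c1, c2, c3, c4, c5, c6, c7⟩ := hc
      obtain ⟨e1, e2⟩ := x04.g _ _ c1
      obtain ⟨S4, k1, k2, k3⟩ := demP_op hD h4 e1 c2 c3 c4 c5 c6 (by rw [e2]; exact c7)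
      exact ⟨S4, k1, k2, fun _ _ _ _ _ _ _ => k3⟩
    · exact ⟨S4, h4, Ext.refl S4, fun c1 c2 c3 c4 c5 c6 c7 => absurd ⟨c1, c2, c3, c4, c5, c6, c7⟩ hc⟩
  have x15 := ((x2.trans x3).trans x4).trans x5
  refine ⟨S5, h5, x04.trans x5, stepA_ext h h1 h5 x1 x15 a1, fun R hR => ⟨?_, ?_⟩, ?_, d5⟩
  · exact ext_uncutX ((x3.trans x4).trans x5) l2 R hR
  · exact ext_uncutY (x4.trans x5) l3 R hR
  · intro c1 c2 c3 c4 c5 c6 c7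
    obtain ⟨R', k1, k2, k3, k4⟩ := d4 c1 c2 c3 c4 c5 c6 c7
    obtain ⟨R'', k5, k6, k7⟩ := x5.mrk R' k1 (mem_ne k4)
    exact ⟨R'', k5, k2.trans k6.1.1, k3.trans k6.2.1, by rw [k7]; exact k4⟩

structure Lim (N c : ℕ) (S : ℕ → St) : Prop where
  inv : ∀ n, Inv N (S n)
  ext : ∀ n m, n ≤ m → Ext (S n) (S m)
  stp : ∀ n, StepA N (S n) (S (n + 1))
  line : ∀ r, Rt r → ∃ n0, ∀ n, n0 ≤ n → ∀ R ∈ (S n).L, ¬ (R.x0 < r ∧ r < R.x1) ∧ ¬ (R.y0 < r ∧ r < R.y1)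
  dF : ∀ n x y i, Rt x → Rt y → ∃ m, n ≤ m ∧ StepF N (S m) (S (m + 1)) (x, y, i)
  dP : ∀ n x y i, Rt x → Rt y → ∃ m, n ≤ m ∧ StepG N (S m) (S (m + 1)) (x, y, i)
  tgt : ∃ R ∈ (S 0).L, Mem c R.it.2.2

theorem rt_rat {x : ℝ} (h : Rt x) : ∃ q : ℚ, (q : ℝ) = x := by
  unfold Rt Irrational at h
  rw [not_not] at h
  exact h

theorem lim_ex {N c : ℕ} (h : Cert N c) : ∃ S, Lim N c S := by
  obtain ⟨D, -, hD, j, hj, j1, j2, hc⟩ := h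
  obtain ⟨e, he⟩ := exists_surjective_nat ℚ
  obtain ⟨f, hf⟩ := exists_surjective_nat (ℚ × ℚ × ℕ)
  have hr : ∀ q : ℚ, Rt (q : ℝ) := fun q h => h ⟨q, rfl⟩
  have st : ∀ (n : ℕ) (S : {S // InvD N D S}), ∃ S' : {S // InvD N D S}, Ext S.1 S'.1 ∧ StepA N S.1 S'.1 ∧
      (∀ R ∈ S'.1.L, ¬ (R.x0 < e n ∧ e n < R.x1) ∧ ¬ (R.y0 < e n ∧ e n < R.y1)) ∧
      StepF N S.1 S'.1 ((f n.unpair.1).1, (f n.unpair.1).2.1, (f n.unpair.1).2.2) ∧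
      StepG N S.1 S'.1 ((f n.unpair.1).1, (f n.unpair.1).2.1, (f n.unpair.1).2.2) := by
    rintro n ⟨S, hS⟩
    obtain ⟨S', h1, h2⟩ := step hD (hr (e n)) ((f n.unpair.1).1, (f n.unpair.1).2.1, (f n.unpair.1).2.2) S hS
    exact ⟨⟨S', h1⟩, h2⟩
  choose nx hnx using st
  have i0 : InvD N D (S0 N j) := ⟨inv0 j1 j2, by rintro R rfl; exact hj⟩
  let T : ℕ → {S // InvD N D S} := fun n => Nat.rec ⟨S0 N j, i0⟩ (fun n S => nx n S) n
  have hT : ∀ n, T (n + 1) = nx n (T n) := fun n => rfl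
  have hext : ∀ n m, n ≤ m → Ext (T n).1 (T m).1 := by
    intro n m hnm
    induction m, hnm using Nat.le_induction with
    | base => exact Ext.refl _
    | succ m _ ih => exact ih.trans (by rw [hT]; exact (hnx m (T m)).1)
  have dem : ∀ n x y i, Rt x → Rt y → ∃ m, n ≤ m ∧ StepF N (T m).1 (T (m + 1)).1 (x, y, i) ∧ StepG N (T m).1 (T (m + 1)).1 (x, y, i) := by
    intro n x y i hx hy
    obtain ⟨q1, rfl⟩ := rt_rat hx
    obtain ⟨q2, rfl⟩ := rt_rat hy
    obtain ⟨k, hk⟩ := hf (q1, q2, i)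
    refine ⟨Nat.pair k n, Nat.right_le_pair _ _, ?_⟩
    have := (hnx (Nat.pair k n) (T (Nat.pair k n))).2.2.2
    rw [Nat.unpair_pair, hk] at this
    rw [hT]
    exact this
  refine ⟨fun n => (T n).1, fun n => (T n).2.inv, hext, fun n => (hnx n (T n)).2.1, ?_, ?_, ?_, ?_⟩
  · intro r hr
    obtain ⟨q, rfl⟩ := rt_rat hr
    obtain ⟨k, rfl⟩ := he q
    refine ⟨k + 1, fun n hn R hR => ?_⟩
    have := (hnx k (T k)).2.2.1
    rw [← hT] at this
    exact ⟨ext_uncutX (hext _ _ hn) (fun R hR => (this R hR).1) R hR, ext_uncutY (hext _ _ hn) (fun R hR => (this R hR).2) R hR⟩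
  · intro n x y i hx hy
    obtain ⟨m, h1, h2, h3⟩ := dem n x y i hx hy
    exact ⟨m, h1, h2⟩
  · intro n x y i hx hy
    obtain ⟨m, h1, h2, h3⟩ := dem n x y i hx hy
    exact ⟨m, h1, h3⟩
  · exact ⟨_, rfl, hc⟩

end TL

namespace TL

theorem int_ev (f : ℕ → ℤ) (M : ℤ) (hm : ∀ n, f n ≤ f (n + 1)) (hb : ∀ n, f n ≤ M) :
    ∃ K, ∀ k, K ≤ k → f k = f K := by
  have hmono : Monotone f := monotone_nat_of_le_succ hm
  obtain ⟨K, -, hK⟩ := (InvImage.wf (fun n => (M - f n).toNat) Nat.lt_wfRel.wf).has_min Set.univ ⟨0, trivial⟩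
  refine ⟨K, fun k hk => ?_⟩
  have h1 := hK k trivial
  have h2 := hmono hk
  have h3 := hb k
  have h4 := hb K
  simp only [InvImage, WellFoundedRelation.rel] at h1
  have h5 : ¬ ((M - f k).toNat < (M - f K).toNat) := h1
  omega

open Classical in
noncomputable def Ci (S : ℕ → St) (x y : ℝ) : Ltr :=
  if h : ∃ n, (S n).G x y then (S h.choose).C x y else (0, 0)

theorem Lim.ci {N c : ℕ} {S : ℕ → St} (h : Lim N c S) {n : ℕ} {x y : ℝ} (hg : (S n).G x y) :
    (S n).C x y = Ci S x y := by
  have he : ∃ n, (S n).G x y := ⟨n, hg⟩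
  unfold Ci
  rw [dif_pos he]
  rcases le_total n he.choose with h1 | h1
  · exact ((h.ext _ _ h1).g _ _ hg).2.symm
  · exact ((h.ext _ _ h1).g _ _ he.choose_spec).2

theorem Lim.evG {N c : ℕ} {S : ℕ → St} (h : Lim N c S) {x y : ℝ} (hx : Rt x) (hy : Rt y) (x0 : 0 < x) (x1 : x < 1)
    (y0 : 0 < y) (y1 : y < 1) : ∃ n0, ∀ n, n0 ≤ n → (S n).G x y := by
  obtain ⟨n0, h0⟩ := h.line x hx
  exact ⟨n0, fun n hn => ⟨hx, hy, ⟨x0.le, x1.le⟩, ⟨y0.le, y1.le⟩, fun R hR ho => (h0 n hn R hR).1 ⟨ho.1, ho.2.1⟩⟩⟩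

theorem Lim.cmono {N c : ℕ} {S : ℕ → St} (h : Lim N c S) {x y x' y' : ℝ} (hx : Rt x) (hy : Rt y) (x0 : 0 < x) (x1 : x < 1)
    (y0 : 0 < y) (y1 : y < 1) (hx' : Rt x') (hy' : Rt y') (x0' : 0 < x') (x1' : x' < 1)
    (y0' : 0 < y') (y1' : y' < 1) (l1 : x ≤ x') (l2 : y ≤ y') : Le (Ci S x y) (Ci S x' y') := by
  obtain ⟨n, hn⟩ := h.evG hx hy x0 x1 y0 y1
  obtain ⟨n', hn'⟩ := h.evG hx' hy' x0' x1' y0' y1'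
  have g := hn _ (le_max_left n n')
  have g' := hn' _ (le_max_right n n')
  rw [← h.ci g, ← h.ci g']
  exact (h.inv _).mono _ _ _ _ g g' l1 l2

def Up (S : ℕ → St) (x y : ℝ) (b : Ltr) : Prop := ∀ ε > 0, ∃ u v, (Rt u ∧ Rt v) ∧ (0 < u ∧ u < 1 ∧ 0 < v ∧ v < 1) ∧
  (x ≤ u ∧ u < x + ε) ∧ (y ≤ v ∧ v < y + ε) ∧ Ci S u v = b
def Dn (S : ℕ → St) (x y : ℝ) (b : Ltr) : Prop := ∀ ε > 0, ∃ u v, (Rt u ∧ Rt v) ∧ (0 < u ∧ u < 1 ∧ 0 < v ∧ v < 1) ∧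
  (x - ε < u ∧ u ≤ x) ∧ (y - ε < v ∧ v ≤ y) ∧ Ci S u v = b
def Cand (N : ℕ) (S : ℕ → St) (x y : ℝ) (o : ℕ) : Prop := ∃ a b, Dn S x y a ∧ Up S x y b ∧ B N a b o

theorem Lim.sub {N c : ℕ} {S : ℕ → St} (h : Lim N c S) {n m : ℕ} (hnm : n ≤ m) {R R' : Leaf} (hR : R ∈ (S n).L) (hR' : R' ∈ (S m).L)
    {x y : ℝ} (ho : R.Op x y) (ho' : R'.Op x y) : R'.Sub R := by
  obtain ⟨R0, h1, h2⟩ := (h.ext _ _ hnm).sub R' hR'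
  have := (h.inv n).disj _ h1 _ hR x y (h2.op ho') ho
  rw [← this]; exact h2

theorem Inv.rng_le {N : ℕ} {S : St} (h : Inv N S) {R : Leaf} (hR : R ∈ S.L) {a b : Ltr} (hr : Rng R.it a b) : Le a b := by
  obtain ⟨⟨p, hp, hmin, rfl⟩, q, hq, hmax, rfl⟩ := hr
  have bb := h.box R hR
  refine (hmin.2 q hq).1.trans ?_
  obtain ⟨y, hy, e1, e2, rfl⟩ := (h.fitV R hR _).1 hq
  exact h.mono _ _ _ _ (h.leftG hR hy e1.le e2.le) (h.rightG hR hy e1.le e2.le) bb.1.2.2.2.1.le le_rfl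

/-- irrational points: nested leaf sequence. -/
theorem Lim.nest {N c : ℕ} {S : ℕ → St} (h : Lim N c S) {x y : ℝ} (n0 : ℕ) (Q : ℕ → Leaf) (hQ : ∀ k, Q k ∈ (S (n0 + k)).L)
    (ho : ∀ k, (Q k).Op x y) : ∃ K a b, (∀ k, K ≤ k → Rng (Q k).it a b ∧ (Q k).Inr) ∧ Dn S x y a ∧ Up S x y b := by
  have hs : ∀ j k, j ≤ k → (Q k).Sub (Q j) := fun j k hjk => h.sub (Nat.add_le_add_left hjk n0) (hQ j) (hQ k) (ho j) (ho k)
  have hrx : ∀ k, ∃ ab : Ltr × Ltr, Rng (Q k).it ab.1 ab.2 := fun k => by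
    obtain ⟨a, b, hr⟩ := (h.inv _).rng_ex (hQ k)
    exact ⟨(a, b), hr⟩
  choose f hf using hrx
  have hmon : ∀ j k, j ≤ k → Le (f j).1 (f k).1 ∧ Le (f k).2 (f j).2 := fun j k hjk =>
    rng_mono (h.inv _) (h.inv _) (h.ext _ _ (Nat.add_le_add_left hjk n0)) (hQ j) (hQ k) (hs j k hjk) (hf j) (hf k)
  have hle : ∀ k, Le (f k).1 (f k).2 := fun k => (h.inv _).rng_le (hQ k) (hf k)
  obtain ⟨K1, hK1⟩ := int_ev (fun k => rk (f k).1) (rk (f 0).2) (fun k => (hmon k (k+1) (by omega)).1.rk_le)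
    (fun k => ((hle k).trans (hmon 0 k (by omega)).2).rk_le)
  obtain ⟨K2, hK2⟩ := int_ev (fun k => - rk (f k).2) (- rk (f 0).1) (fun k => by have := (hmon k (k+1) (by omega)).2.rk_le; omega)
    (fun k => by have := ((hmon 0 k (by omega)).1.trans (hle k)).rk_le; omega)
  have c1 : ∀ k, K1 ≤ k → (f k).1 = (f K1).1 := fun k hk =>
    ((hmon K1 k hk).1.eq_of_rk (by have := hK1 k hk; omega)).symm
  have c2 : ∀ k, K2 ≤ k → (f k).2 = (f K2).2 := fun k hk =>
    ((hmon K2 k hk).2.eq_of_rk (by have := hK2 k hk; omega))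
  have sm : ∀ ε > 0, ∃ K, ∀ k, K ≤ k → (x - ε < (Q k).x0 ∧ (Q k).x1 < x + ε) ∧ (y - ε < (Q k).y0 ∧ (Q k).y1 < y + ε) := by
    intro ε hε
    obtain ⟨r1, t1, u1, v1⟩ := rt_btwn (show x - ε < x by linarith)
    obtain ⟨r2, t2, u2, v2⟩ := rt_btwn (show x < x + ε by linarith)
    obtain ⟨r3, t3, u3, v3⟩ := rt_btwn (show y - ε < y by linarith)
    obtain ⟨r4, t4, u4, v4⟩ := rt_btwn (show y < y + ε by linarith)
    obtain ⟨n1, h1⟩ := h.line r1 t1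
    obtain ⟨n2, h2⟩ := h.line r2 t2
    obtain ⟨n3, h3⟩ := h.line r3 t3
    obtain ⟨n4, h4⟩ := h.line r4 t4
    refine ⟨n1 + n2 + n3 + n4, fun k hk => ?_⟩
    have g1 := (h1 _ (by omega) _ (hQ k)).1
    have g2 := (h2 _ (by omega) _ (hQ k)).1
    have g3 := (h3 _ (by omega) _ (hQ k)).2
    have g4 := (h4 _ (by omega) _ (hQ k)).2
    obtain ⟨o1, o2, o3, o4⟩ := ho k
    refine ⟨⟨?_, ?_⟩, ?_, ?_⟩
    · by_contra hh; exact g1 ⟨by linarith, by linarith⟩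
    · by_contra hh; exact g2 ⟨by linarith, by linarith⟩
    · by_contra hh; exact g3 ⟨by linarith, by linarith⟩
    · by_contra hh; exact g4 ⟨by linarith, by linarith⟩
  have b0 := (h.inv _).box _ (hQ 0)
  obtain ⟨o1, o2, o3, o4⟩ := ho 0
  obtain ⟨⟨-, -, b1, b2, b3⟩, -, -, b4, b5, b6⟩ := b0
  have hp : 0 < min (min x (1 - x)) (min y (1 - y)) := by
    refine lt_min (lt_min ?_ ?_) (lt_min ?_ ?_) <;> linarith
  obtain ⟨K3, hK3⟩ := sm _ hp
  have hinr : ∀ k, K3 ≤ k → (Q k).Inr := by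
    intro k hk
    obtain ⟨⟨s1, s2⟩, s3, s4⟩ := hK3 k hk
    have e1 := (min_le_left (min x (1 - x)) (min y (1 - y))).trans (min_le_left _ _)
    have e2 := (min_le_left (min x (1 - x)) (min y (1 - y))).trans (min_le_right _ _)
    have e3 := (min_le_right (min x (1 - x)) (min y (1 - y))).trans (min_le_left _ _)
    have e4 := (min_le_right (min x (1 - x)) (min y (1 - y))).trans (min_le_right _ _)
    exact ⟨by linarith, by linarith, by linarith, by linarith⟩
  have hrng : ∀ k, K1 + K2 ≤ k → Rng (Q k).it (f K1).1 (f K2).2 := by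
    intro k hk
    have := hf k
    rwa [c1 k (by omega), c2 k (by omega)] at this
  refine ⟨K1 + K2 + K3, (f K1).1, (f K2).2, fun k hk => ⟨hrng k (by omega), hinr k (by omega)⟩, ?_, ?_⟩
  · intro ε hε
    obtain ⟨K4, hK4⟩ := sm ε hε
    let k := K1 + K2 + K3 + K4
    obtain ⟨⟨s1, s2⟩, s3, s4⟩ := hK4 k (by omega)
    obtain ⟨i1, i2, i3, i4⟩ := hinr k (by omega)
    have bb := (h.inv _).box _ (hQ k)
    obtain ⟨p1, p2, p3, p4⟩ := ho k
    have hmin := (h.inv _).minV (hQ k) i3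
    obtain ⟨⟨p, hp, hpm, e⟩, -⟩ := hrng k (by omega)
    refine ⟨(Q k).x0, (Q k).y0, ⟨bb.1.1, bb.2.1⟩, ⟨i1, by linarith, i3, by linarith⟩, ⟨s1, p1.le⟩, ⟨s3, p3.le⟩, ?_⟩
    rw [← h.ci ((h.inv _).leftG (hQ k) bb.2.1 le_rfl bb.2.2.2.2.1.le), ← e]
    exact (hmin.2 p hp).1.antisymm (hpm.2 _ hmin.1).1
  · intro ε hε
    obtain ⟨K4, hK4⟩ := sm ε hε
    let k := K1 + K2 + K3 + K4
    obtain ⟨⟨s1, s2⟩, s3, s4⟩ := hK4 k (by omega)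
    obtain ⟨i1, i2, i3, i4⟩ := hinr k (by omega)
    have bb := (h.inv _).box _ (hQ k)
    obtain ⟨p1, p2, p3, p4⟩ := ho k
    have hmin := (h.inv _).maxV (hQ k) i4
    obtain ⟨-, ⟨p, hp, hpm, e⟩⟩ := hrng k (by omega)
    refine ⟨(Q k).x1, (Q k).y1, ⟨bb.1.2.1, bb.2.2.1⟩, ⟨by linarith, i2, by linarith, i4⟩, ⟨p2.le, s2⟩, ⟨p4.le, s4⟩, ?_⟩
    rw [← h.ci ((h.inv _).rightG (hQ k) bb.2.2.1 bb.2.2.2.2.1.le le_rfl), ← e]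
    exact (hpm.2 _ hmin.1).2.antisymm (hmin.2 p hp).2

def MarkAt (S : ℕ → St) (x y : ℝ) (m : ℕ) : Prop := ∃ n0, ∀ n, n0 ≤ n → ∃ R ∈ (S n).L, R.Op x y ∧ R.it.2.2 = m

theorem Lim.mark_uniq {N c : ℕ} {S : ℕ → St} (h : Lim N c S) {x y : ℝ} {m m' : ℕ} (hm : MarkAt S x y m) (hm' : MarkAt S x y m') : m = m' := by
  obtain ⟨n, hn⟩ := hm
  obtain ⟨n', hn'⟩ := hm'
  obtain ⟨R, h1, h2, h3⟩ := hn _ (le_max_left n n')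
  obtain ⟨R', h1', h2', h3'⟩ := hn' _ (le_max_right n n')
  rw [← h3, ← h3', (h.inv _).disj _ h1 _ h1' _ _ h2 h2']

theorem Lim.mark {N c : ℕ} {S : ℕ → St} (h : Lim N c S) {n : ℕ} {R : Leaf} (hR : R ∈ (S n).L) (hm : R.it.2.2 ≠ 0) :
    ∃ x y, R.Op x y ∧ MarkAt S x y R.it.2.2 ∧ Cand N S x y R.it.2.2 := by
  have stp : ∀ (k : ℕ) (Q : {Q : Leaf // Q ∈ (S (n + k)).L ∧ Q.it.2.2 = R.it.2.2}),
      ∃ Q' : {Q : Leaf // Q ∈ (S (n + (k + 1))).L ∧ Q.it.2.2 = R.it.2.2}, Q'.1.SIn Q.1 ∧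
        ∀ a b, Rng Q.1.it a b → Rng Q'.1.it a b → B N a b R.it.2.2 := by
    rintro k ⟨Q, h1, h2⟩
    obtain ⟨Q', h3, h4, h5, h6⟩ := (h.stp (n + k)).1 Q h1 (by rw [h2]; exact hm)
    exact ⟨⟨Q', h3, h5.trans h2⟩, h4, fun a b r r' => by rw [← h2]; exact h6 a b r r'⟩
  choose nx hnx using stp
  let Q : (k : ℕ) → {Q : Leaf // Q ∈ (S (n + k)).L ∧ Q.it.2.2 = R.it.2.2} :=
    fun k => Nat.rec ⟨R, hR, rfl⟩ (fun k Q => nx k Q) k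
  have hQ : ∀ k, Q (k + 1) = nx k (Q k) := fun k => rfl
  have hsin : ∀ k, (Q (k + 1)).1.SIn (Q k).1 := fun k => by rw [hQ]; exact (hnx k (Q k)).1
  have hB : ∀ k a b, Rng (Q k).1.it a b → Rng (Q (k+1)).1.it a b → B N a b R.it.2.2 := fun k => by rw [hQ]; exact (hnx k (Q k)).2
  have bx := fun k => (h.inv _).box _ (Q k).2.1
  have key : ∀ (l r : ℕ → ℝ), (∀ k, l k < l (k+1)) → (∀ k, r (k+1) < r k) → (∀ k, l k < r k) → ∃ x, ∀ k, l k < x ∧ x < r k := by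
    intro l r hl hr hlr
    have ml : Monotone l := monotone_nat_of_le_succ fun k => (hl k).le
    have mr : Antitone r := antitone_nat_of_succ_le fun k => (hr k).le
    have hx := ml.ciSup_mem_iInter_Icc_of_antitone mr (fun k => (hlr k).le)
    rw [Set.mem_iInter] at hx
    exact ⟨_, fun k => ⟨lt_of_lt_of_le (hl k) (hx (k+1)).1, lt_of_le_of_lt (hx (k+1)).2 (hr k)⟩⟩
  obtain ⟨x, hx⟩ := key (fun k => (Q k).1.x0) (fun k => (Q k).1.x1) (fun k => (hsin k).1.1) (fun k => (hsin k).1.2) (fun k => (bx k).1.2.2.2.1)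
  obtain ⟨y, hy⟩ := key (fun k => (Q k).1.y0) (fun k => (Q k).1.y1) (fun k => (hsin k).2.1) (fun k => (hsin k).2.2) (fun k => (bx k).2.2.2.2.1)
  have ho : ∀ k, (Q k).1.Op x y := fun k => ⟨(hx k).1, (hx k).2, (hy k).1, (hy k).2⟩
  refine ⟨x, y, ho 0, ⟨n, fun m hm => ?_⟩, ?_⟩
  · obtain ⟨k, rfl⟩ := Nat.exists_eq_add_of_le hm
    exact ⟨(Q k).1, (Q k).2.1, ho k, (Q k).2.2⟩
  · obtain ⟨K, a, b, h1, h2, h3⟩ := h.nest n (fun k => (Q k).1) (fun k => (Q k).2.1) ho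
    exact ⟨a, b, h2, h3, hB K a b (h1 K le_rfl).1 (h1 (K+1) (by omega)).1⟩

theorem Lim.cand {N c : ℕ} {S : ℕ → St} (h : Lim N c S) {x y : ℝ} (x0 : 0 < x) (x1 : x < 1) (y0 : 0 < y) (y1 : y < 1) :
    ∃ o, Cand N S x y o := by
  by_cases hx : Rt x <;> by_cases hy : Rt y
  · obtain ⟨n, hn⟩ := h.evG hx hy x0 x1 y0 y1
    have g := hn n le_rfl
    obtain ⟨-, o, -, hB⟩ := (h.inv n).rat x y g x0 x1 y0 y1
    rw [h.ci g] at hB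
    exact ⟨o, _, _, fun ε hε => ⟨x, y, ⟨hx, hy⟩, ⟨x0, x1, y0, y1⟩, ⟨by linarith, le_rfl⟩, ⟨by linarith, le_rfl⟩, rfl⟩,
      fun ε hε => ⟨x, y, ⟨hx, hy⟩, ⟨x0, x1, y0, y1⟩, ⟨le_rfl, by linarith⟩, ⟨le_rfl, by linarith⟩, rfl⟩, hB⟩
  · obtain ⟨n, hn⟩ := h.line x hx
    rcases (h.inv n).vl x y hx (irr_of_not_rt hy) x0 x1 y0 y1 with ⟨R, hR, ho⟩ | ⟨v1, v2, w, w', l1, l2, ⟨o, -, hB⟩, q1, q2⟩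
    · exact absurd ⟨ho.1, ho.2.1⟩ (hn n le_rfl R hR).1
    · refine ⟨o, w, w', fun ε hε => ?_, fun ε hε => ?_, hB⟩
      · obtain ⟨v, hv, k1, k2⟩ := rt_btwn (show max (max v1 0) (y - ε) < y from max_lt (max_lt l1 y0) (by linarith))
        obtain ⟨k3, k4⟩ := max_lt_iff.1 k1
        obtain ⟨k5, k6⟩ := max_lt_iff.1 k3
        obtain ⟨g, e⟩ := q1 v hv k5 k2
        exact ⟨x, v, ⟨hx, hv⟩, ⟨x0, x1, k6, by linarith⟩, ⟨by linarith, le_rfl⟩, ⟨k4, k2.le⟩, by rw [← h.ci g, e]⟩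
      · obtain ⟨v, hv, k1, k2⟩ := rt_btwn (show y < min (min v2 1) (y + ε) from lt_min (lt_min l2 y1) (by linarith))
        obtain ⟨k3, k4⟩ := lt_min_iff.1 k2
        obtain ⟨k5, k6⟩ := lt_min_iff.1 k3
        obtain ⟨g, e⟩ := q2 v hv k1 k5
        exact ⟨x, v, ⟨hx, hv⟩, ⟨x0, x1, by linarith, k6⟩, ⟨le_rfl, by linarith⟩, ⟨k1.le, k4⟩, by rw [← h.ci g, e]⟩
  · obtain ⟨n, hn⟩ := h.line y hy
    rcases (h.inv n).hl y x hy (irr_of_not_rt hx) y0 y1 x0 x1 with ⟨R, hR, ho⟩ | ⟨v1, v2, w, w', l1, l2, ⟨o, -, hB⟩, q1, q2⟩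
    · exact absurd ⟨ho.1, ho.2.1⟩ (hn n le_rfl R.tr hR).2
    · refine ⟨o, w, w', fun ε hε => ?_, fun ε hε => ?_, hB⟩
      · obtain ⟨v, hv, k1, k2⟩ := rt_btwn (show max (max v1 0) (x - ε) < x from max_lt (max_lt l1 x0) (by linarith))
        obtain ⟨k3, k4⟩ := max_lt_iff.1 k1
        obtain ⟨k5, k6⟩ := max_lt_iff.1 k3
        obtain ⟨g, e⟩ := q1 v hv k5 k2
        exact ⟨v, y, ⟨hv, hy⟩, ⟨k6, by linarith, y0, y1⟩, ⟨k4, k2.le⟩, ⟨by linarith, le_rfl⟩, by rw [← h.ci ((tr_G _ _ _).1 g)]; exact e⟩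
      · obtain ⟨v, hv, k1, k2⟩ := rt_btwn (show x < min (min v2 1) (x + ε) from lt_min (lt_min l2 x1) (by linarith))
        obtain ⟨k3, k4⟩ := lt_min_iff.1 k2
        obtain ⟨k5, k6⟩ := lt_min_iff.1 k3
        obtain ⟨g, e⟩ := q2 v hv k1 k5
        exact ⟨v, y, ⟨hv, hy⟩, ⟨by linarith, k6, y0, y1⟩, ⟨k1.le, k4⟩, ⟨le_rfl, by linarith⟩, by rw [← h.ci ((tr_G _ _ _).1 g)]; exact e⟩
  · have := fun k => (h.inv (0 + k)).cover x y (irr_of_not_rt hx) (irr_of_not_rt hy) x0 x1 y0 y1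
    choose Q hQ ho using this
    obtain ⟨K, a, b, h1, h2, h3⟩ := h.nest 0 Q hQ ho
    obtain ⟨o, -, hB⟩ := (h.stp (0 + K)).2 (Q K) (hQ K) (h1 K le_rfl).2 (Q (K+1)) (hQ (K+1))
      (h.sub (by omega) (hQ K) (hQ (K+1)) (ho K) (ho (K+1))) a b (h1 K le_rfl).1 (h1 (K+1) (by omega)).1
    exact ⟨o, a, b, h2, h3, hB⟩

theorem lab_of_lim {N c : ℕ} {S : ℕ → St} (h : Lim N c S) : ∃ o, Lab N c o := by
  classical
  have ex : ∀ x y, ∃ o, (0 < x → x < 1 → 0 < y → y < 1 → Cand N S x y o) ∧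
      ∀ m, MarkAt S x y m → Cand N S x y m → o = m := by
    intro x y
    by_cases hm : ∃ m, MarkAt S x y m ∧ Cand N S x y m
    · obtain ⟨m, h1, h2⟩ := hm
      exact ⟨m, fun _ _ _ _ => h2, fun m' h3 _ => h.mark_uniq h1 h3⟩
    · push Not at hm
      by_cases hh : 0 < x ∧ x < 1 ∧ 0 < y ∧ y < 1
      · obtain ⟨o, ho⟩ := h.cand hh.1 hh.2.1 hh.2.2.1 hh.2.2.2
        exact ⟨o, fun _ _ _ _ => ho, fun m h1 h2 => absurd h2 (hm m h1)⟩
      · exact ⟨0, fun a b c d => absurd ⟨a, b, c, d⟩ hh, fun m h1 h2 => absurd h2 (hm m h1)⟩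
  choose o ho hmk using ex
  have up : ∀ x y u v, (0 < u ∧ u < 1) → (0 < v ∧ v < 1) → 0 < x → 0 < y → x < u → y < v → ∀ k, ∀ b, Up S x y b → Mem k (o u v) → Mem k b.1 := by
    intro x y u v hu hv hx hy hxu hyv k b hb hk
    obtain ⟨a', b', d, -, hB⟩ := ho u v hu.1 hu.2 hv.1 hv.2
    obtain ⟨p, q, ⟨r1, r2⟩, ⟨i1, i2, i3, i4⟩, ⟨s1, s2⟩, ⟨s3, s4⟩, e⟩ := hb (min (u - x) (v - y)) (lt_min (by linarith) (by linarith))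
    have m1 := min_le_left (u - x) (v - y)
    have m2 := min_le_right (u - x) (v - y)
    obtain ⟨p', q', ⟨r1', r2'⟩, ⟨i1', i2', i3', i4'⟩, ⟨s1', s2'⟩, ⟨s3', s4'⟩, e'⟩ := d (min (u - p) (v - q)) (lt_min (by linarith) (by linarith))
    have m1' := min_le_left (u - p) (v - q)
    have m2' := min_le_right (u - p) (v - q)
    have := h.cmono r1 r2 i1 i2 i3 i4 r1' r2' i1' i2' i3' i4' (by linarith) (by linarith)
    rw [e, e'] at this
    exact this.1 k (hB.2.2.1 k hk).1
  have dn : ∀ x y u v, (0 < u ∧ u < 1) → (0 < v ∧ v < 1) → x < 1 → y < 1 → u < x → v < y → ∀ k, ∀ b, Dn S x y b → Mem k (o u v) → Mem k b.2 := by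
    intro x y u v hu hv hx hy hxu hyv k b hb hk
    obtain ⟨a', b', -, d, hB⟩ := ho u v hu.1 hu.2 hv.1 hv.2
    obtain ⟨p, q, ⟨r1, r2⟩, ⟨i1, i2, i3, i4⟩, ⟨s1, s2⟩, ⟨s3, s4⟩, e⟩ := hb (min (x - u) (y - v)) (lt_min (by linarith) (by linarith))
    have m1 := min_le_left (x - u) (y - v)
    have m2 := min_le_right (x - u) (y - v)
    obtain ⟨p', q', ⟨r1', r2'⟩, ⟨i1', i2', i3', i4'⟩, ⟨s1', s2'⟩, ⟨s3', s4'⟩, e'⟩ := d (min (p - u) (q - v)) (lt_min (by linarith) (by linarith))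
    have m1' := min_le_left (p - u) (q - v)
    have m2' := min_le_right (p - u) (q - v)
    have := h.cmono r1' r2' i1' i2' i3' i4' r1 r2 i1 i2 i3 i4 (by linarith) (by linarith)
    rw [e, e'] at this
    exact this.2 k (hB.2.2.1 k hk).2
  have upc : ∀ x y, ∀ k, k < N + 1 → ∀ b, Up S x y b → Mem k b.1 → ∃ u v, x < u ∧ u < 1 ∧ y < v ∧ v < 1 ∧ Mem k (o u v) := by
    intro x y k hk b hb hkb
    obtain ⟨p, q, ⟨r1, r2⟩, ⟨i1, i2, i3, i4⟩, ⟨s1, s2⟩, ⟨s3, s4⟩, e⟩ := hb 1 one_pos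
    obtain ⟨n, hn⟩ := h.evG r1 r2 i1 i2 i3 i4
    obtain ⟨m, hnm, hm⟩ := h.dF n p q k r1 r2
    have g := hn m hnm
    obtain ⟨R, hR, e1, e2, e3⟩ := hm g i1 i2 i3 i4 hk (by simp only; rw [h.ci g, e]; exact hkb)
    obtain ⟨u, v, ⟨t1, t2, t3, t4⟩, ma, mc⟩ := h.mark hR (mem_ne e3)
    have bb := (h.inv _).box R hR
    simp only at e1 e2 e3
    refine ⟨u, v, by linarith, by linarith [bb.1.2.2.2.2], by linarith, by linarith [bb.2.2.2.2.2], ?_⟩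
    rw [hmk u v _ ma mc]; exact e3
  have dnc : ∀ x y, ∀ k, k < N + 1 → ∀ b, Dn S x y b → Mem k b.2 → ∃ u v, 0 < u ∧ u < x ∧ 0 < v ∧ v < y ∧ Mem k (o u v) := by
    intro x y k hk b hb hkb
    obtain ⟨p, q, ⟨r1, r2⟩, ⟨i1, i2, i3, i4⟩, ⟨s1, s2⟩, ⟨s3, s4⟩, e⟩ := hb 1 one_pos
    obtain ⟨n, hn⟩ := h.evG r1 r2 i1 i2 i3 i4
    obtain ⟨m, hnm, hm⟩ := h.dP n p q k r1 r2
    have g := hn m hnm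
    obtain ⟨R, hR, e1, e2, e3⟩ := hm g i1 i2 i3 i4 hk (by simp only; rw [h.ci g, e]; exact hkb)
    obtain ⟨u, v, ⟨t1, t2, t3, t4⟩, ma, mc⟩ := h.mark hR (mem_ne e3)
    have bb := (h.inv _).box R hR
    simp only at e1 e2 e3
    refine ⟨u, v, by linarith [bb.1.2.2.1], by linarith, by linarith [bb.2.2.2.1], by linarith, ?_⟩
    rw [hmk u v _ ma mc]; exact e3
  refine ⟨o, ?_, ?_, ?_, ?_⟩
  · intro x y x0 x1 y0 y1
    obtain ⟨a, b, -, -, hB⟩ := ho x y x0 x1 y0 y1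
    exact hB.1
  · intro x y x0 x1 y0 y1
    obtain ⟨a, b, -, -, hB⟩ := ho x y x0 x1 y0 y1
    exact hB.2.1
  · intro x y x0 x1 y0 y1 i hi
    obtain ⟨a, b, hd, hu, hB⟩ := ho x y x0 x1 y0 y1
    obtain ⟨c1, c2, c3, c4⟩ := hB.2.2.2 i hi
    have hk : i.unpair.2 < N + 1 := by have := Nat.unpair_right_le i; omega
    refine ⟨c1, c2, fun e => (c3 e).trans ?_, fun e => (c4 e).trans ?_⟩
    · constructor
      · rintro (hh | hh)
        · exact Or.inr (upc x y _ hk b hu hh)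
        · exact Or.inl hh
      · rintro (hh | ⟨u, v, h1, h2, h3, h4, h5⟩)
        · exact Or.inr hh
        · exact Or.inl (up x y u v ⟨by linarith, h2⟩ ⟨by linarith, h4⟩ x0 y0 h1 h3 _ b hu h5)
    · constructor
      · rintro (hh | hh)
        · exact Or.inr (dnc x y _ hk a hd hh)
        · exact Or.inl hh
      · rintro (hh | ⟨u, v, h1, h2, h3, h4, h5⟩)
        · exact Or.inr hh
        · exact Or.inl (dn x y u v ⟨h1, by linarith⟩ ⟨h3, by linarith⟩ x1 y1 h2 h4 _ a hd h5)
  · obtain ⟨R, hR, hc⟩ := h.tgt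
    obtain ⟨u, v, ⟨t1, t2, t3, t4⟩, ma, mc⟩ := h.mark hR (mem_ne hc)
    have bb := (h.inv _).box R hR
    refine ⟨u, v, by linarith [bb.1.2.2.1], by linarith [bb.1.2.2.2.2], by linarith [bb.2.2.2.1], by linarith [bb.2.2.2.2.2], ?_⟩
    rw [hmk u v _ ma mc]; exact hc

theorem lab_of_cert {N c : ℕ} (h : Cert N c) : ∃ o, Lab N c o := by
  obtain ⟨S, hS⟩ := lim_ex h
  exact lab_of_lim hS

end TL

namespace TL

/-! ### Completeness: from a labelling to a certificate -/

open Classical in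
noncomputable def msk (N : ℕ) (P : ℕ → Prop) : ℕ := Nat.ofBits (fun i : Fin (N + 1) => decide (P i))

theorem msk_lt (N : ℕ) (P : ℕ → Prop) : msk N P < 2 ^ (N + 1) := Nat.ofBits_lt_two_pow _

theorem mem_msk {N : ℕ} {P : ℕ → Prop} {i : ℕ} : Mem i (msk N P) ↔ i < N + 1 ∧ P i := by
  unfold Mem msk
  by_cases h : i < N + 1
  · rw [Nat.testBit_ofBits_lt _ _ h]; simp [h]
  · rw [Nat.testBit_ofBits_ge _ _ (by omega)]; simp [h]

theorem mem_lt {N i m : ℕ} (hm : m < 2 ^ (N + 1)) (h : Mem i m) : i < N + 1 := by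
  by_contra hh
  have := Nat.ge_two_pow_of_testBit h
  have h2 : 2 ^ (N + 1) ≤ 2 ^ i := Nat.pow_le_pow_right (by norm_num) (by omega)
  omega

structure Lb (N : ℕ) (o : ℝ → ℝ → ℕ) : Prop where
  lt : ∀ x y, 0 < x → x < 1 → 0 < y → y < 1 → o x y < 2 ^ (N + 1)
  mem : ∀ x y, 0 < x → x < 1 → 0 < y → y < 1 → Mem N (o x y)
  cons : ∀ x y, 0 < x → x < 1 → 0 < y → y < 1 → ∀ i, i < N → ConsI i (o x y)
    (fun k => Mem k (o x y) ∨ ∃ u v, x < u ∧ u < 1 ∧ y < v ∧ v < 1 ∧ Mem k (o u v))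
    (fun k => Mem k (o x y) ∨ ∃ u v, 0 < u ∧ u < x ∧ 0 < v ∧ v < y ∧ Mem k (o u v))

theorem Lab.lb {N c : ℕ} {o : ℝ → ℝ → ℕ} (h : Lab N c o) : Lb N o := ⟨h.lt, h.mem, h.cons⟩

def tro (o : ℝ → ℝ → ℕ) : ℝ → ℝ → ℕ := fun x y => o y x

theorem Lb.tr {N : ℕ} {o : ℝ → ℝ → ℕ} (h : Lb N o) : Lb N (tro o) where
  lt x y a b c d := h.lt y x c d a b
  mem x y a b c d := h.mem y x c d a b
  cons x y a b c d i hi := by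
    obtain ⟨c1, c2, c3, c4⟩ := h.cons y x c d a b i hi
    refine ⟨c1, c2, fun e => (c3 e).trans ?_, fun e => (c4 e).trans ?_⟩
    · refine or_congr Iff.rfl ⟨?_, ?_⟩
      · rintro ⟨u, v, h1, h2, h3, h4, h5⟩; exact ⟨v, u, h3, h4, h1, h2, h5⟩
      · rintro ⟨u, v, h1, h2, h3, h4, h5⟩; exact ⟨v, u, h3, h4, h1, h2, h5⟩
    · refine or_congr Iff.rfl ⟨?_, ?_⟩
      · rintro ⟨u, v, h1, h2, h3, h4, h5⟩; exact ⟨v, u, h3, h4, h1, h2, h5⟩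
      · rintro ⟨u, v, h1, h2, h3, h4, h5⟩; exact ⟨v, u, h3, h4, h1, h2, h5⟩

def Abv (o : ℝ → ℝ → ℕ) (x y : ℝ) (i : ℕ) : Prop := ∃ u v, (0 < u ∧ u < 1) ∧ (0 < v ∧ v < 1) ∧ x < u ∧ y < v ∧ Mem i (o u v)
def Blw (o : ℝ → ℝ → ℕ) (x y : ℝ) (i : ℕ) : Prop := ∃ u v, (0 < u ∧ u < 1) ∧ (0 < v ∧ v < 1) ∧ u < x ∧ v < y ∧ Mem i (o u v)

noncomputable def Cr (N : ℕ) (o : ℝ → ℝ → ℕ) (x y : ℝ) : Ltr := (msk N (Abv o x y), msk N (Blw o x y))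

theorem Cr_tr (N : ℕ) (o : ℝ → ℝ → ℕ) (x y : ℝ) : Cr N (tro o) x y = Cr N o y x := by
  have h1 : Abv (tro o) x y = Abv o y x := by
    funext i; apply propext
    constructor <;> rintro ⟨u, v, h1, h2, h3, h4, h5⟩ <;> exact ⟨v, u, h2, h1, h4, h3, h5⟩
  have h2 : Blw (tro o) x y = Blw o y x := by
    funext i; apply propext
    constructor <;> rintro ⟨u, v, h1, h2, h3, h4, h5⟩ <;> exact ⟨v, u, h2, h1, h4, h3, h5⟩
  unfold Cr; rw [h1, h2]

theorem Cr_mono (N : ℕ) (o : ℝ → ℝ → ℕ) {x y x' y' : ℝ} (hx : x ≤ x') (hy : y ≤ y') : Le (Cr N o x y) (Cr N o x' y') := by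
  constructor
  · intro i hi
    obtain ⟨h, u, v, h1, h2, h3, h4, h5⟩ := mem_msk.1 hi
    exact mem_msk.2 ⟨h, u, v, h1, h2, by linarith, by linarith, h5⟩
  · intro i hi
    obtain ⟨h, u, v, h1, h2, h3, h4, h5⟩ := mem_msk.1 hi
    exact mem_msk.2 ⟨h, u, v, h1, h2, by linarith, by linarith, h5⟩

theorem Cr_ltrs (N : ℕ) (o : ℝ → ℝ → ℕ) (x y : ℝ) : Cr N o x y ∈ ltrs N := by
  unfold ltrs Cr
  exact List.pair_mem_product.2 ⟨List.mem_range.2 (msk_lt _ _), List.mem_range.2 (msk_lt _ _)⟩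

def Itr (N : ℕ) (o : ℝ → ℝ → ℕ) (x y : ℝ) : Prop :=
  ∃ ε > 0, ∀ x' y', |x' - x| < ε → |y' - y| < ε → Cr N o x' y' = Cr N o x y

theorem Itr.tr {N : ℕ} {o : ℝ → ℝ → ℕ} {x y : ℝ} (h : Itr N o x y) : Itr N (tro o) y x := by
  obtain ⟨ε, h1, h2⟩ := h
  exact ⟨ε, h1, fun x' y' a b => by rw [Cr_tr, Cr_tr]; exact h2 _ _ b a⟩

theorem itr_of {N : ℕ} {o : ℝ → ℝ → ℕ} {x y a b a' b' : ℝ} (h1 : a < x) (h2 : b < y) (h3 : x < a') (h4 : y < b')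
    (h : rk (Cr N o a' b') ≤ rk (Cr N o a b)) : Itr N o x y := by
  have e := (Cr_mono N o (h1.trans h3).le (h2.trans h4).le).eq_of_rk h
  have key : ∀ x' y', a ≤ x' → x' ≤ a' → b ≤ y' → y' ≤ b' → Cr N o x' y' = Cr N o a b := by
    intro x' y' k1 k2 k3 k4
    have l1 := Cr_mono N o k2 k4
    rw [← e] at l1
    exact l1.antisymm (Cr_mono N o k1 k3)
  refine ⟨min (min (x - a) (a' - x)) (min (y - b) (b' - y)), lt_min (lt_min (by linarith) (by linarith)) (lt_min (by linarith) (by linarith)), fun x' y' hx hy => ?_⟩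
  simp only [lt_min_iff, abs_lt] at hx hy
  obtain ⟨⟨⟨p1, p2⟩, p3, p4⟩, -⟩ := hx
  obtain ⟨-, ⟨q1, q2⟩, q3, q4⟩ := hy
  rw [key x' y' (by linarith) (by linarith) (by linarith) (by linarith), key x y h1.le h3.le h2.le h4.le]

theorem itr_open (N : ℕ) (o : ℝ → ℝ → ℕ) (x : ℝ) : IsOpen {y | Itr N o x y} := by
  rw [Metric.isOpen_iff]
  rintro y ⟨ε, hε, h⟩
  refine ⟨ε / 2, by linarith, fun y' hy' => ?_⟩
  rw [Metric.mem_ball, Real.dist_eq] at hy'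
  have h0 := h x y' (by simpa using hε) (by linarith)
  refine ⟨ε / 2, by linarith, fun x'' y'' a b => ?_⟩
  rw [h0]
  apply h _ _ (by linarith)
  rw [abs_lt] at *
  constructor <;> linarith

theorem bad_countable (N : ℕ) (o : ℝ → ℝ → ℕ) (r s : ℝ) (hrs : r < s) :
    {x : ℝ | 0 < x ∧ x < 1 ∧ ∀ y, r < y → y < s → ¬ Itr N o x y}.Countable := by
  let φ : ℝ → ℝ := fun x => (rk (Cr N o x (r + (s - r) * x)) : ℝ)
  have hφ : Monotone φ := by
    intro x x' h
    have : r + (s - r) * x ≤ r + (s - r) * x' := by nlinarith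
    have := (Cr_mono N o h this).rk_le
    show (rk (Cr N o x (r + (s - r) * x)) : ℝ) ≤ (rk (Cr N o x' (r + (s - r) * x')) : ℝ)
    exact_mod_cast this
  apply hφ.countable_not_continuousAt.mono
  rintro x ⟨x0, x1, hx⟩ hc
  rw [Metric.continuousAt_iff] at hc
  obtain ⟨δ, hδ, hd⟩ := hc (1 / 2) (by norm_num)
  have d1 := hd (x := x - δ / 2) (by rw [Real.dist_eq, abs_lt]; constructor <;> linarith)
  have d2 := hd (x := x + δ / 2) (by rw [Real.dist_eq, abs_lt]; constructor <;> linarith)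
  rw [Real.dist_eq, abs_lt] at d1 d2
  apply hx (r + (s - r) * x) (by nlinarith) (by nlinarith)
  refine itr_of (a := x - δ / 2) (b := r + (s - r) * (x - δ / 2)) (a' := x + δ / 2) (b' := r + (s - r) * (x + δ / 2))
    (by linarith) (by nlinarith) (by linarith) (by nlinarith) ?_
  have : φ (x + δ / 2) < φ (x - δ / 2) + 1 := by linarith [d1.1, d2.2]
  simp only [φ] at this
  have h3 : rk (Cr N o (x + δ / 2) (r + (s - r) * (x + δ / 2))) < rk (Cr N o (x - δ / 2) (r + (s - r) * (x - δ / 2))) + 1 := by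
    exact_mod_cast this
  omega

structure Gr (N : ℕ) (o : ℝ → ℝ → ℕ) (X Y : Set ℝ) : Prop where
  lb : Lb N o
  bX : ∀ x ∈ X, 0 < x ∧ x < 1
  bY : ∀ x ∈ Y, 0 < x ∧ x < 1
  dX : ∀ a b, 0 ≤ a → a < b → b ≤ 1 → ∃ x ∈ X, a < x ∧ x < b
  dY : ∀ a b, 0 ≤ a → a < b → b ≤ 1 → ∃ x ∈ Y, a < x ∧ x < b
  itr : ∀ x ∈ X, ∀ y ∈ Y, Itr N o x y

theorem Gr.tr {N : ℕ} {o : ℝ → ℝ → ℕ} {X Y : Set ℝ} (h : Gr N o X Y) : Gr N (tro o) Y X :=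
  ⟨h.lb.tr, h.bY, h.bX, h.dY, h.dX, fun y hy x hx => (h.itr x hx y hy).tr⟩

theorem gr_ex {N : ℕ} {o : ℝ → ℝ → ℕ} (h : Lb N o) : ∃ X Y, Gr N o X Y := by
  let Bad : Set ℝ := ⋃ q : {q : ℚ × ℚ // q.1 < q.2}, {x : ℝ | 0 < x ∧ x < 1 ∧ ∀ y, (q.1.1 : ℝ) < y → y < q.1.2 → ¬ Itr N o x y}
  have hBad : Bad.Countable := Set.countable_iUnion fun q => bad_countable N o _ _ (by exact_mod_cast q.2)
  have hd := hBad.dense_compl ℝ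
  have hex : ∀ q : {q : ℚ × ℚ // q.1 < q.2}, ∃ x : ℝ, x ∈ Badᶜ ∧ (q.1.1 : ℝ) < x ∧ x < q.1.2 := by
    intro q
    obtain ⟨x, hx, hb⟩ := hd.exists_between (show (q.1.1 : ℝ) < q.1.2 by exact_mod_cast q.2)
    exact ⟨x, hx, hb.1, hb.2⟩
  choose g hg using hex
  let X : Set ℝ := {x | x ∈ Set.range g ∧ 0 < x ∧ x < 1}
  have hXc : X.Countable := (Set.countable_range g).mono fun x hx => hx.1
  let U : ℝ → Set ℝ := fun x => {y | Itr N o x y} ∪ (Set.Iio 0 ∪ Set.Ioi 1)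
  have hU : ∀ x ∈ X, IsOpen (U x) := fun x _ => (itr_open N o x).union (isOpen_Iio.union isOpen_Ioi)
  have hUd : ∀ x ∈ X, Dense (U x) := by
    rintro x ⟨⟨q, rfl⟩, hx0, hx1⟩
    rw [dense_iff_exists_between]
    intro a b hab
    obtain ⟨r, r1, r2⟩ := exists_rat_btwn hab
    obtain ⟨s, s1, s2⟩ := exists_rat_btwn r2
    have hq := (hg q).1
    by_contra hcon
    apply hq
    rw [Set.mem_iUnion]
    refine ⟨⟨(r, s), by exact_mod_cast s1⟩, hx0, hx1, fun y y1 y2 hi => hcon ⟨y, Or.inl hi, ?_, ?_⟩⟩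
    · simp only at y1 y2; linarith
    · simp only at y1 y2; linarith
  have hD := dense_biInter_of_isOpen hU hXc hUd
  refine ⟨X, {y | (∀ x ∈ X, y ∈ U x) ∧ 0 < y ∧ y < 1}, h, fun x hx => hx.2, fun y hy => hy.2, ?_, ?_, ?_⟩
  · intro a b ha hab hb
    obtain ⟨r, r1, r2⟩ := exists_rat_btwn hab
    obtain ⟨s, s1, s2⟩ := exists_rat_btwn r2
    have := (hg ⟨(r, s), by exact_mod_cast s1⟩).2
    simp only at this
    exact ⟨_, ⟨⟨_, rfl⟩, by linarith, by linarith⟩, by linarith, by linarith⟩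
  · intro a b ha hab hb
    obtain ⟨y, hy, h1, h2⟩ := hD.exists_between hab
    rw [Set.mem_iInter₂] at hy
    exact ⟨y, ⟨hy, by linarith, by linarith⟩, h1, h2⟩
  · rintro x hx y ⟨hy, y0, y1⟩
    rcases hy x hx with h | h | h
    · exact h
    · simp only [Set.mem_Iio] at h; linarith
    · simp only [Set.mem_Ioi] at h; linarith

end TL

namespace TL

open Classical in
noncomputable def CC (N : ℕ) (o : ℝ → ℝ → ℕ) (x y : ℝ) : Ltr :=
  if x = 0 ∨ y = 0 then bot N else if x = 1 ∨ y = 1 then top N else Cr N o x y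

theorem CC_tr (N : ℕ) (o : ℝ → ℝ → ℕ) (x y : ℝ) : CC N (tro o) x y = CC N o y x := by
  unfold CC; rw [Cr_tr]; simp only [or_comm]

theorem CC_in {N : ℕ} {o : ℝ → ℝ → ℕ} {x y : ℝ} (x0 : 0 < x) (x1 : x < 1) (y0 : 0 < y) (y1 : y < 1) :
    CC N o x y = Cr N o x y := by
  unfold CC; simp [x0.ne', x1.ne, y0.ne', y1.ne]

theorem CC_bot {N : ℕ} {o : ℝ → ℝ → ℕ} {x y : ℝ} (h : x = 0 ∨ y = 0) : CC N o x y = bot N := by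
  unfold CC; simp [h]

theorem CC_top {N : ℕ} {o : ℝ → ℝ → ℕ} {x y : ℝ} (x0 : 0 < x) (y0 : 0 < y) (h : x = 1 ∨ y = 1) : CC N o x y = top N := by
  unfold CC; simp [h, x0.ne', y0.ne']

theorem mem_full {N i : ℕ} : Mem i (2 ^ (N + 1) - 1) ↔ i < N + 1 := by
  unfold Mem; rw [Nat.testBit_two_pow_sub_one]; simp

theorem not_mem_zero {i : ℕ} : ¬ Mem i 0 := by unfold Mem; simp

theorem bot_Le {N : ℕ} {a : Ltr} (h : a ∈ ltrs N) : Le (bot N) a := by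
  obtain ⟨a1, a2⟩ := a
  have := List.pair_mem_product.1 h
  exact ⟨fun i hi => mem_full.2 (mem_lt (List.mem_range.1 this.1) hi), fun i hi => absurd hi not_mem_zero⟩

theorem Le_top {N : ℕ} {a : Ltr} (h : a ∈ ltrs N) : Le a (top N) := by
  obtain ⟨a1, a2⟩ := a
  have := List.pair_mem_product.1 h
  exact ⟨fun i hi => absurd hi not_mem_zero, fun i hi => mem_full.2 (mem_lt (List.mem_range.1 this.2) hi)⟩

theorem CC_ltrs (N : ℕ) (o : ℝ → ℝ → ℕ) (x y : ℝ) : CC N o x y ∈ ltrs N := by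
  unfold CC
  have : 2 ^ (N + 1) > 0 := by positivity
  split_ifs
  · exact List.pair_mem_product.2 ⟨List.mem_range.2 (by omega), List.mem_range.2 (by omega)⟩
  · exact List.pair_mem_product.2 ⟨List.mem_range.2 (by omega), List.mem_range.2 (by omega)⟩
  · exact Cr_ltrs _ _ _ _

theorem CC_mono {N : ℕ} {o : ℝ → ℝ → ℕ} {x y x' y' : ℝ} (x0 : 0 ≤ x) (hx : x ≤ x') (x1 : x' ≤ 1) (y0 : 0 ≤ y) (hy : y ≤ y')
    (y1 : y' ≤ 1) : Le (CC N o x y) (CC N o x' y') := by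
  by_cases h : x = 0 ∨ y = 0
  · rw [CC_bot h]; exact bot_Le (CC_ltrs _ _ _ _)
  · push Not at h
    have x0' : 0 < x := lt_of_le_of_ne x0 (Ne.symm h.1)
    have y0' : 0 < y := lt_of_le_of_ne y0 (Ne.symm h.2)
    by_cases h' : x' = 1 ∨ y' = 1
    · rw [CC_top (by linarith) (by linarith) h']; exact Le_top (CC_ltrs _ _ _ _)
    · push Not at h'
      have := lt_of_le_of_ne x1 h'.1
      have := lt_of_le_of_ne y1 h'.2
      rw [CC_in x0' (by linarith) y0' (by linarith), CC_in (by linarith) (by linarith) (by linarith) (by linarith)]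
      exact Cr_mono _ _ hx hy

theorem CC_Rl {N : ℕ} {o : ℝ → ℝ → ℕ} (h : Lb N o) {x y : ℝ} (x0 : 0 < x) (x1 : x < 1) (y0 : 0 < y) (y1 : y < 1) :
    Rl N (CC N o x y) := by
  rw [CC_in x0 x1 y0 y1]
  constructor
  · refine mem_msk.2 ⟨by omega, (x + 1) / 2, (y + 1) / 2, ⟨by linarith, by linarith⟩, ⟨by linarith, by linarith⟩, by linarith, by linarith, h.mem _ _ ?_ ?_ ?_ ?_⟩ <;> linarith
  · refine mem_msk.2 ⟨by omega, x / 2, y / 2, ⟨by linarith, by linarith⟩, ⟨by linarith, by linarith⟩, by linarith, by linarith, h.mem _ _ ?_ ?_ ?_ ?_⟩ <;> linarith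

theorem bot_nRl {N : ℕ} : ¬ Rl N (bot N) := fun h => not_mem_zero h.2
theorem top_nRl {N : ℕ} : ¬ Rl N (top N) := fun h => not_mem_zero h.1

/-- the basic block lemma -/
theorem Lb.blk {N : ℕ} {o : ℝ → ℝ → ℕ} (h : Lb N o) {x y : ℝ} (x0 : 0 < x) (x1 : x < 1) (y0 : 0 < y) (y1 : y < 1) {a b : Ltr}
    (h1 : ∀ i, Mem i (o x y) → Mem i a.1) (h2 : ∀ i, Mem i (o x y) → Mem i b.2)
    (h3 : ∀ i, i < N + 1 → (Mem i b.1 ↔ Abv o x y i)) (h4 : ∀ i, i < N + 1 → (Mem i a.2 ↔ Blw o x y i)) : B N a b (o x y) := by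
  refine ⟨h.lt x y x0 x1 y0 y1, h.mem x y x0 x1 y0 y1, fun i hi => ⟨h1 i hi, h2 i hi⟩, fun i hi => ?_⟩
  obtain ⟨c1, c2, c3, c4⟩ := h.cons x y x0 x1 y0 y1 i hi
  have hk : i.unpair.2 < N + 1 := by have := Nat.unpair_right_le i; omega
  refine ⟨c1, c2, fun e => (c3 e).trans ?_, fun e => (c4 e).trans ?_⟩
  · simp only
    rw [h3 _ hk, or_comm]
    refine or_congr ⟨?_, ?_⟩ Iff.rfl
    · rintro ⟨u, v, k1, k2, k3, k4, k5⟩; exact ⟨u, v, ⟨by linarith, k2⟩, ⟨by linarith, k4⟩, k1, k3, k5⟩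
    · rintro ⟨u, v, k1, k2, k3, k4, k5⟩; exact ⟨u, v, k3, k1.2, k4, k2.2, k5⟩
  · simp only
    rw [h4 _ hk, or_comm]
    refine or_congr ⟨?_, ?_⟩ Iff.rfl
    · rintro ⟨u, v, k1, k2, k3, k4, k5⟩; exact ⟨u, v, ⟨k1, by linarith⟩, ⟨k3, by linarith⟩, k2, k4, k5⟩
    · rintro ⟨u, v, k1, k2, k3, k4, k5⟩; exact ⟨u, v, k1.1, k3, k2.1, k4, k5⟩

theorem B.adm {N : ℕ} {a b : Ltr} {o : ℕ} (h : B N a b o) : Adm N a b := ⟨o, h.1, h⟩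

/-- interior constancy near grid points -/
theorem Gr.lc {N : ℕ} {o : ℝ → ℝ → ℕ} {X Y : Set ℝ} (h : Gr N o X Y) {x y : ℝ} (hx : x ∈ X) (hy : y ∈ Y) :
    ∃ ε > 0, ∀ x' y', |x' - x| < ε → |y' - y| < ε → (0 < x' ∧ x' < 1) ∧ (0 < y' ∧ y' < 1) ∧ CC N o x' y' = CC N o x y ∧
      Cr N o x' y' = CC N o x y := by
  obtain ⟨ε, hε, he⟩ := h.itr x hx y hy
  obtain ⟨x0, x1⟩ := h.bX x hx
  obtain ⟨y0, y1⟩ := h.bY y hy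
  refine ⟨min ε (min (min x (1 - x)) (min y (1 - y))), lt_min hε (lt_min (lt_min x0 (by linarith)) (lt_min y0 (by linarith))), fun x' y' a b => ?_⟩
  have e := he x' y' (lt_of_lt_of_le a (min_le_left _ _)) (lt_of_lt_of_le b (min_le_left _ _))
  simp only [lt_min_iff, abs_lt] at a b
  obtain ⟨-, ⟨⟨a1, a2⟩, a3, a4⟩, -⟩ := a
  obtain ⟨-, -, ⟨b1, b2⟩, b3, b4⟩ := b
  have p1 : 0 < x' := by linarith
  have p2 : x' < 1 := by linarith
  have p3 : 0 < y' := by linarith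
  have p4 : y' < 1 := by linarith
  rw [CC_in p1 p2 p3 p4, CC_in x0 x1 y0 y1]
  exact ⟨⟨p1, p2⟩, ⟨p3, p4⟩, e, e⟩

theorem Gr.lcx {N : ℕ} {o : ℝ → ℝ → ℕ} {X Y : Set ℝ} (h : Gr N o X Y) {x y : ℝ} (hx : x ∈ X) (hy : y = 0 ∨ y = 1 ∨ y ∈ Y) :
    ∃ ε > 0, ∀ x', |x' - x| < ε → CC N o x' y = CC N o x y := by
  obtain ⟨x0, x1⟩ := h.bX x hx
  rcases hy with rfl | rfl | hy
  · exact ⟨1, one_pos, fun x' _ => by rw [CC_bot (Or.inr rfl), CC_bot (Or.inr rfl)]⟩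
  · refine ⟨x, x0, fun x' hx' => ?_⟩
    rw [abs_lt] at hx'
    rw [CC_top (by linarith) one_pos (Or.inr rfl), CC_top x0 one_pos (Or.inr rfl)]
  · obtain ⟨ε, hε, he⟩ := h.lc hx hy
    exact ⟨ε, hε, fun x' hx' => (he x' y hx' (by simpa using hε)).2.2.1⟩

def Bd (X : Set ℝ) (a b : ℝ) : Prop := (a = 0 ∨ a ∈ X) ∧ (b = 1 ∨ b ∈ X) ∧ a < b

theorem Bd.bnd {X : Set ℝ} (hX : ∀ x ∈ X, 0 < x ∧ x < 1) {a b : ℝ} (h : Bd X a b) : 0 ≤ a ∧ a < b ∧ b ≤ 1 := by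
  obtain ⟨h1, h2, h3⟩ := h
  refine ⟨?_, h3, ?_⟩
  · rcases h1 with rfl | h1
    · exact le_rfl
    · exact (hX a h1).1.le
  · rcases h2 with rfl | h2
    · exact le_rfl
    · exact (hX b h2).2.le

theorem Gr.pert {N : ℕ} {o : ℝ → ℝ → ℕ} {X Y : Set ℝ} (h : Gr N o X Y) {x y0 y1 : ℝ} (hx : x ∈ X) (hb : Bd Y y0 y1) :
    ∃ ε > 0, ∀ x', |x' - x| < ε → CC N o x' y0 = CC N o x y0 ∧ CC N o x' y1 = CC N o x y1 := by
  obtain ⟨e1, p1, q1⟩ := h.lcx hx (y := y0) (by rcases hb.1 with k | k <;> tauto)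
  obtain ⟨e2, p2, q2⟩ := h.lcx hx (y := y1) (by rcases hb.2.1 with k | k <;> tauto)
  exact ⟨min e1 e2, lt_min p1 p2, fun x' hx' => ⟨q1 x' (lt_of_lt_of_le hx' (min_le_left _ _)), q2 x' (lt_of_lt_of_le hx' (min_le_right _ _))⟩⟩

theorem Gr.nearX {N : ℕ} {o : ℝ → ℝ → ℕ} {X Y : Set ℝ} (h : Gr N o X Y) {x l r y0 y1 : ℝ} (hx : x ∈ X) (hb : Bd Y y0 y1)
    (hl : l < x) (hr : x < r) : (∃ x' ∈ X, l < x' ∧ x' < x ∧ CC N o x' y0 = CC N o x y0 ∧ CC N o x' y1 = CC N o x y1) ∧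
      (∃ x' ∈ X, x < x' ∧ x' < r ∧ CC N o x' y0 = CC N o x y0 ∧ CC N o x' y1 = CC N o x y1) := by
  obtain ⟨ε, hε, he⟩ := h.pert hx hb
  obtain ⟨x0, x1⟩ := h.bX x hx
  constructor
  · obtain ⟨x', hx', k1, k2⟩ := h.dX (max (max l 0) (x - ε)) x (le_trans (le_max_right l 0) (le_max_left _ _)) (max_lt (max_lt hl x0) (by linarith)) x1.le
    obtain ⟨k3, k4⟩ := max_lt_iff.1 k1
    obtain ⟨k5, k6⟩ := max_lt_iff.1 k3
    exact ⟨x', hx', k5, k2, he x' (by rw [abs_lt]; constructor <;> linarith)⟩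
  · obtain ⟨x', hx', k1, k2⟩ := h.dX x (min (min r 1) (x + ε)) x0.le (lt_min (lt_min hr x1) (by linarith)) ((min_le_left _ _).trans (min_le_right _ _))
    obtain ⟨k3, k4⟩ := lt_min_iff.1 k2
    obtain ⟨k5, k6⟩ := lt_min_iff.1 k3
    exact ⟨x', hx', k1, k5, he x' (by rw [abs_lt]; constructor <;> linarith)⟩

open Classical in
noncomputable def VV (N : ℕ) (o : ℝ → ℝ → ℕ) (Y : Set ℝ) (x0 x1 y0 y1 : ℝ) : List Ltr2 :=
  (ltr2s N).filter (fun p => ∃ y ∈ Y, y0 < y ∧ y < y1 ∧ p = (CC N o x0 y, CC N o x1 y))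

theorem mem_VV {N : ℕ} {o : ℝ → ℝ → ℕ} {Y : Set ℝ} {x0 x1 y0 y1 : ℝ} {p : Ltr2} :
    p ∈ VV N o Y x0 x1 y0 y1 ↔ ∃ y ∈ Y, y0 < y ∧ y < y1 ∧ p = (CC N o x0 y, CC N o x1 y) := by
  unfold VV
  simp only [List.mem_filter, decide_eq_true_eq, and_iff_right_iff_imp]
  rintro ⟨y, -, -, -, rfl⟩
  exact List.pair_mem_product.2 ⟨CC_ltrs _ _ _ _, CC_ltrs _ _ _ _⟩

theorem mem_VVt {N : ℕ} {o : ℝ → ℝ → ℕ} {X : Set ℝ} {x0 x1 y0 y1 : ℝ} {p : Ltr2} :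
    p ∈ VV N (tro o) X y0 y1 x0 x1 ↔ ∃ x ∈ X, x0 < x ∧ x < x1 ∧ p = (CC N o x y0, CC N o x y1) := by
  rw [mem_VV]; simp only [CC_tr]

noncomputable def RI (N : ℕ) (o : ℝ → ℝ → ℕ) (X Y : Set ℝ) (x0 x1 y0 y1 : ℝ) (m : ℕ) : Item :=
  (VV N o Y x0 x1 y0 y1, VV N (tro o) X y0 y1 x0 x1, m)

theorem sw_RI (N : ℕ) (o : ℝ → ℝ → ℕ) (X Y : Set ℝ) (x0 x1 y0 y1 : ℝ) (m : ℕ) :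
    sw (RI N o X Y x0 x1 y0 y1 m) = RI N (tro o) Y X y0 y1 x0 x1 m := rfl

/-- adjacency along a grid line -/
theorem Gr.adj {N : ℕ} {o : ℝ → ℝ → ℕ} {X Y : Set ℝ} (h : Gr N o X Y) {x ys yt : ℝ} (hx : x ∈ X) (hys : ys ∈ Y) (hyt : yt ∈ Y)
    (hle : Le (CC N o x ys) (CC N o x yt)) (hne : CC N o x ys ≠ CC N o x yt)
    (hb : ∀ y ∈ Y, ys ≤ y → y ≤ yt → Le (CC N o x y) (CC N o x ys) ∨ Le (CC N o x yt) (CC N o x y)) :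
    Adm N (CC N o x ys) (CC N o x yt) := by
  obtain ⟨x0, x1⟩ := h.bX x hx
  have hlt : ys < yt := by
    by_contra hh
    exact hne (hle.antisymm (CC_mono x0.le le_rfl x1.le (h.bY _ hyt).1.le (not_lt.1 hh) (h.bY _ hys).2.le))
  have hmono : ∀ y y', 0 ≤ y → y ≤ y' → y' ≤ 1 → Le (CC N o x y) (CC N o x y') := fun y y' a b c => CC_mono x0.le le_rfl x1.le a b c
  have s0 := h.bY _ hys
  have t0 := h.bY _ hyt
  let E : Set ℝ := {y | ys ≤ y ∧ y ≤ yt ∧ CC N o x y = CC N o x ys}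
  have hEb : BddAbove E := ⟨yt, fun y hy => hy.2.1⟩
  have hsE : ys ∈ E := ⟨le_rfl, hlt.le, rfl⟩
  let t := sSup E
  have hst : ys ≤ t := le_csSup hEb hsE
  have htt : t ≤ yt := csSup_le ⟨ys, hsE⟩ fun y hy => hy.2.1
  have lo : ∀ y, ys ≤ y → y < t → CC N o x y = CC N o x ys := by
    intro y h1 h2
    obtain ⟨y', hy', h3⟩ := exists_lt_of_lt_csSup ⟨ys, hsE⟩ h2
    have k1 := hmono y y' (by linarith) h3.le (by linarith [hy'.2.1])
    rw [hy'.2.2] at k1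
    exact k1.antisymm (hmono ys y s0.1.le h1 (by linarith))
  have hi : ∀ y, t < y → y ≤ yt → CC N o x y = CC N o x yt := by
    intro y h1 h2
    obtain ⟨y', hy', k1, k2⟩ := h.dY t y (by linarith) h1 (by linarith)
    have : ¬ Le (CC N o x y') (CC N o x ys) := by
      intro hl
      have : y' ∈ E := ⟨by linarith, by linarith, hl.antisymm (hmono ys y' s0.1.le (by linarith) (by linarith))⟩
      have := le_csSup hEb this
      exact absurd k1 (not_lt.2 this)
    have l1 := (hb y' hy' (by linarith) (by linarith)).resolve_left this
    exact (hmono y yt (by linarith) h2 (by linarith)).antisymm (l1.trans (hmono y' y (by linarith) k2.le (by linarith)))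
  obtain ⟨e1, p1, q1⟩ := h.lc hx hys
  obtain ⟨e2, p2, q2⟩ := h.lc hx hyt
  have hst' : ys < t := by
    rcases lt_or_eq_of_le hst with hh | hh
    · exact hh
    exfalso
    obtain ⟨y, k1, k2⟩ := exists_between (show t < min yt (ys + e1) from lt_min (by linarith) (by linarith))
    obtain ⟨k3, k4⟩ := lt_min_iff.1 k2
    have a1 := hi y k1 k3.le
    have a2 := (q1 x y (by simpa using p1) (by rw [abs_lt]; constructor <;> linarith)).2.2.1
    exact hne (a2.symm.trans a1)
  have htt' : t < yt := by
    rcases lt_or_eq_of_le htt with hh | hh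
    · exact hh
    exfalso
    obtain ⟨y, k1, k2⟩ := exists_between (show max ys (yt - e2) < t from max_lt (by linarith) (by linarith))
    obtain ⟨k3, k4⟩ := max_lt_iff.1 k1
    have a1 := lo y k3.le k2
    have a2 := (q2 x y (by simpa using p2) (by rw [abs_lt]; constructor <;> linarith)).2.2.1
    exact hne (a1.symm.trans a2)
  refine B.adm (h.lb.blk (x := x) (y := t) x0 x1 (by linarith) (by linarith) ?_ ?_ ?_ ?_)
  · intro i him
    have hlt := mem_lt (h.lb.lt x t x0 x1 (by linarith) (by linarith)) him
    obtain ⟨-, -, -, e⟩ := q1 (x - e1 / 2) ys (by rw [abs_lt]; constructor <;> linarith) (by simpa using p1)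
    rw [← e]
    exact mem_msk.2 ⟨hlt, x, t, ⟨x0, x1⟩, ⟨by linarith, by linarith⟩, by linarith, hst', him⟩
  · intro i him
    have hlt := mem_lt (h.lb.lt x t x0 x1 (by linarith) (by linarith)) him
    obtain ⟨-, -, -, e⟩ := q2 (x + e2 / 2) yt (by rw [abs_lt]; constructor <;> linarith) (by simpa using p2)
    rw [← e]
    exact mem_msk.2 ⟨hlt, x, t, ⟨x0, x1⟩, ⟨by linarith, by linarith⟩, by linarith, htt', him⟩
  · intro i hlt
    rw [CC_in x0 x1 t0.1 t0.2]
    constructor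
    · intro him
      obtain ⟨-, u, v, k1, k2, k3, k4, k5⟩ := mem_msk.1 him
      exact ⟨u, v, k1, k2, k3, by linarith, k5⟩
    · rintro ⟨u, v, k1, k2, k3, k4, k5⟩
      obtain ⟨y, m1, m2⟩ := exists_between (show t < min v yt from lt_min k4 htt')
      obtain ⟨m3, m4⟩ := lt_min_iff.1 m2
      rw [← CC_in x0 x1 t0.1 t0.2, ← hi y m1 m4.le, CC_in x0 x1 (by linarith) (by linarith)]
      exact mem_msk.2 ⟨hlt, u, v, k1, k2, k3, m3, k5⟩
  · intro i hlt
    rw [CC_in x0 x1 s0.1 s0.2]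
    constructor
    · intro him
      obtain ⟨-, u, v, k1, k2, k3, k4, k5⟩ := mem_msk.1 him
      exact ⟨u, v, k1, k2, k3, by linarith, k5⟩
    · rintro ⟨u, v, k1, k2, k3, k4, k5⟩
      obtain ⟨y, m1, m2⟩ := exists_between (show max v ys < t from max_lt k4 hst')
      obtain ⟨m3, m4⟩ := max_lt_iff.1 m1
      rw [← CC_in x0 x1 s0.1 s0.2, ← lo y m4.le m2, CC_in x0 x1 (by linarith) (by linarith)]
      exact mem_msk.2 ⟨hlt, u, v, k1, k2, k3, m3, k5⟩

theorem Gr.diag {N : ℕ} {o : ℝ → ℝ → ℕ} {X Y : Set ℝ} (h : Gr N o X Y) {x y : ℝ} (hx : x ∈ X) (hy : y ∈ Y) :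
    Adm N (CC N o x y) (CC N o x y) := by
  obtain ⟨x0, x1⟩ := h.bX x hx
  obtain ⟨y0, y1⟩ := h.bY y hy
  obtain ⟨e, p, q⟩ := h.lc hx hy
  refine B.adm (h.lb.blk (x := x) (y := y) x0 x1 y0 y1 ?_ ?_ ?_ ?_)
  · intro i him
    have hlt := mem_lt (h.lb.lt x y x0 x1 y0 y1) him
    obtain ⟨-, -, -, e'⟩ := q (x - e / 2) (y - e / 2) (by rw [abs_lt]; constructor <;> linarith) (by rw [abs_lt]; constructor <;> linarith)
    rw [← e']
    exact mem_msk.2 ⟨hlt, x, y, ⟨x0, x1⟩, ⟨y0, y1⟩, by linarith, by linarith, him⟩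
  · intro i him
    have hlt := mem_lt (h.lb.lt x y x0 x1 y0 y1) him
    obtain ⟨-, -, -, e'⟩ := q (x + e / 2) (y + e / 2) (by rw [abs_lt]; constructor <;> linarith) (by rw [abs_lt]; constructor <;> linarith)
    rw [← e']
    exact mem_msk.2 ⟨hlt, x, y, ⟨x0, x1⟩, ⟨y0, y1⟩, by linarith, by linarith, him⟩
  · intro i hlt
    rw [CC_in x0 x1 y0 y1]
    exact mem_msk.trans (and_iff_right hlt)
  · intro i hlt
    rw [CC_in x0 x1 y0 y1]
    exact mem_msk.trans (and_iff_right hlt)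

open Classical in
theorem Gr.cut {N : ℕ} {o : ℝ → ℝ → ℕ} {X Y : Set ℝ} (h : Gr N o X Y) {x0 x1 y0 y1 x : ℝ} (hX : Bd X x0 x1) (hY : Bd Y y0 y1)
    (hx : x ∈ X) (h0 : x0 < x) (h1 : x < x1) {m m1 m2 : ℕ} (hm : (m1 = m ∧ m2 = 0) ∨ (m1 = 0 ∧ m2 = m)) :
    SplitV N (RI N o X Y x0 x1 y0 y1 m) (CC N o x y0, CC N o x y1) (RI N o X Y x0 x y0 y1 m1) (RI N o X Y x x1 y0 y1 m2) := by
  obtain ⟨bx0, bx, bx1⟩ := hX.bnd h.bX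
  obtain ⟨by0, byy, by1⟩ := hY.bnd h.bY
  obtain ⟨xx0, xx1⟩ := h.bX x hx
  let T : List Tri := (tris N).filter (fun t => ∃ y ∈ Y, y0 < y ∧ y < y1 ∧ t = (CC N o x0 y, CC N o x y, CC N o x1 y))
  have hT : ∀ t, t ∈ T ↔ ∃ y ∈ Y, y0 < y ∧ y < y1 ∧ t = (CC N o x0 y, CC N o x y, CC N o x1 y) := by
    intro t
    simp only [T]
    rw [List.mem_filter, decide_eq_true_eq, and_iff_right_iff_imp]
    rintro ⟨y, -, -, -, rfl⟩
    exact List.pair_mem_product.2 ⟨CC_ltrs _ _ _ _, List.pair_mem_product.2 ⟨CC_ltrs _ _ _ _, CC_ltrs _ _ _ _⟩⟩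
  have my : ∀ x y y', 0 ≤ x → x ≤ 1 → y0 ≤ y → y ≤ y' → y' ≤ y1 → Le (CC N o x y) (CC N o x y') :=
    fun x y y' a b c d e => CC_mono a le_rfl b (by linarith) d (by linarith)
  have mx : ∀ x x' y, x0 ≤ x → x ≤ x' → x' ≤ x1 → y0 ≤ y → y ≤ y1 → Le (CC N o x y) (CC N o x' y) :=
    fun x y y' a b c d e => CC_mono (by linarith) b (by linarith) (by linarith) le_rfl (by linarith)
  refine ⟨T, (mem_subs _ _).2 List.filter_sublist, ?_, ?_, ⟨?_, ?_⟩, ⟨?_, ?_⟩, ⟨?_, ?_⟩, ⟨?_, ?_⟩, ⟨?_, ?_⟩, ?_, ⟨?_, ?_⟩, ?_, hm⟩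
  · exact mem_VVt.2 ⟨x, hx, h0, h1, rfl⟩
  · intro s hs t ht
    obtain ⟨y, hy, a1, a2, rfl⟩ := (hT s).1 hs
    obtain ⟨y', hy', b1, b2, rfl⟩ := (hT t).1 ht
    rcases le_total y y' with hh | hh
    · left; exact ⟨my _ _ _ (by linarith) (by linarith) a1.le hh b2.le, my _ _ _ (by linarith) (by linarith) a1.le hh b2.le, my _ _ _ (by linarith) (by linarith) a1.le hh b2.le⟩
    · right; exact ⟨my _ _ _ (by linarith) (by linarith) b1.le hh a2.le, my _ _ _ (by linarith) (by linarith) b1.le hh a2.le, my _ _ _ (by linarith) (by linarith) b1.le hh a2.le⟩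
  · intro p hp
    obtain ⟨y, hy, a1, a2, rfl⟩ := mem_VV.1 hp
    exact ⟨_, (hT _).2 ⟨y, hy, a1, a2, rfl⟩, rfl, rfl⟩
  · intro t ht
    obtain ⟨y, hy, a1, a2, rfl⟩ := (hT t).1 ht
    exact mem_VV.2 ⟨y, hy, a1, a2, rfl⟩
  · intro p hp
    obtain ⟨y, hy, a1, a2, rfl⟩ := mem_VV.1 hp
    exact ⟨_, (hT _).2 ⟨y, hy, a1, a2, rfl⟩, rfl, rfl⟩
  · intro t ht
    obtain ⟨y, hy, a1, a2, rfl⟩ := (hT t).1 ht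
    exact mem_VV.2 ⟨y, hy, a1, a2, rfl⟩
  · intro p hp
    obtain ⟨y, hy, a1, a2, rfl⟩ := mem_VV.1 hp
    exact ⟨_, (hT _).2 ⟨y, hy, a1, a2, rfl⟩, rfl, rfl⟩
  · intro t ht
    obtain ⟨y, hy, a1, a2, rfl⟩ := (hT t).1 ht
    exact mem_VV.2 ⟨y, hy, a1, a2, rfl⟩
  · intro k hk
    obtain ⟨x', hx', a1, a2, rfl⟩ := mem_VVt.1 hk
    exact ⟨mem_VVt.2 ⟨x', hx', a1, by linarith, rfl⟩, mx _ _ _ a1.le a2.le h1.le le_rfl byy.le, mx _ _ _ a1.le a2.le h1.le byy.le le_rfl⟩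
  · intro k hk hl
    obtain ⟨x', hx', a1, a2, rfl⟩ := mem_VVt.1 hk
    by_cases hh : x' < x
    · exact mem_VVt.2 ⟨x', hx', a1, hh, rfl⟩
    · rw [not_lt] at hh
      have e : L2 (CC N o x y0, CC N o x y1) (CC N o x' y0, CC N o x' y1) :=
        ⟨mx _ _ _ h0.le hh a2.le le_rfl byy.le, mx _ _ _ h0.le hh a2.le byy.le le_rfl⟩
      rw [hl.antisymm e]
      obtain ⟨x'', hx'', k1, k2, k3, k4⟩ := (h.nearX hx hY h0 h1).1
      exact mem_VVt.2 ⟨x'', hx'', k1, k2, by rw [k3, k4]⟩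
  · intro k hk
    obtain ⟨x', hx', a1, a2, rfl⟩ := mem_VVt.1 hk
    exact ⟨mem_VVt.2 ⟨x', hx', by linarith, a2, rfl⟩, mx _ _ _ h0.le a1.le a2.le le_rfl byy.le, mx _ _ _ h0.le a1.le a2.le byy.le le_rfl⟩
  · intro k hk hl
    obtain ⟨x', hx', a1, a2, rfl⟩ := mem_VVt.1 hk
    by_cases hh : x < x'
    · exact mem_VVt.2 ⟨x', hx', hh, a2, rfl⟩
    · rw [not_lt] at hh
      have e : L2 (CC N o x' y0, CC N o x' y1) (CC N o x y0, CC N o x y1) :=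
        ⟨mx _ _ _ a1.le hh h1.le le_rfl byy.le, mx _ _ _ a1.le hh h1.le byy.le le_rfl⟩
      rw [e.antisymm hl]
      obtain ⟨x'', hx'', k1, k2, k3, k4⟩ := (h.nearX hx hY h0 h1).2
      exact mem_VVt.2 ⟨x'', hx'', k1, k2, by rw [k3, k4]⟩
  · intro t ht
    obtain ⟨y, hy, a1, a2, rfl⟩ := (hT t).1 ht
    exact ⟨⟨mx _ _ _ le_rfl h0.le h1.le a1.le a2.le, mx _ _ _ h0.le h1.le le_rfl a1.le a2.le⟩,
      ⟨my _ _ _ xx0.le xx1.le le_rfl a1.le a2.le, my _ _ _ xx0.le xx1.le a1.le a2.le le_rfl⟩,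
      CC_Rl h.lb xx0 xx1 (h.bY y hy).1 (h.bY y hy).2, h.diag hx hy⟩
  · intro hr
    rcases hY.1 with rfl | hy
    · simp only [CC_bot (Or.inr rfl)] at hr
      exact absurd hr bot_nRl
    · obtain ⟨y, hy', k1, k2, k3, k4⟩ := (h.tr.nearX (y0 := 0) (y1 := x) (l := 0) (r := y1) hy ⟨Or.inl rfl, Or.inr hx, xx0⟩ (h.bY _ hy).1 byy).2
      rw [CC_tr, CC_tr] at k4
      exact ⟨_, (hT _).2 ⟨y, hy', k1, k2, rfl⟩, k4⟩
  · intro hr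
    rcases hY.2.1 with rfl | hy
    · simp only [CC_top xx0 one_pos (Or.inr rfl)] at hr
      exact absurd hr top_nRl
    · obtain ⟨y, hy', k1, k2, k3, k4⟩ := (h.tr.nearX (y0 := 0) (y1 := x) (l := y0) (r := 1) hy ⟨Or.inl rfl, Or.inr hx, xx0⟩ byy (h.bY _ hy).2).1
      rw [CC_tr, CC_tr] at k4
      exact ⟨_, (hT _).2 ⟨y, hy', k1, k2, rfl⟩, k4⟩
  · intro s hs t ht hle hne hu
    obtain ⟨ys, hys, a1, a2, rfl⟩ := (hT s).1 hs
    obtain ⟨yt, hyt, b1, b2, rfl⟩ := (hT t).1 ht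
    exact h.adj hx hys hyt hle hne fun y hy l1 l2 => hu _ ((hT _).2 ⟨y, hy, by linarith, by linarith, rfl⟩)

end TL

namespace TL

def MC (o : ℝ → ℝ → ℕ) (x0 x1 y0 y1 : ℝ) (m : ℕ) (u v : ℝ) : Prop :=
  m = 0 ∨ (x0 < u ∧ u < x1 ∧ y0 < v ∧ v < y1 ∧ m = o u v)

theorem MC.tr {o : ℝ → ℝ → ℕ} {x0 x1 y0 y1 : ℝ} {m : ℕ} {u v : ℝ} (h : MC o x0 x1 y0 y1 m u v) :
    MC (tro o) y0 y1 x0 x1 m v u := by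
  rcases h with h | ⟨h1, h2, h3, h4, h5⟩
  · exact Or.inl h
  · exact Or.inr ⟨h3, h4, h1, h2, h5⟩

/-- realized items -/
def Rz (N : ℕ) (o : ℝ → ℝ → ℕ) (X Y : Set ℝ) (it : Item) : Prop :=
  ∃ x0 x1 y0 y1 m u v, Bd X x0 x1 ∧ Bd Y y0 y1 ∧ MC o x0 x1 y0 y1 m u v ∧ it = RI N o X Y x0 x1 y0 y1 m

theorem Rz.sw {N : ℕ} {o : ℝ → ℝ → ℕ} {X Y : Set ℝ} {it : Item} (h : Rz N o X Y it) : Rz N (tro o) Y X (sw it) := by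
  obtain ⟨x0, x1, y0, y1, m, u, v, h1, h2, h3, rfl⟩ := h
  exact ⟨y0, y1, x0, x1, m, v, u, h2, h1, h3.tr, rfl⟩

open Classical in
noncomputable def Dl (N : ℕ) (o : ℝ → ℝ → ℕ) (X Y : Set ℝ) : List Item := (items N).filter (fun it => Rz N o X Y it)

theorem MC.lt {N : ℕ} {o : ℝ → ℝ → ℕ} {X Y : Set ℝ} (h : Gr N o X Y) {x0 x1 y0 y1 : ℝ} {m : ℕ} {u v : ℝ}
    (hX : Bd X x0 x1) (hY : Bd Y y0 y1) (hm : MC o x0 x1 y0 y1 m u v) : m < 2 ^ (N + 1) := by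
  rcases hm with rfl | ⟨h1, h2, h3, h4, rfl⟩
  · positivity
  · obtain ⟨a1, a2, a3⟩ := hX.bnd h.bX
    obtain ⟨b1, b2, b3⟩ := hY.bnd h.bY
    exact h.lb.lt _ _ (by linarith) (by linarith) (by linarith) (by linarith)

theorem mem_Dl {N : ℕ} {o : ℝ → ℝ → ℕ} {X Y : Set ℝ} (h : Gr N o X Y) {it : Item} : it ∈ Dl N o X Y ↔ Rz N o X Y it := by
  unfold Dl
  simp only [List.mem_filter, decide_eq_true_eq, and_iff_right_iff_imp]
  rintro ⟨x0, x1, y0, y1, m, u, v, h1, h2, h3, rfl⟩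
  exact List.pair_mem_product.2 ⟨(mem_subs _ _).2 List.filter_sublist, List.pair_mem_product.2 ⟨(mem_subs _ _).2 List.filter_sublist,
    List.mem_range.2 (h3.lt h h1 h2)⟩⟩

/-- cut left/right of the marked point -/
theorem Gr.vc {N : ℕ} {o : ℝ → ℝ → ℕ} {X Y : Set ℝ} (h : Gr N o X Y) {x0 x1 y0 y1 x u v : ℝ} {m : ℕ} (hX : Bd X x0 x1) (hY : Bd Y y0 y1)
    (hm : MC o x0 x1 y0 y1 m u v) (hx : x ∈ X) (h0 : x0 < x) (h1 : x < x1) (hu : u ≠ x) :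
    Bd X x0 x ∧ Bd X x x1 ∧ ∃ m1 m2, MC o x0 x y0 y1 m1 u v ∧ MC o x x1 y0 y1 m2 u v ∧
      SplitV N (RI N o X Y x0 x1 y0 y1 m) (CC N o x y0, CC N o x y1) (RI N o X Y x0 x y0 y1 m1) (RI N o X Y x x1 y0 y1 m2) ∧
      (u < x → m1 = m ∧ m2 = 0) ∧ (x < u → m1 = 0 ∧ m2 = m) := by
  refine ⟨⟨hX.1, Or.inr hx, h0⟩, ⟨Or.inr hx, hX.2.1, h1⟩, ?_⟩
  rcases lt_or_gt_of_ne hu with hu | hu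
  · refine ⟨m, 0, ?_, Or.inl rfl, h.cut hX hY hx h0 h1 (Or.inl ⟨rfl, rfl⟩), fun _ => ⟨rfl, rfl⟩, fun k => absurd k hu.not_gt⟩
    rcases hm with hm | ⟨a, b, c⟩
    · exact Or.inl hm
    · exact Or.inr ⟨a, hu, c⟩
  · refine ⟨0, m, Or.inl rfl, ?_, h.cut hX hY hx h0 h1 (Or.inr ⟨rfl, rfl⟩), fun k => absurd k hu.not_gt, fun _ => ⟨rfl, rfl⟩⟩
    rcases hm with hm | ⟨a, b, c⟩
    · exact Or.inl hm
    · exact Or.inr ⟨hu, b, c⟩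

theorem Gr.cV {N : ℕ} {o : ℝ → ℝ → ℕ} {X Y : Set ℝ} (h : Gr N o X Y) (it : Item) (hi : Rz N o X Y it) :
    ∀ k ∈ it.2.1, ∃ j1 j2, Rz N o X Y j1 ∧ Rz N o X Y j2 ∧ SplitV N it k j1 j2 := by
  obtain ⟨x0, x1, y0, y1, m, u, v, hX, hY, hm, rfl⟩ := hi
  intro k hk
  obtain ⟨x, hx, h0, h1, rfl⟩ := mem_VVt.1 hk
  have : ∃ x' ∈ X, x0 < x' ∧ x' < x1 ∧ CC N o x' y0 = CC N o x y0 ∧ CC N o x' y1 = CC N o x y1 ∧ u ≠ x' := by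
    by_cases hu : u = x
    · obtain ⟨x', a, b, c, d, e⟩ := (h.nearX hx hY h0 h1).1
      exact ⟨x', a, b, by linarith, d, e, by rw [hu]; exact c.ne'⟩
    · exact ⟨x, hx, h0, h1, rfl, rfl, hu⟩
  obtain ⟨x', hx', a, b, c, d, e⟩ := this
  obtain ⟨b1, b2, m1, m2, k1, k2, k3, -, -⟩ := h.vc hX hY hm hx' a b e
  rw [c, d] at k3
  exact ⟨_, _, ⟨_, _, _, _, _, _, _, b1, hY, k1, rfl⟩, ⟨_, _, _, _, _, _, _, b2, hY, k2, rfl⟩, k3⟩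

theorem Gr.iV {N : ℕ} {o : ℝ → ℝ → ℕ} {X Y : Set ℝ} (h : Gr N o X Y) (it : Item) (hi : Rz N o X Y it) (h0 : it.2.2 ≠ 0) :
    (∃ k ∈ it.2.1, ∃ j1 j2, Rz N o X Y j1 ∧ Rz N o X Y j2 ∧ SplitV N it k j1 j2 ∧ j1.2.2 = it.2.2) ∧
    (∃ k ∈ it.2.1, ∃ j1 j2, Rz N o X Y j1 ∧ Rz N o X Y j2 ∧ SplitV N it k j1 j2 ∧ j2.2.2 = it.2.2) := by
  obtain ⟨x0, x1, y0, y1, m, u, v, hX, hY, hm, rfl⟩ := hi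
  have hm' := hm
  obtain ⟨n0, n1, n2⟩ := hX.bnd h.bX
  rcases hm with hm | ⟨a, b, c, d, e⟩
  · exact absurd hm h0
  constructor
  · obtain ⟨x, hx, g1, g2⟩ := h.dX u x1 (by linarith) b n2
    obtain ⟨b1, b2, m1, m2, k1, k2, k3, k4, -⟩ := h.vc hX hY hm' hx (by linarith) g2 g1.ne
    exact ⟨_, mem_VVt.2 ⟨x, hx, by linarith, g2, rfl⟩, _, _, ⟨_, _, _, _, _, _, _, b1, hY, k1, rfl⟩, ⟨_, _, _, _, _, _, _, b2, hY, k2, rfl⟩, k3, (k4 g1).1⟩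
  · obtain ⟨x, hx, g1, g2⟩ := h.dX x0 u (by linarith) a (by linarith)
    obtain ⟨b1, b2, m1, m2, k1, k2, k3, -, k4⟩ := h.vc hX hY hm' hx (by linarith) (by linarith) g2.ne'
    exact ⟨_, mem_VVt.2 ⟨x, hx, by linarith, by linarith, rfl⟩, _, _, ⟨_, _, _, _, _, _, _, b1, hY, k1, rfl⟩, ⟨_, _, _, _, _, _, _, b2, hY, k2, rfl⟩, k3, (k4 g2).2⟩

theorem Gr.demAux {N : ℕ} {o : ℝ → ℝ → ℕ} {X Y : Set ℝ} (h : Gr N o X Y) {x0 x1 y0 y1 u v u0 v0 : ℝ} {m i : ℕ} (hX : Bd X x0 x1) (hY : Bd Y y0 y1)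
    (hm : MC o x0 x1 y0 y1 m u0 v0) (hm0 : m ≠ 0) (hu0 : x0 < u) (hu1 : u < x1) (hv0 : y0 < v) (hv1 : v < y1) (hi : Mem i (o u v)) (hne : u ≠ u0) :
    ∃ j1 j2, Rz N o X Y j1 ∧ Rz N o X Y j2 ∧ (∃ k ∈ (RI N o X Y x0 x1 y0 y1 m).2.1, SplitV N (RI N o X Y x0 x1 y0 y1 m) k j1 j2) ∧
      ((j1.2.2 = 0 ∧ ∃ j, Rz N o X Y j ∧ j.1 = j1.1 ∧ j.2.1 = j1.2.1 ∧ Mem i j.2.2) ∨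
       (j2.2.2 = 0 ∧ ∃ j, Rz N o X Y j ∧ j.1 = j2.1 ∧ j.2.1 = j2.2.1 ∧ Mem i j.2.2)) := by
  have hm' := hm
  obtain ⟨n0, n1, n2⟩ := hX.bnd h.bX
  rcases hm with hm | ⟨a, b, c, d, e⟩
  · exact absurd hm hm0
  rcases lt_or_gt_of_ne hne with hu | hu
  · obtain ⟨x, hx, g1, g2⟩ := h.dX u u0 (by linarith) hu (by linarith)
    obtain ⟨b1, b2, m1, m2, k1, k2, k3, -, k4⟩ := h.vc hX hY hm' hx (by linarith) (by linarith) g2.ne'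
    refine ⟨_, _, ⟨_, _, _, _, _, _, _, b1, hY, k1, rfl⟩, ⟨_, _, _, _, _, _, _, b2, hY, k2, rfl⟩, ⟨_, mem_VVt.2 ⟨x, hx, by linarith, by linarith, rfl⟩, k3⟩, Or.inl ⟨(k4 g2).1, ?_⟩⟩
    exact ⟨RI N o X Y x0 x y0 y1 (o u v), ⟨_, _, _, _, _, u, v, b1, hY, Or.inr ⟨hu0, g1, hv0, hv1, rfl⟩, rfl⟩, rfl, rfl, hi⟩
  · obtain ⟨x, hx, g1, g2⟩ := h.dX u0 u (by linarith) hu (by linarith)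
    obtain ⟨b1, b2, m1, m2, k1, k2, k3, k4, -⟩ := h.vc hX hY hm' hx (by linarith) (by linarith) g1.ne
    refine ⟨_, _, ⟨_, _, _, _, _, _, _, b1, hY, k1, rfl⟩, ⟨_, _, _, _, _, _, _, b2, hY, k2, rfl⟩, ⟨_, mem_VVt.2 ⟨x, hx, by linarith, by linarith, rfl⟩, k3⟩, Or.inr ⟨(k4 g1).2, ?_⟩⟩
    exact ⟨RI N o X Y x x1 y0 y1 (o u v), ⟨_, _, _, _, _, u, v, b2, hY, Or.inr ⟨g2, hu1, hv0, hv1, rfl⟩, rfl⟩, rfl, rfl, hi⟩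

theorem Gr.dem {N : ℕ} {o : ℝ → ℝ → ℕ} {X Y : Set ℝ} (h : Gr N o X Y) {x0 x1 y0 y1 u v u0 v0 : ℝ} {m i : ℕ} (hX : Bd X x0 x1) (hY : Bd Y y0 y1)
    (hm : MC o x0 x1 y0 y1 m u0 v0) (hu0 : x0 < u) (hu1 : u < x1) (hv0 : y0 < v) (hv1 : v < y1) (hi : Mem i (o u v)) :
    Dem N (Dl N o X Y) (RI N o X Y x0 x1 y0 y1 m) i := by
  by_cases hm0 : m = 0
  · left
    exact ⟨hm0, RI N o X Y x0 x1 y0 y1 (o u v), (mem_Dl h).2 ⟨_, _, _, _, _, u, v, hX, hY, Or.inr ⟨hu0, hu1, hv0, hv1, rfl⟩, rfl⟩, rfl, rfl, hi⟩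
  · right
    by_cases e1 : u = u0
    · by_cases e2 : v = v0
      · left
        rcases hm with hm | hm
        · exact absurd hm hm0
        · refine ⟨hm0, ?_⟩
          change Mem i m
          rw [hm.2.2.2.2, ← e1, ← e2]; exact hi
      · right
        refine ⟨hm0, ?_⟩
        obtain ⟨j1, j2, r1, r2, ⟨k, hk, hs⟩, hd⟩ := h.tr.demAux hY hX hm.tr hm0 hv0 hv1 hu0 hu1 hi e2
        refine ⟨TL.sw j1, (mem_Dl h).2 r1.sw, TL.sw j2, (mem_Dl h).2 r2.sw, Or.inr ⟨k, hk, hs⟩, ?_⟩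
        rcases hd with ⟨z, j, s1, s2, s3, s4⟩ | ⟨z, j, s1, s2, s3, s4⟩
        · exact Or.inl ⟨z, TL.sw j, (mem_Dl h).2 s1.sw, s3, s2, s4⟩
        · exact Or.inr ⟨z, TL.sw j, (mem_Dl h).2 s1.sw, s3, s2, s4⟩
    · right
      refine ⟨hm0, ?_⟩
      obtain ⟨j1, j2, r1, r2, ⟨k, hk, hs⟩, hd⟩ := h.demAux hX hY hm hm0 hu0 hu1 hv0 hv1 hi e1
      refine ⟨j1, (mem_Dl h).2 r1, j2, (mem_Dl h).2 r2, Or.inl ⟨k, hk, hs⟩, ?_⟩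
      rcases hd with ⟨z, j, s1, s2⟩ | ⟨z, j, s1, s2⟩
      · exact Or.inl ⟨z, j, (mem_Dl h).2 s1, s2⟩
      · exact Or.inr ⟨z, j, (mem_Dl h).2 s1, s2⟩

theorem Gr.dF {N : ℕ} {o : ℝ → ℝ → ℕ} {X Y : Set ℝ} (h : Gr N o X Y) {it : Item} (hit : Rz N o X Y it) {p q : Ltr2} (hp : p ∈ it.1)
    (hq : IsMin it.2.1 q) (hr : Rl N p.1) {i : ℕ} (m1 : Mem i p.1.1) (m2 : ¬ Mem i p.2.1) (m3 : ¬ Mem i q.2.1) :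
    Dem N (Dl N o X Y) it i := by
  obtain ⟨x0, x1, y0, y1, m, u0, v0, hX, hY, hm, rfl⟩ := hit
  obtain ⟨y, hy, a1, a2, rfl⟩ := mem_VV.1 hp
  obtain ⟨n0, n1, n2⟩ := hX.bnd h.bX
  obtain ⟨n3, n4, n5⟩ := hY.bnd h.bY
  have hx0 : x0 ∈ X := by
    rcases hX.1 with k | k
    · simp only at hr
      rw [CC_bot (Or.inl k)] at hr; exact absurd hr bot_nRl
    · exact k
  obtain ⟨p0, p1⟩ := h.bX x0 hx0
  simp only at m1 m2
  rw [CC_in p0 p1 (by linarith) (by linarith)] at m1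
  obtain ⟨hiN, u, v, b1, b2, b3, b4, b5⟩ := mem_msk.1 m1
  have hu : u < x1 := by
    by_contra hu
    rw [not_lt] at hu
    have hx1 : x1 ∈ X := by
      rcases hX.2.1 with k | k
      · linarith [b1.2]
      · exact k
    obtain ⟨ε, hε, he⟩ := h.lc hx1 hy
    have := (he (x1 - ε / 2) y (by rw [abs_lt]; constructor <;> linarith) (by simpa using hε)).2.2.2
    rw [← this] at m2
    exact m2 (mem_msk.2 ⟨hiN, u, v, b1, b2, by linarith, b4, b5⟩)
  have hv : v < y1 := by
    by_contra hv
    rw [not_lt] at hv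
    have hy1 : y1 ∈ Y := by
      rcases hY.2.1 with k | k
      · linarith [b2.2]
      · exact k
    obtain ⟨x', hx', c1, c2⟩ := h.dX x0 u (by linarith) b3 (by linarith)
    obtain ⟨ε, hε, he⟩ := h.lc hx' hy1
    have := (he x' (y1 - ε / 2) (by simpa using hε) (by rw [abs_lt]; constructor <;> linarith)).2.2.2
    have hl := (hq.2 _ (mem_VVt.2 ⟨x', hx', c1, by linarith, rfl⟩)).2
    apply m3
    apply hl.1
    simp only
    rw [← this]
    exact mem_msk.2 ⟨hiN, u, v, b1, b2, by linarith, by linarith, b5⟩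
  exact h.dem hX hY hm b3 hu (by linarith) hv b5

theorem Gr.dP {N : ℕ} {o : ℝ → ℝ → ℕ} {X Y : Set ℝ} (h : Gr N o X Y) {it : Item} (hit : Rz N o X Y it) {p q : Ltr2} (hp : p ∈ it.1)
    (hq : IsMax it.2.1 q) (hr : Rl N p.2) {i : ℕ} (m1 : Mem i p.2.2) (m2 : ¬ Mem i p.1.2) (m3 : ¬ Mem i q.1.2) :
    Dem N (Dl N o X Y) it i := by
  obtain ⟨x0, x1, y0, y1, m, u0, v0, hX, hY, hm, rfl⟩ := hit
  obtain ⟨y, hy, a1, a2, rfl⟩ := mem_VV.1 hp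
  obtain ⟨n0, n1, n2⟩ := hX.bnd h.bX
  obtain ⟨n3, n4, n5⟩ := hY.bnd h.bY
  have hx1 : x1 ∈ X := by
    rcases hX.2.1 with k | k
    · simp only at hr
      rw [CC_top (by linarith) (by linarith) (Or.inl k)] at hr; exact absurd hr top_nRl
    · exact k
  obtain ⟨p0, p1⟩ := h.bX x1 hx1
  simp only at m1 m2
  rw [CC_in p0 p1 (by linarith) (by linarith)] at m1
  obtain ⟨hiN, u, v, b1, b2, b3, b4, b5⟩ := mem_msk.1 m1
  have hu : x0 < u := by
    by_contra hu
    rw [not_lt] at hu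
    have hx0 : x0 ∈ X := by
      rcases hX.1 with k | k
      · linarith [b1.1]
      · exact k
    obtain ⟨ε, hε, he⟩ := h.lc hx0 hy
    have := (he (x0 + ε / 2) y (by rw [abs_lt]; constructor <;> linarith) (by simpa using hε)).2.2.2
    rw [← this] at m2
    exact m2 (mem_msk.2 ⟨hiN, u, v, b1, b2, by linarith, b4, b5⟩)
  have hv : y0 < v := by
    by_contra hv
    rw [not_lt] at hv
    have hy0 : y0 ∈ Y := by
      rcases hY.1 with k | k
      · linarith [b2.1]
      · exact k
    obtain ⟨x', hx', c1, c2⟩ := h.dX u x1 (by linarith) b3 (by linarith)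
    obtain ⟨ε, hε, he⟩ := h.lc hx' hy0
    have := (he x' (y0 + ε / 2) (by simpa using hε) (by rw [abs_lt]; constructor <;> linarith)).2.2.2
    have hl := (hq.2 _ (mem_VVt.2 ⟨x', hx', by linarith, c2, rfl⟩)).1
    apply m3
    apply hl.2
    simp only
    rw [← this]
    exact mem_msk.2 ⟨hiN, u, v, b1, b2, by linarith, by linarith, b5⟩
  exact h.dem hX hY hm hu b3 hv (by linarith) b5

theorem Gr.minC {N : ℕ} {o : ℝ → ℝ → ℕ} {X Y : Set ℝ} (h : Gr N o X Y) {x0 x1 y0 y1 : ℝ} {m : ℕ} (hx0 : x0 ∈ X) (hx1 : x1 ∈ X) (hX : x0 < x1)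
    (hy0 : y0 ∈ Y) (hy1 : y1 ∈ Y) (hY : y0 < y1) {p : Ltr2} (hp : IsMin (RI N o X Y x0 x1 y0 y1 m).1 p) : p.1 = CC N o x0 y0 := by
  obtain ⟨y, hy, a1, a2, rfl⟩ := mem_VV.1 hp.1
  obtain ⟨-, ⟨y', hy', b1, b2, b3, b4⟩⟩ := h.tr.nearX hy0 (y0 := x0) (y1 := x1) ⟨Or.inr hx0, Or.inr hx1, hX⟩ (l := y0 - 1) (by linarith) hY
  rw [CC_tr, CC_tr] at b3
  have := (hp.2 _ (mem_VV.2 ⟨y', hy', b1, b2, rfl⟩)).1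
  simp only [b3] at this
  have l := h.bX x0 hx0
  exact this.antisymm (CC_mono l.1.le le_rfl l.2.le (h.bY y0 hy0).1.le a1.le (h.bY y hy).2.le)

theorem Gr.maxC {N : ℕ} {o : ℝ → ℝ → ℕ} {X Y : Set ℝ} (h : Gr N o X Y) {x0 x1 y0 y1 : ℝ} {m : ℕ} (hx0 : x0 ∈ X) (hx1 : x1 ∈ X) (hX : x0 < x1)
    (hy0 : y0 ∈ Y) (hy1 : y1 ∈ Y) (hY : y0 < y1) {p : Ltr2} (hp : IsMax (RI N o X Y x0 x1 y0 y1 m).1 p) : p.2 = CC N o x1 y1 := by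
  obtain ⟨y, hy, a1, a2, rfl⟩ := mem_VV.1 hp.1
  obtain ⟨⟨y', hy', b1, b2, b3, b4⟩, -⟩ := h.tr.nearX hy1 (y0 := x0) (y1 := x1) ⟨Or.inr hx0, Or.inr hx1, hX⟩ (r := y1 + 1) hY (by linarith)
  rw [CC_tr, CC_tr] at b4
  have := (hp.2 _ (mem_VV.2 ⟨y', hy', b1, b2, rfl⟩)).2
  simp only [b4] at this
  have l := h.bX x1 hx1
  exact (CC_mono l.1.le le_rfl l.2.le (h.bY y hy).1.le a2.le (h.bY y1 hy1).2.le : Le _ _).antisymm this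

theorem Gr.vstep {N : ℕ} {o : ℝ → ℝ → ℕ} {X Y : Set ℝ} (h : Gr N o X Y) (K : Item → Prop)
    (hK : ∀ j j1 j2, Rz N o X Y j → Rz N o X Y j1 → Rz N o X Y j2 → K j → (∃ k ∈ j.2.1, SplitV N j k j1 j2) → K j1 ∨ K j2)
    {x0 x1 y0 y1 u v : ℝ} {m : ℕ} (hx0 : x0 ∈ X) (hx1 : x1 ∈ X) (hX : x0 < x1)
    (hy0 : y0 ∈ Y) (hy1 : y1 ∈ Y) (hY : y0 < y1) (hm : MC o x0 x1 y0 y1 m u v) (hk : K (RI N o X Y x0 x1 y0 y1 m)) :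
    ∃ x0' x1' m', x0' ∈ X ∧ x1' ∈ X ∧ x0' < x1' ∧ MC o x0' x1' y0 y1 m' u v ∧ K (RI N o X Y x0' x1' y0 y1 m') ∧ x0 ≤ x0' ∧ x1' ≤ x1 ∧
      x1' - x0' ≤ 2 / 3 * (x1 - x0) := by
  have l0 := h.bX x0 hx0
  have l1 := h.bX x1 hx1
  obtain ⟨x, hx, g1, g2, g3⟩ : ∃ x ∈ X, x0 + (x1 - x0) / 3 < x ∧ x < x0 + 2 * (x1 - x0) / 3 ∧ u ≠ x := by
    obtain ⟨x, hx, g1, g2⟩ := h.dX (x0 + (x1 - x0) / 3) (x0 + 2 * (x1 - x0) / 3) (by linarith) (by linarith) (by linarith)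
    by_cases hu : u = x
    · obtain ⟨x', hx', g3, g4⟩ := h.dX (x0 + (x1 - x0) / 3) x (by linarith) (by linarith) (by linarith)
      exact ⟨x', hx', g3, by linarith, by rw [hu]; exact g4.ne'⟩
    · exact ⟨x, hx, g1, g2, hu⟩
  have bY : Bd Y y0 y1 := ⟨Or.inr hy0, Or.inr hy1, hY⟩
  have bX : Bd X x0 x1 := ⟨Or.inr hx0, Or.inr hx1, hX⟩
  obtain ⟨b1, b2, m1, m2, k1, k2, k3, -, -⟩ := h.vc bX bY hm hx (by linarith) (by linarith) g3
  rcases hK _ _ _ ⟨_, _, _, _, _, _, _, bX, bY, hm, rfl⟩ ⟨_, _, _, _, _, _, _, b1, bY, k1, rfl⟩ ⟨_, _, _, _, _, _, _, b2, bY, k2, rfl⟩ hk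
    ⟨_, mem_VVt.2 ⟨x, hx, by linarith, by linarith, rfl⟩, k3⟩ with kk | kk
  · exact ⟨x0, x, m1, hx0, hx, by linarith, k1, kk, le_rfl, by linarith, by linarith⟩
  · exact ⟨x, x1, m2, hx, hx1, by linarith, k2, kk, by linarith, le_rfl, by linarith⟩

end TL

namespace TL

structure QQ (N : ℕ) (o : ℝ → ℝ → ℕ) (X Y : Set ℝ) (K : Item → Prop) (u v : ℝ) (s : ℝ × ℝ × ℝ × ℝ × ℕ) : Prop where
  x0 : s.1 ∈ X
  x1 : s.2.1 ∈ X
  hx : s.1 < s.2.1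
  y0 : s.2.2.1 ∈ Y
  y1 : s.2.2.2.1 ∈ Y
  hy : s.2.2.1 < s.2.2.2.1
  hm : MC o s.1 s.2.1 s.2.2.1 s.2.2.2.1 s.2.2.2.2 u v
  hk : K (RI N o X Y s.1 s.2.1 s.2.2.1 s.2.2.2.1 s.2.2.2.2)

theorem Gr.step {N : ℕ} {o : ℝ → ℝ → ℕ} {X Y : Set ℝ} (h : Gr N o X Y) (K : Item → Prop)
    (hK : ∀ j j1 j2, Rz N o X Y j → Rz N o X Y j1 → Rz N o X Y j2 → K j → Spl N j j1 j2 → K j1 ∨ K j2) {u v : ℝ}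
    (s : ℝ × ℝ × ℝ × ℝ × ℕ) (hs : QQ N o X Y K u v s) : ∃ t, QQ N o X Y K u v t ∧ s.1 ≤ t.1 ∧ t.2.1 ≤ s.2.1 ∧ t.2.1 - t.1 ≤ 2 / 3 * (s.2.1 - s.1) ∧
      s.2.2.1 ≤ t.2.2.1 ∧ t.2.2.2.1 ≤ s.2.2.2.1 ∧ t.2.2.2.1 - t.2.2.1 ≤ 2 / 3 * (s.2.2.2.1 - s.2.2.1) := by
  obtain ⟨x0, x1, m, a1, a2, a3, a4, a5, a6, a7, a8⟩ := h.vstep K (fun j j1 j2 r r1 r2 k s => hK j j1 j2 r r1 r2 k (Or.inl s))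
    hs.x0 hs.x1 hs.hx hs.y0 hs.y1 hs.hy hs.hm hs.hk
  obtain ⟨y0, y1, m', b1, b2, b3, b4, b5, b6, b7, b8⟩ := h.tr.vstep (fun j => K (sw j)) (fun j j1 j2 r r1 r2 k s => hK (sw j) (sw j1) (sw j2) r.sw r1.sw r2.sw k (Or.inr s))
    hs.y0 hs.y1 hs.hy a1 a2 a3 a4.tr a5
  exact ⟨(x0, x1, y0, y1, m'), ⟨a1, a2, a3, b1, b2, b3, b4.tr, b5⟩, a6, a7, a8, b6, b7, b8⟩

theorem nest {a b : ℕ → ℝ} (ha : Monotone a) (hb : Antitone b) (hab : ∀ n, a n < b n) (hw : ∀ n, b (n + 1) - a (n + 1) ≤ 2 / 3 * (b n - a n)) :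
    ∃ z, (∀ n, a n ≤ z ∧ z ≤ b n) ∧ (∀ w, z < w → ∃ n, b n < w) ∧ (∀ w, w < z → ∃ n, w < a n) := by
  have hz := ha.ciSup_mem_iInter_Icc_of_antitone hb (fun n => (hab n).le)
  rw [Set.mem_iInter] at hz
  have hg : ∀ n, b n - a n ≤ (2 / 3) ^ n * (b 0 - a 0) := by
    intro n
    induction n with
    | zero => simp
    | succ n ih => rw [pow_succ]; linarith [hw n]
  have ht : ∀ ε > 0, ∃ n, b n - a n < ε := by
    intro ε hε
    obtain ⟨n, hn⟩ := exists_pow_lt_of_lt_one (div_pos hε (sub_pos.2 (hab 0))) (show (2 / 3 : ℝ) < 1 by norm_num)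
    rw [lt_div_iff₀ (sub_pos.2 (hab 0))] at hn
    exact ⟨n, lt_of_le_of_lt (hg n) hn⟩
  refine ⟨_, fun n => hz n, fun w hw => ?_, fun w hw => ?_⟩
  · obtain ⟨n, hn⟩ := ht _ (sub_pos.2 hw)
    exact ⟨n, by linarith [(hz n).1]⟩
  · obtain ⟨n, hn⟩ := ht _ (sub_pos.2 hw)
    exact ⟨n, by linarith [(hz n).2]⟩

theorem Gr.lim {N : ℕ} {o : ℝ → ℝ → ℕ} {X Y : Set ℝ} (h : Gr N o X Y) (K : Item → Prop)
    (hK : ∀ j j1 j2, Rz N o X Y j → Rz N o X Y j1 → Rz N o X Y j2 → K j → Spl N j j1 j2 → K j1 ∨ K j2) {u v : ℝ} {a b : Ltr}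
    (hB : ∀ j, Rz N o X Y j → K j → ¬ CloBase N a b j)
    (s : ℝ × ℝ × ℝ × ℝ × ℕ) (hs : QQ N o X Y K u v s) : False := by
  choose f hf using h.step K hK (u := u) (v := v)
  let S : ℕ → {s // QQ N o X Y K u v s} := fun n => Nat.rec ⟨s, hs⟩ (fun _ t => ⟨f t.1 t.2, (hf t.1 t.2).1⟩) n
  have hS : ∀ n, (S (n + 1)).1 = f (S n).1 (S n).2 := fun n => rfl
  let A : ℕ → ℝ := fun n => (S n).1.1
  let A' : ℕ → ℝ := fun n => (S n).1.2.1
  let C : ℕ → ℝ := fun n => (S n).1.2.2.1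
  let C' : ℕ → ℝ := fun n => (S n).1.2.2.2.1
  let M : ℕ → ℕ := fun n => (S n).1.2.2.2.2
  have hq : ∀ n, QQ N o X Y K u v (A n, A' n, C n, C' n, M n) := fun n => (S n).2
  obtain ⟨z, z1, z2, z3⟩ := nest (a := A) (b := A') (monotone_nat_of_le_succ fun n => (hf _ (S n).2).2.1)
    (antitone_nat_of_succ_le fun n => (hf _ (S n).2).2.2.1) (fun n => (hq n).hx) (fun n => (hf _ (S n).2).2.2.2.1)
  obtain ⟨w, w1, w2, w3⟩ := nest (a := C) (b := C') (monotone_nat_of_le_succ fun n => (hf _ (S n).2).2.2.2.2.1)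
    (antitone_nat_of_succ_le fun n => (hf _ (S n).2).2.2.2.2.2.1) (fun n => (hq n).hy) (fun n => (hf _ (S n).2).2.2.2.2.2.2)
  have key : ∀ n, a = CC N o (A n) (C n) ∧ b = CC N o (A' n) (C' n) ∧ ¬ ((M n = 0 ∧ Adm N a b) ∨ (M n ≠ 0 ∧ B N a b (M n))) := by
    intro n
    have hn := hq n
    have := hB _ ⟨_, _, _, _, _, _, _, ⟨Or.inr hn.x0, Or.inr hn.x1, hn.hx⟩, ⟨Or.inr hn.y0, Or.inr hn.y1, hn.hy⟩, hn.hm, rfl⟩ hn.hk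
    unfold CloBase at this
    rw [Classical.not_imp] at this
    obtain ⟨⟨⟨p, -, p1, p2⟩, ⟨q, -, q1, q2⟩⟩, r⟩ := this
    exact ⟨p2.symm.trans (h.minC hn.x0 hn.x1 hn.hx hn.y0 hn.y1 hn.hy p1), q2.symm.trans (h.maxC hn.x0 hn.x1 hn.hx hn.y0 hn.y1 hn.hy q1), r⟩
  have h0 := hq 0
  have bx0 := h.bX _ h0.x0
  have bx1 := h.bX _ h0.x1
  have by0 := h.bY _ h0.y0
  have by1 := h.bY _ h0.y1
  obtain ⟨ka, kb, -⟩ := key 0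
  have zz := z1 0
  have ww := w1 0
  simp only at bx0 bx1 by0 by1
  have Z0 : 0 < z := by linarith
  have Z1 : z < 1 := by linarith
  have W0 : 0 < w := by linarith
  have W1 : w < 1 := by linarith
  obtain ⟨e, he, le⟩ := h.lc h0.x0 h0.y0
  obtain ⟨e', he', le'⟩ := h.lc h0.x1 h0.y1
  have la := (le (A 0 - e / 2) (C 0 - e / 2) (by rw [abs_lt]; constructor <;> simp only <;> linarith) (by rw [abs_lt]; constructor <;> simp only <;> linarith)).2.2.2
  have lb := (le' (A' 0 + e' / 2) (C' 0 + e' / 2) (by rw [abs_lt]; constructor <;> simp only <;> linarith) (by rw [abs_lt]; constructor <;> simp only <;> linarith)).2.2.2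
  simp only at la lb
  rw [← ka] at la
  rw [← kb] at lb
  have olt : ∀ i, Mem i (o z w) → i < N + 1 := fun i hi => mem_lt (h.lb.lt z w Z0 Z1 W0 W1) hi
  have hBz : B N a b (o z w) := by
    refine h.lb.blk Z0 Z1 W0 W1 ?_ ?_ ?_ ?_
    · intro i hi
      rw [← la]
      exact mem_msk.2 ⟨olt i hi, z, w, ⟨Z0, Z1⟩, ⟨W0, W1⟩, by linarith, by linarith, hi⟩
    · intro i hi
      rw [← lb]
      exact mem_msk.2 ⟨olt i hi, z, w, ⟨Z0, Z1⟩, ⟨W0, W1⟩, by linarith, by linarith, hi⟩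
    · intro i hi
      constructor
      · intro hm
        rw [← lb] at hm
        obtain ⟨-, u', v', c1, c2, c3, c4, c5⟩ := mem_msk.1 hm
        exact ⟨u', v', c1, c2, by linarith, by linarith, c5⟩
      · rintro ⟨u', v', c1, c2, c3, c4, c5⟩
        obtain ⟨n1, d1⟩ := z2 _ c3
        obtain ⟨n2, d2⟩ := w2 _ c4
        have t1 : A' (max n1 n2) ≤ A' n1 := (antitone_nat_of_succ_le (f := A') fun n => (hf _ (S n).2).2.2.1) (le_max_left _ _)
        have t2 : C' (max n1 n2) ≤ C' n2 := (antitone_nat_of_succ_le (f := C') fun n => (hf _ (S n).2).2.2.2.2.2.1) (le_max_right _ _)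
        have k1 := h.bX _ (hq (max n1 n2)).x1
        have k2 := h.bY _ (hq (max n1 n2)).y1
        rw [(key (max n1 n2)).2.1, CC_in k1.1 k1.2 k2.1 k2.2]
        exact mem_msk.2 ⟨hi, u', v', c1, c2, by linarith, by linarith, c5⟩
    · intro i hi
      constructor
      · intro hm
        rw [← la] at hm
        obtain ⟨-, u', v', c1, c2, c3, c4, c5⟩ := mem_msk.1 hm
        exact ⟨u', v', c1, c2, by linarith, by linarith, c5⟩
      · rintro ⟨u', v', c1, c2, c3, c4, c5⟩
        obtain ⟨n1, d1⟩ := z3 _ c3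
        obtain ⟨n2, d2⟩ := w3 _ c4
        have t1 : A n1 ≤ A (max n1 n2) := (monotone_nat_of_le_succ (f := A) fun n => (hf _ (S n).2).2.1) (le_max_left _ _)
        have t2 : C n2 ≤ C (max n1 n2) := (monotone_nat_of_le_succ (f := C) fun n => (hf _ (S n).2).2.2.2.2.1) (le_max_right _ _)
        have k1 := h.bX _ (hq (max n1 n2)).x0
        have k2 := h.bY _ (hq (max n1 n2)).y0
        rw [(key (max n1 n2)).1, CC_in k1.1 k1.2 k2.1 k2.2]
        exact mem_msk.2 ⟨hi, u', v', c1, c2, by linarith, by linarith, c5⟩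
  by_cases hM : ∃ n, M n = 0
  · obtain ⟨n, hn⟩ := hM
    exact (key n).2.2 (Or.inl ⟨hn, hBz.adm⟩)
  · push Not at hM
    have hin : ∀ n, A n < u ∧ u < A' n ∧ C n < v ∧ v < C' n ∧ M n = o u v := by
      intro n
      rcases (hq n).hm with k | k
      · exact absurd k (hM n)
      · exact k
    have ez : z = u := by
      rcases lt_trichotomy z u with k | k | k
      · obtain ⟨n, hn⟩ := z2 u k; linarith [(hin n).2.1]
      · exact k
      · obtain ⟨n, hn⟩ := z3 u k; linarith [(hin n).1]
    have ew : w = v := by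
      rcases lt_trichotomy w v with k | k | k
      · obtain ⟨n, hn⟩ := w2 v k; linarith [(hin n).2.2.2.1]
      · exact k
      · obtain ⟨n, hn⟩ := w3 v k; linarith [(hin n).2.2.1]
    apply (key 0).2.2
    right
    refine ⟨hM 0, ?_⟩
    rw [(hin 0).2.2.2.2, ← ez, ← ew]
    exact hBz

theorem Gr.clo {N : ℕ} {o : ℝ → ℝ → ℕ} {X Y : Set ℝ} (h : Gr N o X Y) {it : Item} (hi : Rz N o X Y it) (hA : AllR N it) (a b : Ltr) :
    Clo N (Dl N o X Y) a b it := by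
  intro S hS hcl
  by_contra hit
  obtain ⟨x0, x1, y0, y1, m, u, v, hX, hY, hm, rfl⟩ := hi
  obtain ⟨n0, n1, n2⟩ := hX.bnd h.bX
  obtain ⟨n3, n4, n5⟩ := hY.bnd h.bY
  obtain ⟨x, hx, g1, g2⟩ := h.dX x0 x1 n0 n1 n2
  obtain ⟨y, hy, g3, g4⟩ := h.dY y0 y1 n3 n4 n5
  have r1 := hA.1 _ (mem_VV.2 ⟨y, hy, g3, g4, rfl⟩)
  have r2 := hA.2 _ (mem_VVt.2 ⟨x, hx, g1, g2, rfl⟩)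
  simp only at r1 r2
  have hx0 : x0 ∈ X := hX.1.resolve_left fun k => by
    rw [CC_bot (Or.inl k)] at r1; exact bot_nRl r1.1
  have hy0 : y0 ∈ Y := hY.1.resolve_left fun k => by
    rw [CC_bot (y := y0) (Or.inr k)] at r2; exact bot_nRl r2.1
  have hx1 : x1 ∈ X := hX.2.1.resolve_left fun k => by
    rw [CC_top (x := x1) (by linarith) (by linarith) (Or.inl k)] at r1; exact top_nRl r1.2
  have hy1 : y1 ∈ Y := hY.2.1.resolve_left fun k => by
    rw [CC_top (y := y1) (by linarith) (by linarith) (Or.inr k)] at r2; exact top_nRl r2.2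
  refine h.lim (fun j => j ∉ S) ?_ (a := a) (b := b) ?_ (x0, x1, y0, y1, m) ⟨hx0, hx1, n1, hy0, hy1, n4, hm, hit⟩
  · intro j j1 j2 r r1 r2 k s
    by_contra hh
    push Not at hh
    exact k (hcl j ((mem_Dl h).2 r) (Or.inr ⟨j1, hh.1, j2, hh.2, s⟩))
  · intro j r k hb
    exact k (hcl j ((mem_Dl h).2 r) (Or.inl hb))

theorem Gr.good {N : ℕ} {o : ℝ → ℝ → ℕ} {X Y : Set ℝ} (h : Gr N o X Y) : Good N (Dl N o X Y) where
  cutV it hi k hk := by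
    obtain ⟨j1, j2, r1, r2, s⟩ := h.cV it ((mem_Dl h).1 hi) k hk
    exact ⟨j1, (mem_Dl h).2 r1, j2, (mem_Dl h).2 r2, s⟩
  cutH it hi k hk := by
    obtain ⟨j1, j2, r1, r2, s⟩ := h.tr.cV (sw it) ((mem_Dl h).1 hi).sw k hk
    exact ⟨sw j1, (mem_Dl h).2 r1.sw, sw j2, (mem_Dl h).2 r2.sw, s⟩
  clo it hi hA p _ q _ _ _ := h.clo ((mem_Dl h).1 hi) hA _ _
  demF it hi p hp q hq _ mq hr _ i _ m1 m2 m3 := h.dF ((mem_Dl h).1 hi) hp mq hr m1 m2 m3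
  demP it hi p hp q hq _ mq hr _ i _ m1 m2 m3 := h.dP ((mem_Dl h).1 hi) hp mq hr m1 m2 m3
  insV it hi h0 := by
    obtain ⟨⟨k, hk, j1, j2, r1, r2, s⟩, ⟨k', hk', j1', j2', r1', r2', s'⟩⟩ := h.iV it ((mem_Dl h).1 hi) h0
    exact ⟨⟨k, hk, j1, (mem_Dl h).2 r1, j2, (mem_Dl h).2 r2, s⟩, ⟨k', hk', j1', (mem_Dl h).2 r1', j2', (mem_Dl h).2 r2', s'⟩⟩
  insH it hi h0 := by
    obtain ⟨⟨k, hk, j1, j2, r1, r2, s⟩, ⟨k', hk', j1', j2', r1', r2', s'⟩⟩ := h.tr.iV (sw it) ((mem_Dl h).1 hi).sw h0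
    exact ⟨⟨k, hk, sw j1, (mem_Dl h).2 r1.sw, sw j2, (mem_Dl h).2 r2.sw, s⟩, ⟨k', hk', sw j1', (mem_Dl h).2 r1'.sw, sw j2', (mem_Dl h).2 r2'.sw, s'⟩⟩

theorem nodup_ltr2s (N : ℕ) : (ltr2s N).Nodup :=
  ((List.nodup_range).product (List.nodup_range)).product ((List.nodup_range).product (List.nodup_range))

theorem Gr.start {N : ℕ} {o : ℝ → ℝ → ℕ} {X Y : Set ℝ} (h : Gr N o X Y) : VV N o Y 0 1 0 1 = [(bot N, top N)] := by
  have hm : ∀ p, p ∈ VV N o Y 0 1 0 1 ↔ p = (bot N, top N) := by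
    intro p
    rw [mem_VV]
    constructor
    · rintro ⟨y, hy, a, b, rfl⟩
      rw [CC_bot (Or.inl rfl), CC_top one_pos a (Or.inl rfl)]
    · rintro rfl
      obtain ⟨y, hy, a, b⟩ := h.dY 0 1 le_rfl one_pos le_rfl
      exact ⟨y, hy, a, b, by rw [CC_bot (Or.inl rfl), CC_top one_pos a (Or.inl rfl)]⟩
  have hn : (VV N o Y 0 1 0 1).Nodup := (nodup_ltr2s N).filter _
  apply List.perm_singleton.1
  rw [List.perm_ext_iff_of_nodup hn (List.nodup_singleton _)]
  intro p; rw [hm, List.mem_singleton]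

theorem cert_of_lab {N c : ℕ} {o : ℝ → ℝ → ℕ} (h : Lab N c o) : Cert N c := by
  obtain ⟨X, Y, g⟩ := gr_ex h.lb
  obtain ⟨x, y, x0, x1, y0, y1, hm⟩ := h.tgt
  refine ⟨Dl N o X Y, (mem_subs _ _).2 List.filter_sublist, g.good, RI N o X Y 0 1 0 1 (o x y), ?_, g.start, g.tr.start, hm⟩
  exact (mem_Dl g).2 ⟨0, 1, 0, 1, _, x, y, ⟨Or.inl rfl, Or.inl rfl, one_pos⟩, ⟨Or.inl rfl, Or.inl rfl, one_pos⟩, Or.inr ⟨x0, x1, y0, y1, rfl⟩, rfl⟩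

theorem cert_iff {N c : ℕ} : Cert N c ↔ ∃ o, Lab N c o := ⟨lab_of_cert, fun ⟨_, h⟩ => cert_of_lab h⟩

end TL

namespace TL

theorem unpair_dec {n : ℕ} (h : n.unpair.1 ≠ 0) : n.unpair.2 < n := by
  have e := Nat.pair_unpair n
  set t := n.unpair.1
  set k := n.unpair.2
  rw [← e]
  unfold Nat.pair
  split_ifs
  · nlinarith [Nat.pos_of_ne_zero h]
  · nlinarith [Nat.pos_of_ne_zero h]

def dec (n : ℕ) : Formula :=
  if h : n.unpair.1 = 0 then Formula.var n.unpair.2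
  else
    have h1 : n.unpair.2 < n := unpair_dec h
    have h2 : n.unpair.2.unpair.1 < n := lt_of_le_of_lt (Nat.unpair_left_le _) h1
    have h3 : n.unpair.2.unpair.2 < n := lt_of_le_of_lt (Nat.unpair_right_le _) h1
    if n.unpair.1 = 1 then Formula.neg (dec n.unpair.2)
    else if n.unpair.1 = 2 then Formula.or (dec n.unpair.2.unpair.1) (dec n.unpair.2.unpair.2)
    else if n.unpair.1 = 3 then Formula.F (dec n.unpair.2)
    else Formula.P (dec n.unpair.2)
termination_by n

theorem dec_enc (φ : Formula) : dec φ.enc = φ := by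
  induction φ with
  | var n => rw [dec]; simp [Formula.enc]
  | neg φ ih => rw [dec]; simp [Formula.enc, ih]
  | or φ ψ ih ih' => rw [dec]; simp [Formula.enc, ih, ih']
  | F φ ih => rw [dec]; simp [Formula.enc, ih]
  | P φ ih => rw [dec]; simp [Formula.enc, ih]

theorem g_ex : ∃ g l : ℝ → ℝ, StrictMono g ∧ (∀ x, 0 < g x ∧ g x < 1) ∧ ∀ x, 0 < x → x < 1 → g (l x) = x := by
  refine ⟨Real.sigmoid, fun x => if h : 0 < x ∧ x < 1 then Classical.choose (show ∃ y, Real.sigmoid y = x from ?_) else 0, Real.sigmoid_strictMono, fun x => ⟨Real.sigmoid_pos x, Real.sigmoid_lt_one x⟩, fun x h0 h1 => ?_⟩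
  · have : x ∈ Set.range Real.sigmoid := by rw [Real.range_sigmoid]; exact h
    exact this
  · simp only [h0, h1, and_self, dif_pos]
    generalize_proofs a
    exact Classical.choose_spec a

theorem lab_of_sat {c : ℕ} {v : ℕ → Set (ℝ × ℝ)} {w : ℝ × ℝ} (h : Sat sltRefl v w (dec c)) : ∃ o, Lab (c + 1) c o := by
  obtain ⟨g, l, hg, hb, hl⟩ := g_ex
  have hlg : ∀ x, l (g x) = x := fun x => hg.injective (hl _ (hb x).1 (hb x).2)
  have hlm : ∀ x y, 0 < x → x < y → y < 1 → l x < l y := by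
    intro x y h0 h1 h2
    rw [← hg.lt_iff_lt, hl x h0 (by linarith), hl y (by linarith) h2]; exact h1
  let o : ℝ → ℝ → ℕ := fun x y => msk (c + 1) (fun i => i = c + 1 ∨ Sat sltRefl v (l x, l y) (dec i))
  have ho : ∀ x y i, i < c + 1 → (Mem i (o x y) ↔ Sat sltRefl v (l x, l y) (dec i)) := by
    intro x y i hi
    rw [mem_msk]
    constructor
    · rintro ⟨_, k | k⟩
      · omega
      · exact k
    · exact fun k => ⟨by omega, Or.inr k⟩
  refine ⟨o, fun x y _ _ _ _ => msk_lt _ _, fun x y _ _ _ _ => mem_msk.2 ⟨by omega, Or.inl rfl⟩, ?_, ?_⟩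
  · intro x y x0 x1 y0 y1 i hi
    have hk : i.unpair.2 < c + 1 := lt_of_le_of_lt (Nat.unpair_right_le _) hi
    have hk1 : i.unpair.2.unpair.1 < c + 1 := lt_of_le_of_lt (Nat.unpair_left_le _) hk
    have hk2 : i.unpair.2.unpair.2 < c + 1 := lt_of_le_of_lt (Nat.unpair_right_le _) hk
    refine ⟨fun e => ?_, fun e => ?_, fun e => ?_, fun e => ?_⟩
    · rw [ho _ _ _ hi, ho _ _ _ hk, dec]; simp [e, Sat]
    · rw [ho _ _ _ hi, ho _ _ _ hk1, ho _ _ _ hk2, dec]; simp [e, Sat]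
    · simp only [ho _ _ _ hk]
      rw [ho _ _ _ hi, dec]
      simp only [e]
      constructor
      · rintro ⟨u, rfl | hu, hs⟩
        · exact Or.inl hs
        · right
          refine ⟨g u.1, g u.2, ?_, (hb _).2, ?_, (hb _).2, by rw [hlg, hlg]; exact hs⟩
          · rw [← hl x x0 x1]; exact hg hu.1
          · rw [← hl y y0 y1]; exact hg hu.2
      · rintro (hs | ⟨a, b, a1, a2, b1, b2, hs⟩)
        · exact ⟨_, Or.inl rfl, hs⟩
        · exact ⟨(l a, l b), Or.inr ⟨hlm _ _ x0 a1 a2, hlm _ _ y0 b1 b2⟩, hs⟩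
    · simp only [ho _ _ _ hk]
      rw [ho _ _ _ hi, dec]
      simp only [e]
      constructor
      · rintro ⟨u, rfl | hu, hs⟩
        · exact Or.inl hs
        · right
          refine ⟨g u.1, g u.2, (hb _).1, ?_, (hb _).1, ?_, by rw [hlg, hlg]; exact hs⟩
          · rw [← hl x x0 x1]; exact hg hu.1
          · rw [← hl y y0 y1]; exact hg hu.2
      · rintro (hs | ⟨a, b, a1, a2, b1, b2, hs⟩)
        · exact ⟨_, Or.inl rfl, hs⟩
        · exact ⟨(l a, l b), Or.inr ⟨hlm _ _ a1 a2 x1, hlm _ _ b1 b2 y1⟩, hs⟩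
  · refine ⟨g w.1, g w.2, (hb _).1, (hb _).2, (hb _).1, (hb _).2, ?_⟩
    rw [ho _ _ _ (by omega), hlg, hlg]; exact h

theorem sat_of_lab {N : ℕ} {φ : Formula} (hN : φ.enc < N) {o : ℝ → ℝ → ℕ} (h : Lab N φ.enc o) : ∃ v w, Sat sltRefl v w φ := by
  obtain ⟨g, l, hg, hb, hl⟩ := g_ex
  have key : ∀ ψ : Formula, ψ.enc < N → ∀ z : ℝ × ℝ, Sat sltRefl (fun n => {z | Mem (Nat.pair 0 n) (o (g z.1) (g z.2))}) z ψ ↔ Mem ψ.enc (o (g z.1) (g z.2)) := by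
    intro ψ
    induction ψ with
    | var n => intro _ z; exact Iff.rfl
    | neg ψ ih =>
      intro hn z
      obtain ⟨c1, -⟩ := h.cons _ _ (hb z.1).1 (hb z.1).2 (hb z.2).1 (hb z.2).2 _ hn
      have : ψ.enc < N := lt_of_le_of_lt (Nat.right_le_pair 1 _) hn
      rw [c1 (by simp [Formula.enc])]
      simp only [Sat, ih this, Formula.enc, Nat.unpair_pair]
    | or ψ χ ih ih' =>
      intro hn z
      obtain ⟨-, c1, -⟩ := h.cons _ _ (hb z.1).1 (hb z.1).2 (hb z.2).1 (hb z.2).2 _ hn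
      have t : Nat.pair ψ.enc χ.enc < N := lt_of_le_of_lt (Nat.right_le_pair 2 _) hn
      have t1 : ψ.enc < N := lt_of_le_of_lt (Nat.left_le_pair _ _) t
      have t2 : χ.enc < N := lt_of_le_of_lt (Nat.right_le_pair _ _) t
      rw [c1 (by simp [Formula.enc])]
      simp only [Sat, ih t1, ih' t2, Formula.enc, Nat.unpair_pair]
    | F ψ ih =>
      intro hn z
      obtain ⟨-, -, c1, -⟩ := h.cons _ _ (hb z.1).1 (hb z.1).2 (hb z.2).1 (hb z.2).2 _ hn
      have t : ψ.enc < N := lt_of_le_of_lt (Nat.right_le_pair 3 _) hn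
      rw [c1 (by simp [Formula.enc])]
      simp only [Sat, ih t, Formula.enc, Nat.unpair_pair]
      constructor
      · rintro ⟨u, rfl | hu, hs⟩
        · exact Or.inl hs
        · exact Or.inr ⟨_, _, hg hu.1, (hb _).2, hg hu.2, (hb _).2, hs⟩
      · rintro (hs | ⟨a, b, a1, a2, b1, b2, hs⟩)
        · exact ⟨_, Or.inl rfl, hs⟩
        · have ea := hl a (by linarith [hb z.1]) a2
          have eb := hl b (by linarith [hb z.2]) b2
          refine ⟨(l a, l b), Or.inr ⟨?_, ?_⟩, ?_⟩
          · rw [← hg.lt_iff_lt]; simp only; rw [ea]; exact a1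
          · rw [← hg.lt_iff_lt]; simp only; rw [eb]; exact b1
          · simp only; rw [ea, eb]; exact hs
    | P ψ ih =>
      intro hn z
      obtain ⟨-, -, -, c1⟩ := h.cons _ _ (hb z.1).1 (hb z.1).2 (hb z.2).1 (hb z.2).2 _ hn
      have t : ψ.enc < N := lt_of_le_of_lt (Nat.right_le_pair 4 _) hn
      rw [c1 (by simp [Formula.enc])]
      simp only [Sat, ih t, Formula.enc, Nat.unpair_pair]
      constructor
      · rintro ⟨u, rfl | hu, hs⟩
        · exact Or.inl hs
        · exact Or.inr ⟨_, _, (hb _).1, hg hu.1, (hb _).1, hg hu.2, hs⟩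
      · rintro (hs | ⟨a, b, a1, a2, b1, b2, hs⟩)
        · exact ⟨_, Or.inl rfl, hs⟩
        · have ea := hl a a1 (by linarith [hb z.1])
          have eb := hl b b1 (by linarith [hb z.2])
          refine ⟨(l a, l b), Or.inr ⟨?_, ?_⟩, ?_⟩
          · rw [← hg.lt_iff_lt]; simp only; rw [ea]; exact a2
          · rw [← hg.lt_iff_lt]; simp only; rw [eb]; exact b2
          · simp only; rw [ea, eb]; exact hs
  obtain ⟨x, y, x0, x1, y0, y1, hm⟩ := h.tgt
  refine ⟨_, (l x, l y), (key φ hN (l x, l y)).2 ?_⟩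
  simp only
  rw [hl x x0 x1, hl y y0 y1]; exact hm

theorem valid_iff (φ : Formula) : Valid sltRefl φ ↔ ¬ Cert (Nat.pair 1 φ.enc + 1) (Nat.pair 1 φ.enc) := by
  rw [cert_iff]
  constructor
  · rintro hv ⟨o, h⟩
    obtain ⟨v, w, hs⟩ := sat_of_lab (φ := φ.neg) (N := Nat.pair 1 φ.enc + 1) (Nat.lt_succ_self _) h
    exact hs (hv v w)
  · intro hn v w
    by_contra hs
    apply hn
    have : Sat sltRefl v w (dec φ.neg.enc) := by rw [dec_enc]; exact hs
    exact lab_of_sat this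

end TL

namespace TL

attribute [local fun_prop] Primrec
attribute [local fun_prop] Primrec.id Primrec.const Primrec.comp Primrec.pair Primrec.fst Primrec.snd

section Comb
variable {α β γ : Type} [Primcodable α] [Primcodable β] [Primcodable γ]

theorem pAll {l : α → List β} {p : α → β → Prop} (hp : PrimrecPred fun x : α × β => p x.1 x.2) (hl : Primrec l) :
    PrimrecPred fun a => ∀ b ∈ l a, p a b := by
  have : PrimrecRel fun (b : β) (a : α) => p a b := PrimrecPred.comp hp (Primrec.snd.pair Primrec.fst)
  exact this.forall_mem_list.comp hl Primrec.id

theorem pEx {l : α → List β} {p : α → β → Prop} (hp : PrimrecPred fun x : α × β => p x.1 x.2) (hl : Primrec l) :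
    PrimrecPred fun a => ∃ b ∈ l a, p a b := by
  have : PrimrecRel fun (b : β) (a : α) => p a b := PrimrecPred.comp hp (Primrec.snd.pair Primrec.fst)
  exact this.exists_mem_list.comp hl Primrec.id

theorem pImp {p q : α → Prop} (hp : PrimrecPred p) (hq : PrimrecPred q) : PrimrecPred fun a => p a → q a :=
  (hp.not.or hq).of_eq fun _ => imp_iff_not_or.symm

theorem pIff {p q : α → Prop} (hp : PrimrecPred p) (hq : PrimrecPred q) : PrimrecPred fun a => p a ↔ q a :=
  ((pImp hp hq).and (pImp hq hp)).of_eq fun _ => iff_iff_implies_and_implies.symm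

theorem pNot {p : α → Prop} (hp : PrimrecPred p) : PrimrecPred fun a => ¬ p a := hp.not
theorem pAnd {p q : α → Prop} (hp : PrimrecPred p) (hq : PrimrecPred q) : PrimrecPred fun a => p a ∧ q a := hp.and hq
theorem pOr {p q : α → Prop} (hp : PrimrecPred p) (hq : PrimrecPred q) : PrimrecPred fun a => p a ∨ q a := hp.or hq

theorem pEq {f g : α → β} (hf : Primrec f) (hg : Primrec g) : PrimrecPred fun a => f a = g a := by
  classical
  exact Primrec.eq.comp hf hg

theorem pNe {f g : α → β} (hf : Primrec f) (hg : Primrec g) : PrimrecPred fun a => f a ≠ g a := (pEq hf hg).not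

theorem pIn {f : α → β} {l : α → List β} (hf : Primrec f) (hl : Primrec l) : PrimrecPred fun a => f a ∈ l a :=
  (pEx (p := fun a b => b = f a) (pEq Primrec.snd (hf.comp Primrec.fst)) hl).of_eq fun a => by simp

theorem pLt {f g : α → ℕ} (hf : Primrec f) (hg : Primrec g) : PrimrecPred fun a => f a < g a := Primrec.nat_lt.comp hf hg

theorem rPow {f : α → ℕ} (hf : Primrec f) : Primrec fun a => 2 ^ f a := by
  have : Primrec fun n : ℕ => 2 ^ n :=
    (Primrec.nat_rec₁ 1 (Primrec.nat_mul.comp₂ Primrec₂.right (Primrec₂.const 2))).of_eq fun n => by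
      induction n with
      | zero => rfl
      | succ n ih => simp only [ih, pow_succ]
  exact this.comp hf

theorem rSucc {f : α → ℕ} (hf : Primrec f) : Primrec fun a => f a + 1 := Primrec.succ.comp hf

theorem pMem {f g : α → ℕ} (hf : Primrec f) (hg : Primrec g) : PrimrecPred fun a => Mem (f a) (g a) :=
  (pEq (Primrec.nat_mod.comp (Primrec.nat_div.comp hg (rPow hf)) (Primrec.const 2)) (Primrec.const 1)).of_eq fun a => by
    unfold Mem; rw [Nat.testBit_eq_decide_div_mod_eq, decide_eq_true_eq]

theorem mem_lt_self {i n : ℕ} (h : Mem i n) : i < n := lt_of_lt_of_le Nat.lt_two_pow_self (Nat.ge_two_pow_of_testBit h)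

theorem rRange {f : α → ℕ} (hf : Primrec f) : Primrec fun a => List.range (f a) := Primrec.list_range.comp hf

theorem pSub {f g : α → ℕ} (hf : Primrec f) (hg : Primrec g) : PrimrecPred fun a => ∀ i, Mem i (f a) → Mem i (g a) :=
  (pAll (l := fun a => List.range (f a)) (p := fun a i => Mem i (f a) → Mem i (g a)) (pImp (pMem (by fun_prop) (by fun_prop)) (pMem (by fun_prop) (by fun_prop))) (rRange hf)).of_eq fun a =>
    ⟨fun h i hi => h i (List.mem_range.2 (mem_lt_self hi)) hi, fun h i _ => h i⟩

theorem pLe {f g : α → Ltr} (hf : Primrec f) (hg : Primrec g) : PrimrecPred fun a => Le (f a) (g a) :=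
  pAnd (pSub (by fun_prop) (by fun_prop)) (pSub (by fun_prop) (by fun_prop))

theorem pL2 {f g : α → Ltr2} (hf : Primrec f) (hg : Primrec g) : PrimrecPred fun a => L2 (f a) (g a) :=
  pAnd (pLe (by fun_prop) (by fun_prop)) (pLe (by fun_prop) (by fun_prop))

theorem pL3 {f g : α → Tri} (hf : Primrec f) (hg : Primrec g) : PrimrecPred fun a => L3 (f a) (g a) :=
  pAnd (pLe (by fun_prop) (by fun_prop)) (pAnd (pLe (by fun_prop) (by fun_prop)) (pLe (by fun_prop) (by fun_prop)))

theorem pRl {n : α → ℕ} {f : α → Ltr} (hn : Primrec n) (hf : Primrec f) : PrimrecPred fun a => Rl (n a) (f a) :=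
  pAnd (pMem (by fun_prop) (by fun_prop)) (pMem (by fun_prop) (by fun_prop))

theorem rUn {f : α → ℕ} (hf : Primrec f) : Primrec fun a => (f a).unpair := Primrec.unpair.comp hf

attribute [local fun_prop] rUn rPow rSucc rRange

theorem pB {n : α → ℕ} {f g : α → Ltr} {o : α → ℕ} (hn : Primrec n) (hf : Primrec f) (hg : Primrec g) (ho : Primrec o) :
    PrimrecPred fun a => B (n a) (f a) (g a) (o a) := by
  have h1 : PrimrecPred fun a => ∀ i, Mem i (o a) → Mem i (f a).1 ∧ Mem i (g a).2 :=
    ((pSub (f := o) (g := fun a => (f a).1) (by fun_prop) (by fun_prop)).and (pSub (f := o) (g := fun a => (g a).2) (by fun_prop) (by fun_prop))).of_eq fun a =>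
      ⟨fun h i hi => ⟨h.1 i hi, h.2 i hi⟩, fun h => ⟨fun i hi => (h i hi).1, fun i hi => (h i hi).2⟩⟩
  have h2 : PrimrecPred fun a => ∀ i ∈ List.range (n a), ConsI i (o a) (fun k => Mem k (g a).1 ∨ Mem k (o a)) (fun k => Mem k (f a).2 ∨ Mem k (o a)) := by
    refine pAll ?_ (by fun_prop)
    unfold ConsI
    refine pAnd (pImp (pEq (by fun_prop) (by fun_prop)) (pIff (pMem (by fun_prop) (by fun_prop)) (pNot (pMem (by fun_prop) (by fun_prop))))) ?_
    refine pAnd (pImp (pEq (by fun_prop) (by fun_prop)) (pIff (pMem (by fun_prop) (by fun_prop)) (pOr (pMem (by fun_prop) (by fun_prop)) (pMem (by fun_prop) (by fun_prop))))) ?_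
    refine pAnd (pImp (pEq (by fun_prop) (by fun_prop)) (pIff (pMem (by fun_prop) (by fun_prop)) (pOr (pMem (by fun_prop) (by fun_prop)) (pMem (by fun_prop) (by fun_prop))))) ?_
    exact pImp (pEq (by fun_prop) (by fun_prop)) (pIff (pMem (by fun_prop) (by fun_prop)) (pOr (pMem (by fun_prop) (by fun_prop)) (pMem (by fun_prop) (by fun_prop))))
  refine pAnd (pLt (by fun_prop) (by fun_prop)) (pAnd (pMem (by fun_prop) (by fun_prop)) (pAnd h1 (h2.of_eq fun a => ?_)))
  simp only [List.mem_range]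

theorem pAdm {n : α → ℕ} {f g : α → Ltr} (hn : Primrec n) (hf : Primrec f) (hg : Primrec g) :
    PrimrecPred fun a => Adm (n a) (f a) (g a) :=
  (pEx (l := fun a => List.range (2 ^ (n a + 1))) (p := fun a o => B (n a) (f a) (g a) o) (pB (by fun_prop) (by fun_prop) (by fun_prop) (by fun_prop)) (by fun_prop)).of_eq fun a => by
    unfold Adm; simp only [List.mem_range]

theorem pIsMin {l : α → List Ltr2} {f : α → Ltr2} (hl : Primrec l) (hf : Primrec f) : PrimrecPred fun a => IsMin (l a) (f a) :=
  pAnd (pIn (by fun_prop) (by fun_prop)) (pAll (pL2 (by fun_prop) (by fun_prop)) (by fun_prop))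

theorem pIsMax {l : α → List Ltr2} {f : α → Ltr2} (hl : Primrec l) (hf : Primrec f) : PrimrecPred fun a => IsMax (l a) (f a) :=
  pAnd (pIn (by fun_prop) (by fun_prop)) (pAll (pL2 (by fun_prop) (by fun_prop)) (by fun_prop))

theorem pRng {it : α → Item} {f g : α → Ltr} (hi : Primrec it) (hf : Primrec f) (hg : Primrec g) : PrimrecPred fun a => Rng (it a) (f a) (g a) :=
  pAnd (pEx (pAnd (pIsMin (by fun_prop) (by fun_prop)) (pEq (by fun_prop) (by fun_prop))) (by fun_prop))
    (pEx (pAnd (pIsMax (by fun_prop) (by fun_prop)) (pEq (by fun_prop) (by fun_prop))) (by fun_prop))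

theorem rSw {it : α → Item} (hi : Primrec it) : Primrec fun a => sw (it a) := by
  unfold sw; fun_prop

theorem rSubs {l : α → List β} (hl : Primrec l) : Primrec fun a => subs (l a) := by
  unfold subs
  refine Primrec.list_foldr (h := fun _ p => p.2 ++ p.2.map (fun s => p.1 :: s)) hl (Primrec.const [[]]) ?_
  refine Primrec.list_append.comp (by fun_prop) (Primrec.list_map (by fun_prop) ?_)
  exact Primrec.list_cons.comp (by fun_prop) (by fun_prop)

theorem rProd {l : α → List β} {k : α → List γ} (hl : Primrec l) (hk : Primrec k) : Primrec fun a => (l a).product (k a) := by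
  unfold List.product
  refine Primrec.list_flatMap hl (Primrec.list_map (by fun_prop) ?_)
  exact Primrec.pair (by fun_prop) (by fun_prop)

attribute [local fun_prop] rSw rSubs rProd

theorem rLtrs {n : α → ℕ} (hn : Primrec n) : Primrec fun a => ltrs (n a) := by unfold ltrs; fun_prop
attribute [local fun_prop] rLtrs
theorem rLtr2s {n : α → ℕ} (hn : Primrec n) : Primrec fun a => ltr2s (n a) := by unfold ltr2s; fun_prop
attribute [local fun_prop] rLtr2s
theorem rTris {n : α → ℕ} (hn : Primrec n) : Primrec fun a => tris (n a) := by unfold tris; fun_prop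
theorem rItems {n : α → ℕ} (hn : Primrec n) : Primrec fun a => items (n a) := by unfold items; fun_prop
attribute [local fun_prop] rTris rItems

end Comb
end TL

namespace TL

attribute [local fun_prop] Primrec
attribute [local fun_prop] Primrec.id Primrec.const Primrec.comp Primrec.pair Primrec.fst Primrec.snd
attribute [local fun_prop] rUn rPow rSucc rRange rSw rSubs rProd rLtrs rLtr2s rTris rItems

section Comb2
variable {α : Type} [Primcodable α]

theorem pSplitT {N : α → ℕ} {T : α → List Tri} {it : α → Item} {h : α → Ltr2} {it1 : α → Item} {it2 : α → Item}
    (hN : Primrec N) (hT : Primrec T) (hit : Primrec it) (hh : Primrec h) (hit1 : Primrec it1) (hit2 : Primrec it2) : PrimrecPred fun x => SplitT (N x) (T x) (it x) (h x) (it1 x) (it2 x) := by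
  unfold SplitT
  repeat' first
    | with_reducible refine pL2 ?_ ?_
    | with_reducible refine pL3 ?_ ?_
    | with_reducible refine pLe ?_ ?_
    | with_reducible refine pRl ?_ ?_
    | with_reducible refine pMem ?_ ?_
    | with_reducible refine pAdm ?_ ?_ ?_
    | with_reducible refine pB ?_ ?_ ?_ ?_
    | with_reducible refine pRng ?_ ?_ ?_
    | with_reducible refine pIsMin ?_ ?_
    | with_reducible refine pIsMax ?_ ?_
    | with_reducible refine pIn ?_ ?_
    | with_reducible refine pNe ?_ ?_
    | with_reducible refine pEq ?_ ?_
    | with_reducible refine pAll ?_ ?_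
    | with_reducible refine pEx ?_ ?_
    | with_reducible refine pNot ?_
    | with_reducible refine pAnd ?_ ?_
    | with_reducible refine pOr ?_ ?_
    | with_reducible refine pImp ?_ ?_
    | fun_prop

theorem pSplitV {N : α → ℕ} {it : α → Item} {h : α → Ltr2} {it1 : α → Item} {it2 : α → Item}
    (hN : Primrec N) (hit : Primrec it) (hh : Primrec h) (hit1 : Primrec it1) (hit2 : Primrec it2) : PrimrecPred fun x => SplitV (N x) (it x) (h x) (it1 x) (it2 x) := by
  unfold SplitV
  repeat' first
    | with_reducible refine pSplitT ?_ ?_ ?_ ?_ ?_ ?_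
    | with_reducible refine pL2 ?_ ?_
    | with_reducible refine pL3 ?_ ?_
    | with_reducible refine pLe ?_ ?_
    | with_reducible refine pRl ?_ ?_
    | with_reducible refine pMem ?_ ?_
    | with_reducible refine pAdm ?_ ?_ ?_
    | with_reducible refine pB ?_ ?_ ?_ ?_
    | with_reducible refine pRng ?_ ?_ ?_
    | with_reducible refine pIsMin ?_ ?_
    | with_reducible refine pIsMax ?_ ?_
    | with_reducible refine pIn ?_ ?_
    | with_reducible refine pNe ?_ ?_
    | with_reducible refine pEq ?_ ?_
    | with_reducible refine pAll ?_ ?_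
    | with_reducible refine pEx ?_ ?_
    | with_reducible refine pNot ?_
    | with_reducible refine pAnd ?_ ?_
    | with_reducible refine pOr ?_ ?_
    | with_reducible refine pImp ?_ ?_
    | fun_prop

theorem pSplitH {N : α → ℕ} {it : α → Item} {h : α → Ltr2} {it1 : α → Item} {it2 : α → Item}
    (hN : Primrec N) (hit : Primrec it) (hh : Primrec h) (hit1 : Primrec it1) (hit2 : Primrec it2) : PrimrecPred fun x => SplitH (N x) (it x) (h x) (it1 x) (it2 x) := by
  unfold SplitH
  repeat' first
    | with_reducible refine pSplitT ?_ ?_ ?_ ?_ ?_ ?_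
    | with_reducible refine pSplitV ?_ ?_ ?_ ?_ ?_
    | with_reducible refine pL2 ?_ ?_
    | with_reducible refine pL3 ?_ ?_
    | with_reducible refine pLe ?_ ?_
    | with_reducible refine pRl ?_ ?_
    | with_reducible refine pMem ?_ ?_
    | with_reducible refine pAdm ?_ ?_ ?_
    | with_reducible refine pB ?_ ?_ ?_ ?_
    | with_reducible refine pRng ?_ ?_ ?_
    | with_reducible refine pIsMin ?_ ?_
    | with_reducible refine pIsMax ?_ ?_
    | with_reducible refine pIn ?_ ?_
    | with_reducible refine pNe ?_ ?_
    | with_reducible refine pEq ?_ ?_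
    | with_reducible refine pAll ?_ ?_
    | with_reducible refine pEx ?_ ?_
    | with_reducible refine pNot ?_
    | with_reducible refine pAnd ?_ ?_
    | with_reducible refine pOr ?_ ?_
    | with_reducible refine pImp ?_ ?_
    | fun_prop

theorem pSpl {N : α → ℕ} {it : α → Item} {it1 : α → Item} {it2 : α → Item}
    (hN : Primrec N) (hit : Primrec it) (hit1 : Primrec it1) (hit2 : Primrec it2) : PrimrecPred fun x => Spl (N x) (it x) (it1 x) (it2 x) := by
  unfold Spl
  repeat' first
    | with_reducible refine pSplitT ?_ ?_ ?_ ?_ ?_ ?_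
    | with_reducible refine pSplitV ?_ ?_ ?_ ?_ ?_
    | with_reducible refine pSplitH ?_ ?_ ?_ ?_ ?_
    | with_reducible refine pL2 ?_ ?_
    | with_reducible refine pL3 ?_ ?_
    | with_reducible refine pLe ?_ ?_
    | with_reducible refine pRl ?_ ?_
    | with_reducible refine pMem ?_ ?_
    | with_reducible refine pAdm ?_ ?_ ?_
    | with_reducible refine pB ?_ ?_ ?_ ?_
    | with_reducible refine pRng ?_ ?_ ?_
    | with_reducible refine pIsMin ?_ ?_
    | with_reducible refine pIsMax ?_ ?_
    | with_reducible refine pIn ?_ ?_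
    | with_reducible refine pNe ?_ ?_
    | with_reducible refine pEq ?_ ?_
    | with_reducible refine pAll ?_ ?_
    | with_reducible refine pEx ?_ ?_
    | with_reducible refine pNot ?_
    | with_reducible refine pAnd ?_ ?_
    | with_reducible refine pOr ?_ ?_
    | with_reducible refine pImp ?_ ?_
    | fun_prop

theorem pCloBase {N : α → ℕ} {a : α → Ltr} {b : α → Ltr} {it : α → Item}
    (hN : Primrec N) (ha : Primrec a) (hb : Primrec b) (hit : Primrec it) : PrimrecPred fun x => CloBase (N x) (a x) (b x) (it x) := by
  unfold CloBase
  repeat' first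
    | with_reducible refine pSplitT ?_ ?_ ?_ ?_ ?_ ?_
    | with_reducible refine pSplitV ?_ ?_ ?_ ?_ ?_
    | with_reducible refine pSplitH ?_ ?_ ?_ ?_ ?_
    | with_reducible refine pSpl ?_ ?_ ?_ ?_
    | with_reducible refine pL2 ?_ ?_
    | with_reducible refine pL3 ?_ ?_
    | with_reducible refine pLe ?_ ?_
    | with_reducible refine pRl ?_ ?_
    | with_reducible refine pMem ?_ ?_
    | with_reducible refine pAdm ?_ ?_ ?_
    | with_reducible refine pB ?_ ?_ ?_ ?_
    | with_reducible refine pRng ?_ ?_ ?_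
    | with_reducible refine pIsMin ?_ ?_
    | with_reducible refine pIsMax ?_ ?_
    | with_reducible refine pIn ?_ ?_
    | with_reducible refine pNe ?_ ?_
    | with_reducible refine pEq ?_ ?_
    | with_reducible refine pAll ?_ ?_
    | with_reducible refine pEx ?_ ?_
    | with_reducible refine pNot ?_
    | with_reducible refine pAnd ?_ ?_
    | with_reducible refine pOr ?_ ?_
    | with_reducible refine pImp ?_ ?_
    | fun_prop

theorem pClo {N : α → ℕ} {D : α → List Item} {a : α → Ltr} {b : α → Ltr} {it : α → Item}
    (hN : Primrec N) (hD : Primrec D) (ha : Primrec a) (hb : Primrec b) (hit : Primrec it) : PrimrecPred fun x => Clo (N x) (D x) (a x) (b x) (it x) := by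
  unfold Clo
  repeat' first
    | with_reducible refine pSplitT ?_ ?_ ?_ ?_ ?_ ?_
    | with_reducible refine pSplitV ?_ ?_ ?_ ?_ ?_
    | with_reducible refine pSplitH ?_ ?_ ?_ ?_ ?_
    | with_reducible refine pSpl ?_ ?_ ?_ ?_
    | with_reducible refine pCloBase ?_ ?_ ?_ ?_
    | with_reducible refine pL2 ?_ ?_
    | with_reducible refine pL3 ?_ ?_
    | with_reducible refine pLe ?_ ?_
    | with_reducible refine pRl ?_ ?_
    | with_reducible refine pMem ?_ ?_
    | with_reducible refine pAdm ?_ ?_ ?_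
    | with_reducible refine pB ?_ ?_ ?_ ?_
    | with_reducible refine pRng ?_ ?_ ?_
    | with_reducible refine pIsMin ?_ ?_
    | with_reducible refine pIsMax ?_ ?_
    | with_reducible refine pIn ?_ ?_
    | with_reducible refine pNe ?_ ?_
    | with_reducible refine pEq ?_ ?_
    | with_reducible refine pAll ?_ ?_
    | with_reducible refine pEx ?_ ?_
    | with_reducible refine pNot ?_
    | with_reducible refine pAnd ?_ ?_
    | with_reducible refine pOr ?_ ?_
    | with_reducible refine pImp ?_ ?_
    | fun_prop

theorem pMk {D : α → List Item} {it : α → Item} {i : α → ℕ}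
    (hD : Primrec D) (hit : Primrec it) (hi : Primrec i) : PrimrecPred fun x => Mk (D x) (it x) (i x) := by
  unfold Mk
  repeat' first
    | with_reducible refine pSplitT ?_ ?_ ?_ ?_ ?_ ?_
    | with_reducible refine pSplitV ?_ ?_ ?_ ?_ ?_
    | with_reducible refine pSplitH ?_ ?_ ?_ ?_ ?_
    | with_reducible refine pSpl ?_ ?_ ?_ ?_
    | with_reducible refine pCloBase ?_ ?_ ?_ ?_
    | with_reducible refine pClo ?_ ?_ ?_ ?_ ?_
    | with_reducible refine pL2 ?_ ?_
    | with_reducible refine pL3 ?_ ?_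
    | with_reducible refine pLe ?_ ?_
    | with_reducible refine pRl ?_ ?_
    | with_reducible refine pMem ?_ ?_
    | with_reducible refine pAdm ?_ ?_ ?_
    | with_reducible refine pB ?_ ?_ ?_ ?_
    | with_reducible refine pRng ?_ ?_ ?_
    | with_reducible refine pIsMin ?_ ?_
    | with_reducible refine pIsMax ?_ ?_
    | with_reducible refine pIn ?_ ?_
    | with_reducible refine pNe ?_ ?_
    | with_reducible refine pEq ?_ ?_
    | with_reducible refine pAll ?_ ?_
    | with_reducible refine pEx ?_ ?_
    | with_reducible refine pNot ?_
    | with_reducible refine pAnd ?_ ?_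
    | with_reducible refine pOr ?_ ?_
    | with_reducible refine pImp ?_ ?_
    | fun_prop

theorem pDem {N : α → ℕ} {D : α → List Item} {it : α → Item} {i : α → ℕ}
    (hN : Primrec N) (hD : Primrec D) (hit : Primrec it) (hi : Primrec i) : PrimrecPred fun x => Dem (N x) (D x) (it x) (i x) := by
  unfold Dem
  repeat' first
    | with_reducible refine pSplitT ?_ ?_ ?_ ?_ ?_ ?_
    | with_reducible refine pSplitV ?_ ?_ ?_ ?_ ?_
    | with_reducible refine pSplitH ?_ ?_ ?_ ?_ ?_
    | with_reducible refine pSpl ?_ ?_ ?_ ?_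
    | with_reducible refine pCloBase ?_ ?_ ?_ ?_
    | with_reducible refine pClo ?_ ?_ ?_ ?_ ?_
    | with_reducible refine pMk ?_ ?_ ?_
    | with_reducible refine pL2 ?_ ?_
    | with_reducible refine pL3 ?_ ?_
    | with_reducible refine pLe ?_ ?_
    | with_reducible refine pRl ?_ ?_
    | with_reducible refine pMem ?_ ?_
    | with_reducible refine pAdm ?_ ?_ ?_
    | with_reducible refine pB ?_ ?_ ?_ ?_
    | with_reducible refine pRng ?_ ?_ ?_
    | with_reducible refine pIsMin ?_ ?_
    | with_reducible refine pIsMax ?_ ?_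
    | with_reducible refine pIn ?_ ?_
    | with_reducible refine pNe ?_ ?_
    | with_reducible refine pEq ?_ ?_
    | with_reducible refine pAll ?_ ?_
    | with_reducible refine pEx ?_ ?_
    | with_reducible refine pNot ?_
    | with_reducible refine pAnd ?_ ?_
    | with_reducible refine pOr ?_ ?_
    | with_reducible refine pImp ?_ ?_
    | fun_prop

theorem pAllR {N : α → ℕ} {it : α → Item}
    (hN : Primrec N) (hit : Primrec it) : PrimrecPred fun x => AllR (N x) (it x) := by
  unfold AllR
  repeat' first
    | with_reducible refine pSplitT ?_ ?_ ?_ ?_ ?_ ?_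
    | with_reducible refine pSplitV ?_ ?_ ?_ ?_ ?_
    | with_reducible refine pSplitH ?_ ?_ ?_ ?_ ?_
    | with_reducible refine pSpl ?_ ?_ ?_ ?_
    | with_reducible refine pCloBase ?_ ?_ ?_ ?_
    | with_reducible refine pClo ?_ ?_ ?_ ?_ ?_
    | with_reducible refine pMk ?_ ?_ ?_
    | with_reducible refine pDem ?_ ?_ ?_ ?_
    | with_reducible refine pL2 ?_ ?_
    | with_reducible refine pL3 ?_ ?_
    | with_reducible refine pLe ?_ ?_
    | with_reducible refine pRl ?_ ?_
    | with_reducible refine pMem ?_ ?_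
    | with_reducible refine pAdm ?_ ?_ ?_
    | with_reducible refine pB ?_ ?_ ?_ ?_
    | with_reducible refine pRng ?_ ?_ ?_
    | with_reducible refine pIsMin ?_ ?_
    | with_reducible refine pIsMax ?_ ?_
    | with_reducible refine pIn ?_ ?_
    | with_reducible refine pNe ?_ ?_
    | with_reducible refine pEq ?_ ?_
    | with_reducible refine pAll ?_ ?_
    | with_reducible refine pEx ?_ ?_
    | with_reducible refine pNot ?_
    | with_reducible refine pAnd ?_ ?_
    | with_reducible refine pOr ?_ ?_
    | with_reducible refine pImp ?_ ?_
    | fun_prop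

theorem pGood {N : α → ℕ} {D : α → List Item} (hN : Primrec N) (hD : Primrec D) :
    PrimrecPred fun x => Good (N x) (D x) := by
  have cutV : PrimrecPred fun x => ∀ it ∈ (D x), ∀ h ∈ it.2.1, ∃ j1 ∈ (D x), ∃ j2 ∈ (D x), SplitV (N x) it h j1 j2 := by
    repeat' first
      | with_reducible refine pSplitT ?_ ?_ ?_ ?_ ?_ ?_
      | with_reducible refine pSplitV ?_ ?_ ?_ ?_ ?_
      | with_reducible refine pSplitH ?_ ?_ ?_ ?_ ?_
      | with_reducible refine pSpl ?_ ?_ ?_ ?_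
      | with_reducible refine pCloBase ?_ ?_ ?_ ?_
      | with_reducible refine pClo ?_ ?_ ?_ ?_ ?_
      | with_reducible refine pMk ?_ ?_ ?_
      | with_reducible refine pDem ?_ ?_ ?_ ?_
      | with_reducible refine pAllR ?_ ?_
      | with_reducible refine pL2 ?_ ?_
      | with_reducible refine pL3 ?_ ?_
      | with_reducible refine pLe ?_ ?_
      | with_reducible refine pRl ?_ ?_
      | with_reducible refine pMem ?_ ?_
      | with_reducible refine pAdm ?_ ?_ ?_
      | with_reducible refine pB ?_ ?_ ?_ ?_
      | with_reducible refine pRng ?_ ?_ ?_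
      | with_reducible refine pIsMin ?_ ?_
      | with_reducible refine pIsMax ?_ ?_
      | with_reducible refine pIn ?_ ?_
      | with_reducible refine pNe ?_ ?_
      | with_reducible refine pEq ?_ ?_
      | with_reducible refine pAll ?_ ?_
      | with_reducible refine pEx ?_ ?_
      | with_reducible refine pNot ?_
      | with_reducible refine pAnd ?_ ?_
      | with_reducible refine pOr ?_ ?_
      | with_reducible refine pImp ?_ ?_
      | fun_prop
  have cutH : PrimrecPred fun x => ∀ it ∈ (D x), ∀ h ∈ it.1, ∃ j1 ∈ (D x), ∃ j2 ∈ (D x), SplitH (N x) it h j1 j2 := by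
    repeat' first
      | with_reducible refine pSplitT ?_ ?_ ?_ ?_ ?_ ?_
      | with_reducible refine pSplitV ?_ ?_ ?_ ?_ ?_
      | with_reducible refine pSplitH ?_ ?_ ?_ ?_ ?_
      | with_reducible refine pSpl ?_ ?_ ?_ ?_
      | with_reducible refine pCloBase ?_ ?_ ?_ ?_
      | with_reducible refine pClo ?_ ?_ ?_ ?_ ?_
      | with_reducible refine pMk ?_ ?_ ?_
      | with_reducible refine pDem ?_ ?_ ?_ ?_
      | with_reducible refine pAllR ?_ ?_
      | with_reducible refine pL2 ?_ ?_
      | with_reducible refine pL3 ?_ ?_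
      | with_reducible refine pLe ?_ ?_
      | with_reducible refine pRl ?_ ?_
      | with_reducible refine pMem ?_ ?_
      | with_reducible refine pAdm ?_ ?_ ?_
      | with_reducible refine pB ?_ ?_ ?_ ?_
      | with_reducible refine pRng ?_ ?_ ?_
      | with_reducible refine pIsMin ?_ ?_
      | with_reducible refine pIsMax ?_ ?_
      | with_reducible refine pIn ?_ ?_
      | with_reducible refine pNe ?_ ?_
      | with_reducible refine pEq ?_ ?_
      | with_reducible refine pAll ?_ ?_
      | with_reducible refine pEx ?_ ?_
      | with_reducible refine pNot ?_
      | with_reducible refine pAnd ?_ ?_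
      | with_reducible refine pOr ?_ ?_
      | with_reducible refine pImp ?_ ?_
      | fun_prop
  have clo : PrimrecPred fun x => ∀ it ∈ (D x), AllR (N x) it → ∀ p ∈ it.1, ∀ q ∈ it.1, IsMin it.1 p → IsMax it.1 q →
        Clo (N x) (D x) p.1 q.2 it := by
    repeat' first
      | with_reducible refine pSplitT ?_ ?_ ?_ ?_ ?_ ?_
      | with_reducible refine pSplitV ?_ ?_ ?_ ?_ ?_
      | with_reducible refine pSplitH ?_ ?_ ?_ ?_ ?_
      | with_reducible refine pSpl ?_ ?_ ?_ ?_
      | with_reducible refine pCloBase ?_ ?_ ?_ ?_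
      | with_reducible refine pClo ?_ ?_ ?_ ?_ ?_
      | with_reducible refine pMk ?_ ?_ ?_
      | with_reducible refine pDem ?_ ?_ ?_ ?_
      | with_reducible refine pAllR ?_ ?_
      | with_reducible refine pL2 ?_ ?_
      | with_reducible refine pL3 ?_ ?_
      | with_reducible refine pLe ?_ ?_
      | with_reducible refine pRl ?_ ?_
      | with_reducible refine pMem ?_ ?_
      | with_reducible refine pAdm ?_ ?_ ?_
      | with_reducible refine pB ?_ ?_ ?_ ?_
      | with_reducible refine pRng ?_ ?_ ?_
      | with_reducible refine pIsMin ?_ ?_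
      | with_reducible refine pIsMax ?_ ?_
      | with_reducible refine pIn ?_ ?_
      | with_reducible refine pNe ?_ ?_
      | with_reducible refine pEq ?_ ?_
      | with_reducible refine pAll ?_ ?_
      | with_reducible refine pEx ?_ ?_
      | with_reducible refine pNot ?_
      | with_reducible refine pAnd ?_ ?_
      | with_reducible refine pOr ?_ ?_
      | with_reducible refine pImp ?_ ?_
      | fun_prop
  have demF : PrimrecPred fun x => ∀ it ∈ (D x), ∀ p ∈ it.1, ∀ q ∈ it.2.1, IsMin it.1 p → IsMin it.2.1 q → Rl (N x) p.1 → Rl (N x) q.1 →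
        ∀ i ∈ List.range ((N x) + 1), Mem i p.1.1 → ¬ Mem i p.2.1 → ¬ Mem i q.2.1 → Dem (N x) (D x) it i := by
    repeat' first
      | with_reducible refine pSplitT ?_ ?_ ?_ ?_ ?_ ?_
      | with_reducible refine pSplitV ?_ ?_ ?_ ?_ ?_
      | with_reducible refine pSplitH ?_ ?_ ?_ ?_ ?_
      | with_reducible refine pSpl ?_ ?_ ?_ ?_
      | with_reducible refine pCloBase ?_ ?_ ?_ ?_
      | with_reducible refine pClo ?_ ?_ ?_ ?_ ?_
      | with_reducible refine pMk ?_ ?_ ?_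
      | with_reducible refine pDem ?_ ?_ ?_ ?_
      | with_reducible refine pAllR ?_ ?_
      | with_reducible refine pL2 ?_ ?_
      | with_reducible refine pL3 ?_ ?_
      | with_reducible refine pLe ?_ ?_
      | with_reducible refine pRl ?_ ?_
      | with_reducible refine pMem ?_ ?_
      | with_reducible refine pAdm ?_ ?_ ?_
      | with_reducible refine pB ?_ ?_ ?_ ?_
      | with_reducible refine pRng ?_ ?_ ?_
      | with_reducible refine pIsMin ?_ ?_
      | with_reducible refine pIsMax ?_ ?_
      | with_reducible refine pIn ?_ ?_
      | with_reducible refine pNe ?_ ?_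
      | with_reducible refine pEq ?_ ?_
      | with_reducible refine pAll ?_ ?_
      | with_reducible refine pEx ?_ ?_
      | with_reducible refine pNot ?_
      | with_reducible refine pAnd ?_ ?_
      | with_reducible refine pOr ?_ ?_
      | with_reducible refine pImp ?_ ?_
      | fun_prop
  have demP : PrimrecPred fun x => ∀ it ∈ (D x), ∀ p ∈ it.1, ∀ q ∈ it.2.1, IsMax it.1 p → IsMax it.2.1 q → Rl (N x) p.2 → Rl (N x) q.2 →
        ∀ i ∈ List.range ((N x) + 1), Mem i p.2.2 → ¬ Mem i p.1.2 → ¬ Mem i q.1.2 → Dem (N x) (D x) it i := by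
    repeat' first
      | with_reducible refine pSplitT ?_ ?_ ?_ ?_ ?_ ?_
      | with_reducible refine pSplitV ?_ ?_ ?_ ?_ ?_
      | with_reducible refine pSplitH ?_ ?_ ?_ ?_ ?_
      | with_reducible refine pSpl ?_ ?_ ?_ ?_
      | with_reducible refine pCloBase ?_ ?_ ?_ ?_
      | with_reducible refine pClo ?_ ?_ ?_ ?_ ?_
      | with_reducible refine pMk ?_ ?_ ?_
      | with_reducible refine pDem ?_ ?_ ?_ ?_
      | with_reducible refine pAllR ?_ ?_
      | with_reducible refine pL2 ?_ ?_
      | with_reducible refine pL3 ?_ ?_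
      | with_reducible refine pLe ?_ ?_
      | with_reducible refine pRl ?_ ?_
      | with_reducible refine pMem ?_ ?_
      | with_reducible refine pAdm ?_ ?_ ?_
      | with_reducible refine pB ?_ ?_ ?_ ?_
      | with_reducible refine pRng ?_ ?_ ?_
      | with_reducible refine pIsMin ?_ ?_
      | with_reducible refine pIsMax ?_ ?_
      | with_reducible refine pIn ?_ ?_
      | with_reducible refine pNe ?_ ?_
      | with_reducible refine pEq ?_ ?_
      | with_reducible refine pAll ?_ ?_
      | with_reducible refine pEx ?_ ?_
      | with_reducible refine pNot ?_
      | with_reducible refine pAnd ?_ ?_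
      | with_reducible refine pOr ?_ ?_
      | with_reducible refine pImp ?_ ?_
      | fun_prop
  have insV : PrimrecPred fun x => ∀ it ∈ (D x), it.2.2 ≠ 0 →
        (∃ h ∈ it.2.1, ∃ j1 ∈ (D x), ∃ j2 ∈ (D x), SplitV (N x) it h j1 j2 ∧ j1.2.2 = it.2.2) ∧
        (∃ h ∈ it.2.1, ∃ j1 ∈ (D x), ∃ j2 ∈ (D x), SplitV (N x) it h j1 j2 ∧ j2.2.2 = it.2.2) := by
    repeat' first
      | with_reducible refine pSplitT ?_ ?_ ?_ ?_ ?_ ?_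
      | with_reducible refine pSplitV ?_ ?_ ?_ ?_ ?_
      | with_reducible refine pSplitH ?_ ?_ ?_ ?_ ?_
      | with_reducible refine pSpl ?_ ?_ ?_ ?_
      | with_reducible refine pCloBase ?_ ?_ ?_ ?_
      | with_reducible refine pClo ?_ ?_ ?_ ?_ ?_
      | with_reducible refine pMk ?_ ?_ ?_
      | with_reducible refine pDem ?_ ?_ ?_ ?_
      | with_reducible refine pAllR ?_ ?_
      | with_reducible refine pL2 ?_ ?_
      | with_reducible refine pL3 ?_ ?_
      | with_reducible refine pLe ?_ ?_
      | with_reducible refine pRl ?_ ?_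
      | with_reducible refine pMem ?_ ?_
      | with_reducible refine pAdm ?_ ?_ ?_
      | with_reducible refine pB ?_ ?_ ?_ ?_
      | with_reducible refine pRng ?_ ?_ ?_
      | with_reducible refine pIsMin ?_ ?_
      | with_reducible refine pIsMax ?_ ?_
      | with_reducible refine pIn ?_ ?_
      | with_reducible refine pNe ?_ ?_
      | with_reducible refine pEq ?_ ?_
      | with_reducible refine pAll ?_ ?_
      | with_reducible refine pEx ?_ ?_
      | with_reducible refine pNot ?_
      | with_reducible refine pAnd ?_ ?_
      | with_reducible refine pOr ?_ ?_
      | with_reducible refine pImp ?_ ?_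
      | fun_prop
  have insH : PrimrecPred fun x => ∀ it ∈ (D x), it.2.2 ≠ 0 →
        (∃ h ∈ it.1, ∃ j1 ∈ (D x), ∃ j2 ∈ (D x), SplitH (N x) it h j1 j2 ∧ j1.2.2 = it.2.2) ∧
        (∃ h ∈ it.1, ∃ j1 ∈ (D x), ∃ j2 ∈ (D x), SplitH (N x) it h j1 j2 ∧ j2.2.2 = it.2.2) := by
    repeat' first
      | with_reducible refine pSplitT ?_ ?_ ?_ ?_ ?_ ?_
      | with_reducible refine pSplitV ?_ ?_ ?_ ?_ ?_
      | with_reducible refine pSplitH ?_ ?_ ?_ ?_ ?_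
      | with_reducible refine pSpl ?_ ?_ ?_ ?_
      | with_reducible refine pCloBase ?_ ?_ ?_ ?_
      | with_reducible refine pClo ?_ ?_ ?_ ?_ ?_
      | with_reducible refine pMk ?_ ?_ ?_
      | with_reducible refine pDem ?_ ?_ ?_ ?_
      | with_reducible refine pAllR ?_ ?_
      | with_reducible refine pL2 ?_ ?_
      | with_reducible refine pL3 ?_ ?_
      | with_reducible refine pLe ?_ ?_
      | with_reducible refine pRl ?_ ?_
      | with_reducible refine pMem ?_ ?_
      | with_reducible refine pAdm ?_ ?_ ?_
      | with_reducible refine pB ?_ ?_ ?_ ?_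
      | with_reducible refine pRng ?_ ?_ ?_
      | with_reducible refine pIsMin ?_ ?_
      | with_reducible refine pIsMax ?_ ?_
      | with_reducible refine pIn ?_ ?_
      | with_reducible refine pNe ?_ ?_
      | with_reducible refine pEq ?_ ?_
      | with_reducible refine pAll ?_ ?_
      | with_reducible refine pEx ?_ ?_
      | with_reducible refine pNot ?_
      | with_reducible refine pAnd ?_ ?_
      | with_reducible refine pOr ?_ ?_
      | with_reducible refine pImp ?_ ?_
      | fun_prop
  refine (pAnd cutV (pAnd cutH (pAnd clo (pAnd demF (pAnd demP (pAnd insV insH)))))).of_eq fun x => ?_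
  simp only [List.mem_range]
  exact ⟨fun ⟨a, b, c, d, e, f, g⟩ => ⟨a, b, c, d, e, f, g⟩, fun ⟨a, b, c, d, e, f, g⟩ => ⟨a, b, c, d, e, f, g⟩⟩

theorem rBot {N : α → ℕ} (hN : Primrec N) : Primrec fun x => [(bot (N x), top (N x))] := by
  have h : Primrec fun x => 2 ^ (N x + 1) - 1 := Primrec.nat_sub.comp (by fun_prop) (Primrec.const 1)
  unfold bot top
  exact Primrec.list_cons.comp (by fun_prop) (Primrec.const [])

theorem pCert : PrimrecPred fun n : ℕ => Cert (Nat.pair 1 n + 1) (Nat.pair 1 n) := by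
  have h : Primrec fun n : ℕ => Nat.pair 1 n := Primrec₂.natPair.comp (Primrec.const 1) Primrec.id
  unfold Cert
  refine pEx (pAnd (pGood (by fun_prop) (by fun_prop)) (pEx (pAnd (pEq (by fun_prop) (rBot ?_)) (pAnd (pEq (by fun_prop) (rBot ?_)) (pMem ?_ (by fun_prop)))) (by fun_prop))) (by fun_prop)
  all_goals fun_prop

end Comb2
end TL

theorem validity_decidable_sltRefl :
    ∃ f : ℕ → Bool, Computable f ∧ ∀ φ : Formula, (f φ.enc = true ↔ Valid sltRefl φ) := by
  classical
  refine ⟨fun n => decide (¬ TL.Cert (Nat.pair 1 n + 1) (Nat.pair 1 n)), ?_, fun φ => ?_⟩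
  · exact (PrimrecPred.decide (TL.pNot TL.pCert)).to_comp
  · rw [decide_eq_true_eq, TL.valid_iff]
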